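/- arXiv:1311.1409 — 2 statements merged into one kernel-verified Lean document; each statement's English description precedes it below -/
import Mathlib

section
/- Let m and t ≥ 6 be positive integers with C(t−1,3) ≤ m ≤ C(t−1,3) + C(t−2,2). If G is a 3-uniform hypergraph with m edges that contains K_{t−1}^{(3)−} (a complete 3-graph on t−1 vertices minus one edge) but does not contain a complete 3-graph on t−1 vertices, then λ(G) < λ([t−1]^{(3)}). -/
open Finset

/-- The polynomial λ(G, w) = Σ_{e ∈ E} Π_{i ∈ e} w i. -/
def lagPoly (E : Finset (Finset ℕ)) (w : ℕ → ℝ) : ℝ :=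
  ∑ e ∈ E, ∏ i ∈ e, w i

/-- A feasible weighting on vertex set [n] = {0, …, n-1}. -/
def IsWeighting (n : ℕ) (w : ℕ → ℝ) : Prop :=
  (∀ i, 0 ≤ w i) ∧ (∀ i, n ≤ i → w i = 0) ∧ ∑ i ∈ Finset.range n, w i = 1

/-- The Lagrangian of a hypergraph with edge set `E`. -/
noncomputable def lag (E : Finset (Finset ℕ)) : ℝ :=
  sSup {x | ∃ n w, IsWeighting n w ∧ x = lagPoly E w}

/-- The complete r-uniform hypergraph on vertex set {0, …, t-1}. -/
def completeG (t r : ℕ) : Finset (Finset ℕ) :=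
  (Finset.range t).powersetCard r

/-- `w` is an optimal weighting for `E`. -/
def IsOpt (E : Finset (Finset ℕ)) (n : ℕ) (w : ℕ → ℝ) : Prop :=
  IsWeighting n w ∧ ∀ n' w', IsWeighting n' w' → lagPoly E w' ≤ lagPoly E w

/-- Partial derivative of the Lagrange polynomial. -/
def pd (E : Finset (Finset ℕ)) (w : ℕ → ℝ) (i : ℕ) : ℝ :=
  ∑ e ∈ E, if i ∈ e then ∏ j ∈ e.erase i, w j else 0

/-- Link of a vertex. -/
def lnk (E : Finset (Finset ℕ)) (i : ℕ) : Finset (Finset ℕ) :=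
  (E.filter (fun e => i ∈ e)).image (fun e => e.erase i)

lemma pd_eq_lnk (E : Finset (Finset ℕ)) (w : ℕ → ℝ) (i : ℕ) :
    pd E w i = lagPoly (lnk E i) w := by
  unfold pd lagPoly lnk
  rw [Finset.sum_image, Finset.sum_filter]
  intro a ha b hb hab
  simp only [Finset.coe_filter, Set.mem_ofPred_eq] at ha hb
  have := congrArg (insert i) hab
  simpa [Finset.insert_erase ha.2, Finset.insert_erase hb.2] using this

lemma lagPoly_nonneg (E : Finset (Finset ℕ)) (w : ℕ → ℝ) (hw : ∀ i, 0 ≤ w i) :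
    0 ≤ lagPoly E w :=
  Finset.sum_nonneg fun _ _ => Finset.prod_nonneg fun i _ => hw i

lemma lagPoly_mono_set {E E' : Finset (Finset ℕ)} (h : E ⊆ E') (w : ℕ → ℝ)
    (hw : ∀ i, 0 ≤ w i) : lagPoly E w ≤ lagPoly E' w :=
  Finset.sum_le_sum_of_subset_of_nonneg h fun _ _ _ => Finset.prod_nonneg fun i _ => hw i

lemma lagPoly_mono (E : Finset (Finset ℕ)) (w w' : ℕ → ℝ) (hw : ∀ i, 0 ≤ w i)
    (h : ∀ e ∈ E, ∀ i ∈ e, w i ≤ w' i) : lagPoly E w ≤ lagPoly E w' :=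
  Finset.sum_le_sum fun e he => Finset.prod_le_prod (fun i _ => hw i) (h e he)

lemma lagPoly_update (E : Finset (Finset ℕ)) (w : ℕ → ℝ) (p : ℕ) (a : ℝ) :
    lagPoly E (Function.update w p a) = lagPoly E w + (a - w p) * pd E w p := by
  unfold lagPoly pd
  rw [Finset.mul_sum, ← Finset.sum_add_distrib]
  refine Finset.sum_congr rfl fun e _ => ?_
  split_ifs with h
  · rw [← Finset.mul_prod_erase e _ h, ← Finset.mul_prod_erase e w h]
    have : ∏ x ∈ e.erase p, Function.update w p a x = ∏ x ∈ e.erase p, w x := by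
      refine Finset.prod_congr rfl fun x hx => ?_
      rw [Function.update_of_ne (Finset.ne_of_mem_erase hx)]
    rw [this]; simp; ring
  · rw [mul_zero, add_zero]
    refine Finset.prod_congr rfl fun x hx => ?_
    rw [Function.update_of_ne]
    rintro rfl; exact h hx

/-- moving weight `t` from `q` to `p`. -/
lemma lagPoly_move (E : Finset (Finset ℕ)) (w : ℕ → ℝ) (p q : ℕ) (hpq : p ≠ q) (t : ℝ) :
    lagPoly E (Function.update (Function.update w p (w p + t)) q (w q - t)) =
      lagPoly E w + t * (pd E w p - pd E w q) - t ^ 2 * pd (lnk E q) w p := by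
  rw [lagPoly_update, lagPoly_update, pd_eq_lnk E _ q, lagPoly_update, ← pd_eq_lnk,
    Function.update_of_ne hpq.symm]
  ring

lemma move_isWeighting {n : ℕ} {w : ℕ → ℝ} (hw : IsWeighting n w) (p q : ℕ) (hpq : p ≠ q)
    (hp : 0 < w p) (t : ℝ) (ht : 0 ≤ t) (htq : t ≤ w q) (hq : 0 < w q) :
    IsWeighting n (Function.update (Function.update w p (w p + t)) q (w q - t)) := by
  obtain ⟨h0, h1, h2⟩ := hw
  have hpn : p < n := by by_contra h; have := h1 p (by omega); linarith
  have hqn : q < n := by by_contra h; have := h1 q (by omega); linarith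
  refine ⟨fun i => ?_, fun i hi => ?_, ?_⟩
  · by_cases hiq : i = q
    · subst hiq; simp; linarith
    · rw [Function.update_of_ne hiq]
      by_cases hip : i = p
      · subst hip; simp; linarith
      · rw [Function.update_of_ne hip]; exact h0 i
  · rw [Function.update_of_ne (by omega), Function.update_of_ne (by omega)]; exact h1 i hi
  · have hqm : q ∈ Finset.range n := by simpa
    have hpm : p ∈ (Finset.range n) \ {q} := by simp [hpn, hpq]
    rw [Finset.sum_update_of_mem hqm, Finset.sum_update_of_mem hpm]
    rw [← Finset.sum_sdiff (Finset.singleton_subset_iff.2 hqm),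
      ← Finset.sum_sdiff (Finset.singleton_subset_iff.2 hpm)] at h2
    simp only [Finset.sum_singleton] at h2
    linarith

lemma kkt_le {E : Finset (Finset ℕ)} {n : ℕ} {w : ℕ → ℝ} (h : IsOpt E n w) (p q : ℕ)
    (hp : 0 < w p) (hq : 0 < w q) : pd E w p ≤ pd E w q := by
  by_cases hpq : p = q
  · subst hpq; exact le_rfl
  by_contra hlt
  push Not at hlt
  set d := pd E w p - pd E w q with hd
  set c := pd (lnk E q) w p with hc
  have hd0 : 0 < d := by linarith
  have hc0 : 0 ≤ c := by rw [hc, pd_eq_lnk]; exact lagPoly_nonneg _ _ h.1.1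
  have key : ∀ t, 0 ≤ t → t ≤ w q → t * d - t ^ 2 * c ≤ 0 := by
    intro t ht htq
    have := h.2 _ _ (move_isWeighting h.1 p q hpq hp t ht htq hq)
    rw [lagPoly_move E w p q hpq t] at this
    linarith
  have h1 := key (min (w q) (d / (c + 1))) (by positivity) (min_le_left _ _)
  set t := min (w q) (d / (c + 1)) with htd
  have ht0 : 0 < t := by rw [htd]; exact lt_min hq (by positivity)
  have h2 : t ≤ d / (c + 1) := min_le_right _ _
  rw [le_div_iff₀ (by linarith)] at h2
  nlinarith

lemma kkt_eq {E : Finset (Finset ℕ)} {n : ℕ} {w : ℕ → ℝ} (h : IsOpt E n w) (p q : ℕ)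
    (hp : 0 < w p) (hq : 0 < w q) : pd E w p = pd E w q :=
  le_antisymm (kkt_le h p q hp hq) (kkt_le h q p hq hp)

lemma euler {E : Finset (Finset ℕ)} (hE : ∀ e ∈ E, e.card = 3) {n : ℕ} {w : ℕ → ℝ}
    (h : IsWeighting n w) : ∑ i ∈ Finset.range n, w i * pd E w i = 3 * lagPoly E w := by
  unfold pd lagPoly
  simp_rw [Finset.mul_sum]
  rw [Finset.sum_comm]
  refine Finset.sum_congr rfl fun e he => ?_
  have h1 : ∀ i ∈ Finset.range n, (w i * if i ∈ e then ∏ j ∈ e.erase i, w j else 0)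
      = if i ∈ e then ∏ j ∈ e, w j else 0 := by
    intro i _
    split_ifs with hi
    · exact Finset.mul_prod_erase e w hi
    · simp
  rw [Finset.sum_congr rfl h1, ← Finset.sum_filter, Finset.sum_const, nsmul_eq_mul]
  by_cases hs : e ⊆ Finset.range n
  · have : (Finset.range n).filter (fun i => i ∈ e) = e := by
      ext i; simp only [Finset.mem_filter]; exact ⟨fun h => h.2, fun h => ⟨hs h, h⟩⟩
    rw [this, hE e he]; norm_num
  · obtain ⟨i, hi, hin⟩ := Finset.not_subset.1 hs
    have : ∏ j ∈ e, w j = 0 := Finset.prod_eq_zero hi (h.2.1 i (by simpa using hin))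
    rw [this]; ring

lemma kkt {E : Finset (Finset ℕ)} (hE : ∀ e ∈ E, e.card = 3) {n : ℕ} {w : ℕ → ℝ}
    (h : IsOpt E n w) (p : ℕ) (hp : 0 < w p) : pd E w p = 3 * lagPoly E w := by
  rw [← euler hE h.1]
  have : ∀ i ∈ Finset.range n, w i * pd E w i = w i * pd E w p := by
    intro i _
    rcases (h.1.1 i).eq_or_lt with h0 | h0
    · rw [← h0]; simp
    · rw [kkt_eq h i p h0 hp]
  rw [Finset.sum_congr rfl this, ← Finset.sum_mul, h.1.2.2, one_mul]

lemma attain (E : Finset (Finset ℕ)) : ∃ n w, IsOpt E n w := by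
  set n := (E.sup id).sup id + 1 with hn
  have hlt : ∀ e ∈ E, ∀ i ∈ e, i < n := by
    intro e he i hi
    have h1 : i ∈ E.sup id := by
      rw [Finset.mem_sup]; exact ⟨e, he, hi⟩
    have := Finset.le_sup (f := id) h1
    simp only [id] at this
    omega
  let K : Set (ℕ → ℝ) := Set.pi Set.univ (fun _ => Set.Icc (0:ℝ) 1)
  have hK : IsCompact K := isCompact_univ_pi fun _ => isCompact_Icc
  let C : Set (ℕ → ℝ) := {w | (∀ i, n ≤ i → w i = 0) ∧ ∑ i ∈ Finset.range n, w i = 1}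
  have hC : IsClosed C := by
    have h1 : IsClosed {w : ℕ → ℝ | ∀ i, n ≤ i → w i = 0} := by
      simp only [Set.ofPred_forall]
      exact isClosed_iInter fun i => isClosed_iInter fun _ =>
        isClosed_eq (continuous_apply i) continuous_const
    have h2 : IsClosed {w : ℕ → ℝ | ∑ i ∈ Finset.range n, w i = 1} :=
      isClosed_eq (by fun_prop) continuous_const
    exact h1.inter h2
  have hKC : IsCompact (K ∩ C) := hK.inter_right hC
  have hmem : ∀ w, w ∈ K ∩ C ↔ IsWeighting n w := by
    intro w
    constructor
    · rintro ⟨hk, hc⟩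
      exact ⟨fun i => (hk i trivial).1, hc.1, hc.2⟩
    · rintro ⟨h0, h1, h2⟩
      refine ⟨fun i _ => ⟨h0 i, ?_⟩, h1, h2⟩
      by_cases hi : i < n
      · rw [← h2]
        exact Finset.single_le_sum (f := w) (fun j _ => h0 j) (by simpa)
      · rw [h1 i (by omega)]; norm_num
  have hne : (K ∩ C).Nonempty := by
    refine ⟨Pi.single 0 1, (hmem _).2 ⟨fun i => ?_, fun i hi => ?_, ?_⟩⟩
    · by_cases h : i = 0
      · subst h; simp
      · simp [Pi.single_eq_of_ne h]
    · rw [Pi.single_eq_of_ne (by omega)]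
    · rw [Finset.sum_eq_single 0]
      · simp
      · intro b _ hb; rw [Pi.single_eq_of_ne hb]
      · intro h; simp [hn] at h
  have hcont : Continuous (lagPoly E) := by
    unfold lagPoly; fun_prop
  obtain ⟨w, hw, hmax⟩ := hKC.exists_isMaxOn hne hcont.continuousOn
  refine ⟨n, w, (hmem w).1 hw, ?_⟩
  intro n' w' hw'
  obtain ⟨h0, h1, h2⟩ := hw'
  set r := ∑ i ∈ Finset.range n, w' i with hr
  have hr1 : r ≤ 1 := by
    rw [← h2]
    calc r = ∑ i ∈ (Finset.range n).filter (fun i => i < n'), w' i := by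
          rw [hr, Finset.sum_filter]
          refine Finset.sum_congr rfl fun i _ => ?_
          split_ifs with h
          · rfl
          · exact h1 i (by omega)
      _ ≤ _ := by
          apply Finset.sum_le_sum_of_subset_of_nonneg
          · intro i; simp
          · intro i _ _; exact h0 i
  let w'' : ℕ → ℝ := fun i => if i < n then w' i + (if i = 0 then 1 - r else 0) else 0
  have hw'' : IsWeighting n w'' := by
    refine ⟨fun i => ?_, fun i hi => ?_, ?_⟩
    · have := h0 i
      simp only [w'']; split_ifs <;> linarith
    · simp only [w'']; rw [if_neg (by omega)]
    · have : ∀ i ∈ Finset.range n, w'' i = w' i + (if i = 0 then 1 - r else 0) := by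
        intro i hi; simp only [w'']; rw [if_pos (by simpa using hi)]
      rw [Finset.sum_congr rfl this, Finset.sum_add_distrib, Finset.sum_ite_eq', if_pos (by simp [hn])]
      linarith
  calc lagPoly E w' ≤ lagPoly E w'' := by
        apply lagPoly_mono _ _ _ h0
        intro e he i hi
        simp only [w'']; rw [if_pos (hlt e he i hi)]
        split_ifs <;> linarith
    _ ≤ _ := hmax ((hmem _).2 hw'')

lemma lag_eq {E : Finset (Finset ℕ)} {n : ℕ} {w : ℕ → ℝ} (h : IsOpt E n w) :
    lag E = lagPoly E w := by
  apply le_antisymm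
  · have hne : {x | ∃ n w, IsWeighting n w ∧ x = lagPoly E w}.Nonempty := ⟨_, n, w, h.1, rfl⟩
    refine csSup_le hne ?_
    rintro x ⟨n', w', hw', rfl⟩
    exact h.2 _ _ hw'
  · apply le_csSup
    · exact ⟨lagPoly E w, by rintro x ⟨n', w', hw', rfl⟩; exact h.2 _ _ hw'⟩
    · exact ⟨n, w, h.1, rfl⟩

lemma powersetCard_succ_empty' (k : ℕ) (hk : 0 < k) : (∅ : Finset ℕ).powersetCard k = ∅ := by
  rw [Finset.powersetCard_eq_empty]; simpa using hk

lemma lagPoly_insert (A : Finset ℕ) (a : ℕ) (ha : a ∉ A) (k : ℕ) (w : ℕ → ℝ) :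
    lagPoly ((insert a A).powersetCard (k + 1)) w =
      lagPoly (A.powersetCard (k + 1)) w + w a * lagPoly (A.powersetCard k) w := by
  unfold lagPoly
  rw [Finset.powersetCard_succ_insert ha, Finset.sum_union, Finset.sum_image, Finset.mul_sum]
  · congr 1
    refine Finset.sum_congr rfl fun e he => ?_
    rw [Finset.prod_insert]
    intro h; exact ha ((Finset.mem_powersetCard.1 he).1 h)
  · intro s hs t ht hst
    have hs' : a ∉ s := fun h => ha ((Finset.mem_powersetCard.1 hs).1 h)
    have ht' : a ∉ t := fun h => ha ((Finset.mem_powersetCard.1 ht).1 h)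
    have := congrArg (fun x => x.erase a) hst
    simpa [Finset.erase_insert hs', Finset.erase_insert ht'] using this
  · rw [Finset.disjoint_left]
    intro s hs hs'
    obtain ⟨t, _, rfl⟩ := Finset.mem_image.1 hs'
    exact ha ((Finset.mem_powersetCard.1 hs).1 (Finset.mem_insert_self _ _))

lemma e1_eq (A : Finset ℕ) (w : ℕ → ℝ) : lagPoly (A.powersetCard 1) w = ∑ i ∈ A, w i := by
  induction A using Finset.induction_on with
  | empty => simp [lagPoly, powersetCard_succ_empty']
  | insert a A ha ih =>
    rw [lagPoly_insert A a ha 0, ih, Finset.sum_insert ha]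
    simp [lagPoly]; ring

lemma e2_eq (A : Finset ℕ) (w : ℕ → ℝ) :
    2 * lagPoly (A.powersetCard 2) w = (∑ i ∈ A, w i) ^ 2 - ∑ i ∈ A, w i ^ 2 := by
  induction A using Finset.induction_on with
  | empty => simp [lagPoly, powersetCard_succ_empty']
  | insert a A ha ih =>
    rw [lagPoly_insert A a ha 1, mul_add, ih, Finset.sum_insert ha, Finset.sum_insert ha, e1_eq]
    ring

lemma e3_eq (A : Finset ℕ) (w : ℕ → ℝ) :
    6 * lagPoly (A.powersetCard 3) w = (∑ i ∈ A, w i) ^ 3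
      - 3 * (∑ i ∈ A, w i) * (∑ i ∈ A, w i ^ 2) + 2 * ∑ i ∈ A, w i ^ 3 := by
  induction A using Finset.induction_on with
  | empty => simp [lagPoly, powersetCard_succ_empty']
  | insert a A ha ih =>
    have h2 := e2_eq A w
    rw [lagPoly_insert A a ha 2, mul_add, ih, Finset.sum_insert ha, Finset.sum_insert ha,
      Finset.sum_insert ha]
    linear_combination 3 * w a * h2

lemma choose3 (n : ℕ) : (6:ℝ) * (n.choose 3 : ℝ) = n * (n - 1) * (n - 2) := by
  have := e3_eq (Finset.range n) (fun _ => 1)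
  simp [lagPoly] at this
  rw [this]; ring

lemma choose2 (n : ℕ) : (2:ℝ) * (n.choose 2 : ℝ) = n * (n - 1) := by
  have := e2_eq (Finset.range n) (fun _ => 1)
  simp [lagPoly] at this
  rw [this]; ring

/-- The Lagrangian of the complete 3-graph on `n` vertices. -/
noncomputable def Lam (n : ℕ) : ℝ := (n.choose 3 : ℝ) / (n : ℝ) ^ 3

lemma Lam_eq (n : ℕ) (hn : 1 ≤ n) : 6 * Lam n = ((n:ℝ) - 1) * (n - 2) / (n:ℝ) ^ 2 := by
  have h := choose3 n
  have : (n:ℝ) ≠ 0 := by positivity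
  unfold Lam
  rw [← mul_div_assoc, h]; field_simp

lemma Lam_le_lag (n : ℕ) (hn : 1 ≤ n) : Lam n ≤ lag (completeG n 3) := by
  obtain ⟨N, w, h⟩ := attain (completeG n 3)
  rw [lag_eq h]
  let u : ℕ → ℝ := fun i => if i < n then 1 / (n:ℝ) else 0
  have hn0 : (n:ℝ) ≠ 0 := by positivity
  have hu : IsWeighting n u := by
    refine ⟨fun i => ?_, fun i hi => ?_, ?_⟩
    · simp only [u]; split_ifs <;> positivity
    · simp only [u]; rw [if_neg (by omega)]
    · rw [Finset.sum_congr rfl (g := fun _ => 1 / (n:ℝ))]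
      · simp; field_simp
      · intro i hi; simp only [u]; rw [if_pos (by simpa using hi)]
  refine le_trans (le_of_eq ?_) (h.2 _ _ hu)
  unfold lagPoly completeG Lam
  rw [Finset.sum_congr rfl (g := fun _ => (1 / (n:ℝ)) ^ 3)]
  · simp [div_eq_mul_inv]
  · intro e he
    obtain ⟨he, hc⟩ := Finset.mem_powersetCard.1 he
    rw [Finset.prod_congr rfl (g := fun _ => 1 / (n:ℝ)), Finset.prod_const, hc]
    intro i hi; simp only [u]; rw [if_pos (by simpa using he hi)]

lemma e3_id (A : Finset ℕ) (w : ℕ → ℝ) (n : ℕ) (hn : 1 ≤ n) (hA : A.card = n)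
    (hs : ∑ i ∈ A, w i = 1) :
    6 * Lam n - 6 * lagPoly (A.powersetCard 3) w =
      ∑ i ∈ A, (w i - 1 / n) ^ 2 * (3 - 2 * (w i + 2 / n)) := by
  have hn0 : (n:ℝ) ≠ 0 := by positivity
  rw [e3_eq, hs, Lam_eq n hn]
  have : ∀ i ∈ A, (w i - 1 / n) ^ 2 * (3 - 2 * (w i + 2 / n)) =
      3 * w i ^ 2 - 2 * w i ^ 3 + (6 / (n:ℝ) ^ 2 - 6 / n) * w i + (3 / (n:ℝ) ^ 2 - 4 / (n:ℝ) ^ 3) := by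
    intro i _; field_simp; ring
  rw [Finset.sum_congr rfl this, Finset.sum_add_distrib, Finset.sum_add_distrib,
    Finset.sum_sub_distrib, ← Finset.mul_sum, ← Finset.mul_sum, ← Finset.mul_sum, hs]
  simp only [Finset.sum_const, hA, nsmul_eq_mul]
  field_simp; ring

lemma e3_le (A : Finset ℕ) (w : ℕ → ℝ) (n : ℕ) (hn : 5 ≤ n) (hA : A.card = n)
    (h0 : ∀ i, 0 ≤ w i) (hs : ∑ i ∈ A, w i = 1) :
    lagPoly (A.powersetCard 3) w ≤ Lam n ∧
      (Lam n ≤ lagPoly (A.powersetCard 3) w → ∀ i ∈ A, w i = 1 / n) := by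
  have hid := e3_id A w n (by omega) hA hs
  have hn' : (2:ℝ) / n ≤ 2 / 5 := by
    apply div_le_div_of_nonneg_left <;> norm_num; exact_mod_cast hn
  have hpos : ∀ i ∈ A, 0 < 3 - 2 * (w i + 2 / n) := by
    intro i hi
    have : w i ≤ 1 := by rw [← hs]; exact Finset.single_le_sum (fun j _ => h0 j) hi
    linarith
  have hnn : ∀ i ∈ A, 0 ≤ (w i - 1 / n) ^ 2 * (3 - 2 * (w i + 2 / n)) := fun i hi =>
    mul_nonneg (sq_nonneg _) (hpos i hi).le
  have := Finset.sum_nonneg hnn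
  refine ⟨by linarith, fun hge i hi => ?_⟩
  have hz : ∑ i ∈ A, (w i - 1 / n) ^ 2 * (3 - 2 * (w i + 2 / n)) = 0 := by linarith
  have := (Finset.sum_eq_zero_iff_of_nonneg hnn).1 hz i hi
  rcases mul_eq_zero.1 this with h | h
  · have := pow_eq_zero_iff (two_ne_zero) |>.1 h; linarith
  · have := hpos i hi; linarith

lemma lagPoly_restrict (E : Finset (Finset ℕ)) (w : ℕ → ℝ) (A : Finset ℕ)
    (hA : ∀ i, i ∉ A → w i = 0) : lagPoly E w = lagPoly (E.filter (fun e => e ⊆ A)) w := by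
  unfold lagPoly
  rw [Finset.sum_filter]
  refine Finset.sum_congr rfl fun e _ => ?_
  split_ifs with h
  · rfl
  · obtain ⟨i, hi, hin⟩ := Finset.not_subset.1 h
    exact Finset.prod_eq_zero hi (hA i hin)

lemma pd_le {E : Finset (Finset ℕ)} (hE : ∀ e ∈ E, e.card = 3) {n : ℕ} {w : ℕ → ℝ}
    (h : IsWeighting n w) (i : ℕ) :
    pd E w i ≤ lagPoly (((Finset.range n).erase i).powersetCard 2) w := by
  rw [pd_eq_lnk, lagPoly_restrict _ w (Finset.range n) (fun j hj => h.2.1 j (by simpa using hj))]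
  apply lagPoly_mono_set _ _ h.1
  intro e he
  obtain ⟨he, hs⟩ := Finset.mem_filter.1 he
  obtain ⟨f, hf, rfl⟩ := Finset.mem_image.1 he
  obtain ⟨hf, hif⟩ := Finset.mem_filter.1 hf
  rw [Finset.mem_powersetCard]
  refine ⟨fun j hj => Finset.mem_erase.2 ⟨Finset.ne_of_mem_erase hj, hs hj⟩, ?_⟩
  rw [Finset.card_erase_of_mem hif, hE f hf]

lemma p2_le {E : Finset (Finset ℕ)} (hE : ∀ e ∈ E, e.card = 3) {N : ℕ} {w : ℕ → ℝ}
    (h : IsOpt E N w) (n : ℕ) (hn : 5 ≤ n) (hl : Lam n ≤ lagPoly E w) :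
    ∑ i ∈ Finset.range N, w i ^ 2 ≤ 1 / n := by
  have hn5 : (5:ℝ) ≤ n := by exact_mod_cast hn
  have hne : (Finset.range N).Nonempty := by
    rw [Finset.nonempty_iff_ne_empty]; intro h0
    have := h.1.2.2; rw [h0] at this; simp at this
  obtain ⟨i, hi, hmax⟩ := Finset.exists_max_image (Finset.range N) w hne
  by_cases hc : w i ≤ 1 / n
  · calc ∑ j ∈ Finset.range N, w j ^ 2 ≤ ∑ j ∈ Finset.range N, w i * w j := by
          refine Finset.sum_le_sum fun j hj => ?_
          have := hmax j hj; have := h.1.1 j; nlinarith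
      _ = w i := by rw [← Finset.mul_sum, h.1.2.2, mul_one]
      _ ≤ _ := hc
  · push Not at hc
    have hpos : 0 < w i := lt_trans (by positivity) hc
    have h1 := kkt hE h i hpos
    have h2 := pd_le hE h.1 i
    have h3 := e2_eq ((Finset.range N).erase i) w
    have h4 := Finset.add_sum_erase (Finset.range N) w hi
    have h5 := Finset.add_sum_erase (Finset.range N) (fun j => w j ^ 2) hi
    rw [h.1.2.2] at h4
    have h6 := Lam_eq n (by omega)
    set P := ∑ j ∈ Finset.range N, w j ^ 2
    set P' := ∑ j ∈ (Finset.range N).erase i, w j ^ 2 with hP'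
    have hP0 : 0 ≤ P' := Finset.sum_nonneg fun j _ => sq_nonneg _
    have h7 : ∑ j ∈ (Finset.range N).erase i, w j = 1 - w i := by linarith
    rw [h7] at h3
    have h8 : 6 * Lam n ≤ (1 - w i) ^ 2 - P' := by linarith
    have h9 : 6 * Lam n = 1 - 3 * (1 / (n:ℝ)) + 2 * (1 / (n:ℝ)) ^ 2 := by
      rw [h6]; field_simp; ring
    set c := 1 / (n:ℝ) with hcdef
    have hc5 : c ≤ 1 / 5 := by
      rw [hcdef]; apply div_le_div_of_nonneg_left <;> norm_num; exact hn
    have hc0 : 0 < c := by positivity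
    have hw1 : w i ≤ 1 - c := by
      by_contra hcon
      push Not at hcon
      have hle1 : w i ≤ 1 := by
        rw [← h.1.2.2]; exact Finset.single_le_sum (fun j _ => h.1.1 j) hi
      nlinarith
    nlinarith [mul_nonneg (sub_nonneg.2 hc.le) (sub_nonneg.2 hw1)]

lemma sum_powersetCard_insert (A : Finset ℕ) (a : ℕ) (ha : a ∉ A) (k : ℕ) (f : Finset ℕ → ℝ) :
    ∑ e ∈ (insert a A).powersetCard (k + 1), f e =
      ∑ e ∈ A.powersetCard (k + 1), f e + ∑ e ∈ A.powersetCard k, f (insert a e) := by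
  rw [Finset.powersetCard_succ_insert ha, Finset.sum_union, Finset.sum_image]
  · intro s hs t ht hst
    have hs' : a ∉ s := fun h => ha ((Finset.mem_powersetCard.1 hs).1 h)
    have ht' : a ∉ t := fun h => ha ((Finset.mem_powersetCard.1 ht).1 h)
    have := congrArg (fun x => x.erase a) hst
    simpa [Finset.erase_insert hs', Finset.erase_insert ht'] using this
  · rw [Finset.disjoint_left]
    intro s hs hs'
    obtain ⟨t, _, rfl⟩ := Finset.mem_image.1 hs'
    exact ha ((Finset.mem_powersetCard.1 hs).1 (Finset.mem_insert_self _ _))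

/-- contribution of an edge to the derivatives at `q` and `r`. -/
def tt (w : ℕ → ℝ) (q r : ℕ) (e : Finset ℕ) : ℝ :=
  (if q ∈ e then ∏ j ∈ e.erase q, w j else 0) + (if r ∈ e then ∏ j ∈ e.erase r, w j else 0)

lemma sum_tt_sq (w : ℕ → ℝ) (q r : ℕ) (hqr : q ≠ r) (R : Finset ℕ) (hq : q ∉ R) (hr : r ∉ R) :
    ∑ e ∈ (insert q (insert r R)).powersetCard 3, tt w q r e ^ 2 =
      2 * lagPoly (R.powersetCard 2) (fun i => w i ^ 2) + (w q + w r) ^ 2 * ∑ i ∈ R, w i ^ 2 := by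
  have hq' : q ∉ insert r R := by simp [hqr, hq]
  rw [sum_powersetCard_insert _ q hq', sum_powersetCard_insert _ r hr,
    sum_powersetCard_insert _ r hr]
  have a1 : ∑ e ∈ R.powersetCard (2 + 1), tt w q r e ^ 2 = 0 := by
    refine Finset.sum_eq_zero fun e he => ?_
    have hs := (Finset.mem_powersetCard.1 he).1
    have h1 : q ∉ e := fun h => hq (hs h)
    have h2 : r ∉ e := fun h => hr (hs h)
    simp [tt, h1, h2]
  have a2 : ∑ e ∈ R.powersetCard 2, tt w q r (insert r e) ^ 2 =
      lagPoly (R.powersetCard 2) (fun i => w i ^ 2) := by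
    refine Finset.sum_congr rfl fun e he => ?_
    have hs := (Finset.mem_powersetCard.1 he).1
    have h1 : q ∉ e := fun h => hq (hs h)
    have h2 : r ∉ e := fun h => hr (hs h)
    simp [tt, h1, h2, hqr, Finset.prod_pow]
  have a3 : ∑ e ∈ R.powersetCard (1 + 1), tt w q r (insert q e) ^ 2 =
      lagPoly (R.powersetCard 2) (fun i => w i ^ 2) := by
    refine Finset.sum_congr rfl fun e he => ?_
    have hs := (Finset.mem_powersetCard.1 he).1
    have h1 : q ∉ e := fun h => hq (hs h)
    have h2 : r ∉ e := fun h => hr (hs h)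
    simp [tt, h1, h2, hqr.symm, Finset.prod_pow]
  have a4 : ∑ e ∈ R.powersetCard 1, tt w q r (insert q (insert r e)) ^ 2 =
      (w q + w r) ^ 2 * ∑ i ∈ R, w i ^ 2 := by
    rw [← e1_eq R (fun i => w i ^ 2), lagPoly, Finset.mul_sum]
    refine Finset.sum_congr rfl fun e he => ?_
    have hs := (Finset.mem_powersetCard.1 he).1
    have h1 : q ∉ e := fun h => hq (hs h)
    have h2 : r ∉ e := fun h => hr (hs h)
    have h3 : (insert q (insert r e)).erase q = insert r e := by
      rw [Finset.erase_insert]; simp [hqr, h1]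
    have h4 : (insert q (insert r e)).erase r = insert q e := by
      rw [Finset.insert_comm, Finset.erase_insert]; simp [hqr.symm, h2]
    simp only [tt, Finset.mem_insert, true_or, or_true, if_true, h3, h4]
    rw [Finset.prod_insert h2, Finset.prod_insert h1, Finset.prod_pow]
    ring
  rw [a1, a2, a3, a4]; ring

lemma two_out_num5a (z : ℝ) (hz3 : z ≤ 3 / 10) :
    1.2 * (1 - z) * (1 - z) * 0.006 ≤ (0.2 - 0.15 * z) ^ 3 := by
  have h1 : 0 ≤ z ^ 2 * (3 / 10 - z) := mul_nonneg (sq_nonneg _) (by linarith)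
  have h2 := sq_nonneg (z - 0.34)
  norm_num at *
  linarith

lemma two_out_num5b (z P b l u : ℝ) (hl0 : 0 ≤ l) (hu : u ≤ 1 / 2) (hl : l ≤ z) (hz : z ≤ u)
    (hP : P = 1 / 5 - z ^ 2 / 2) (hb : b = (1 - z) ^ 2)
    (hnum : (1 / 25 - (l ^ 2) ^ 2 / 4 - 1 / 7 * (12 / 25) ^ 2) * (1 - l) ^ 2 <
      (1 / 5 - u ^ 2 / 2) ^ 3 ∧ 0 ≤ 1 / 25 - (l ^ 2) ^ 2 / 4 - 1 / 7 * (12 / 25) ^ 2) :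
    b * (1 / 25 - (z ^ 2) ^ 2 / 4) - P ^ 3 < b * (1 / 7 * (12 / 25) ^ 2) := by
  have e0 : z ^ 2 ≤ u ^ 2 := pow_le_pow_left₀ (by linarith) hz 2
  have e00 : u ^ 2 ≤ (1 / 2) ^ 2 := pow_le_pow_left₀ (by linarith) hu 2
  have e1 : (1 / 5 - u ^ 2 / 2) ^ 3 ≤ P ^ 3 :=
    pow_le_pow_left₀ (by linarith) (by linarith) 3
  have e2 : (l ^ 2) ^ 2 ≤ (z ^ 2) ^ 2 :=
    pow_le_pow_left₀ (by positivity) (pow_le_pow_left₀ hl0 hl 2) 2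
  have e3 : b ≤ (1 - l) ^ 2 := by
    rw [hb]; exact pow_le_pow_left₀ (by linarith) (by linarith) 2
  have hb0 : 0 ≤ b := by rw [hb]; positivity
  have e4 := mul_le_mul_of_nonneg_left e3 hnum.2
  have e5 := mul_le_mul_of_nonneg_left e2 hb0
  linarith [hnum.1]

lemma two_out_num5 (z p p4 : ℝ) (hz0 : 0 ≤ z) (hz1 : z ≤ 1) (hp0 : 0 ≤ p)
    (hp : p ≤ 1 / 5 - z ^ 2 / 2) (h4 : p ^ 3 ≤ (1 - z) ^ 2 * p4)  (h40 : 0 ≤ p4) :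
    7 * (z ^ 2 * p + p ^ 2 - p4) < (12 / 25) ^ 2 := by
  obtain ⟨P, hP⟩ : ∃ P, P = 1 / 5 - z ^ 2 / 2 := ⟨_, rfl⟩
  rw [← hP] at hp
  have hzz : 0 ≤ z ^ 2 := sq_nonneg z
  have hid : z ^ 2 * P + P ^ 2 = 1 / 25 - (z ^ 2) ^ 2 / 4 := by rw [hP]; ring
  rcases le_or_gt z (42 / 100) with hz | hz
  · obtain ⟨b, hb⟩ : ∃ b, b = (1 - z) ^ 2 := ⟨_, rfl⟩
    rw [← hb] at h4
    have hb0 : 0 < b := by rw [hb]; have : 0 < 1 - z := by linarith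
                           positivity
    have h2P : 2 * P ≤ b := by rw [hb, hP]; nlinarith [sq_nonneg (z - 1 / 2)]
    have hP0 : 0 ≤ P := hp0.trans hp
    have hm1 : P ^ 2 + P * p + p ^ 2 ≤ b * (P + p + z ^ 2) := by
      nlinarith [mul_nonneg hp0 (sub_nonneg.2 hp), mul_nonneg (sub_nonneg.2 h2P) (add_nonneg hP0 hp0),
        mul_nonneg hb0.le hzz]
    have hm2 : b * (z ^ 2 * p + p ^ 2) - p ^ 3 ≤ b * (z ^ 2 * P + P ^ 2) - P ^ 3 := by
      nlinarith [mul_nonneg (sub_nonneg.2 hp) (sub_nonneg.2 hm1)]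
    rw [hid] at hm2
    have hm3 : b * (1 / 25 - (z ^ 2) ^ 2 / 4) - P ^ 3 < b * (1 / 7 * (12 / 25) ^ 2) := by
      rcases le_or_gt z (3 / 10) with hz3 | hz3
      · have : 0.0072 * b ≤ P ^ 3 := by
          have : 1.2 * (1 - z) * (1 - z) * 0.006 ≤ P ^ 3 := by
            have e1 : 0.2 - 0.15 * z ≤ P := by rw [hP]; nlinarith
            have e2 : (0.2 - 0.15 * z) ^ 3 ≤ P ^ 3 := pow_le_pow_left₀ (by linarith) e1 3
            refine le_trans ?_ e2
            exact two_out_num5a z hz3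
          rw [hb]; linarith
        have e9 := mul_nonneg hb0.le (sq_nonneg (z ^ 2))
        norm_num at *
        linarith
      · rcases le_or_gt z (34 / 100) with hz4 | hz4
        · exact two_out_num5b z P b 0.3 0.34 (by norm_num) (by norm_num) (by linarith)
            (by linarith) hP hb (by norm_num)
        · rcases le_or_gt z (38 / 100) with hz5 | hz5
          · exact two_out_num5b z P b 0.34 0.38 (by norm_num) (by norm_num) (by linarith)
              (by linarith) hP hb (by norm_num)
          · exact two_out_num5b z P b 0.38 0.42 (by norm_num) (by norm_num) (by linarith)
              (by linarith) hP hb (by norm_num)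
    have hm4 : b * (z ^ 2 * p + p ^ 2 - p4) < b * (1 / 7 * (12 / 25) ^ 2) := by linarith
    have := lt_of_mul_lt_mul_left hm4 hb0.le
    linarith
  · have e0 : 0.1764 < z ^ 2 := by nlinarith
    have e3 : 0.03 ≤ (z ^ 2) ^ 2 := by nlinarith
    have : z ^ 2 * p + p ^ 2 ≤ z ^ 2 * P + P ^ 2 := by nlinarith
    rw [hid] at this
    norm_num at *
    linarith

lemma two_out_num6 (n z p p4 : ℝ) (hn6 : 6 ≤ n) (hp0 : 0 ≤ p) (hp40 : 0 ≤ p4)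
    (hpz : p ≤ 1 / n - z ^ 2 / 2)
    (hchain : ((n - 1) * (n - 2) / n ^ 2) ^ 2 ≤
      ((n - 1) * (n - 2) / 2 + 1) * (p ^ 2 - p4 + z ^ 2 * p)) : False := by
  have hn2 : (0:ℝ) < n ^ 2 := by positivity
  have hb : p ^ 2 - p4 + z ^ 2 * p ≤ (1 / n) ^ 2 := by
    have h1 : p * (p + z ^ 2) ≤ (1 / n - z ^ 2 / 2) * (1 / n + z ^ 2 / 2) := by
      apply mul_le_mul hpz (by linarith) (by positivity) (by linarith)
    nlinarith [sq_nonneg (z ^ 2)]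
  have hc := hchain.trans (mul_le_mul_of_nonneg_left hb (by nlinarith))
  rw [div_pow, one_div, inv_pow, ← div_eq_mul_inv, div_le_div_iff₀ (by positivity) (by positivity)] at hc
  have hc2 : ((n - 1) * (n - 2)) ^ 2 ≤ ((n - 1) * (n - 2) / 2 + 1) * n ^ 2 := by
    apply le_of_mul_le_mul_right _ hn2
    calc _ ≤ _ := hc
      _ = _ := by ring
  obtain ⟨k, hk⟩ : ∃ k : ℝ, n = k + 6 := ⟨n - 6, by ring⟩
  have hk0 : 0 ≤ k := by linarith
  rw [hk] at hc2
  nlinarith [pow_nonneg hk0 2, pow_nonneg hk0 3, pow_nonneg hk0 4]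

lemma two_out {E : Finset (Finset ℕ)} (hE : ∀ e ∈ E, e.card = 3) {N : ℕ} {w : ℕ → ℝ}
    (h : IsOpt E N w) (n : ℕ) (hn : 5 ≤ n) (hl : Lam n ≤ lagPoly E w) (q r : ℕ) (hqr : q ≠ r)
    (hq : 0 < w q) (hr : 0 < w r)
    (hcard : (E.filter (fun e => q ∈ e ∨ r ∈ e)).card ≤ (n - 1).choose 2 + 1) : False := by
  have hn5 : (5:ℝ) ≤ n := by exact_mod_cast hn
  obtain ⟨⟨h0, h1, h2⟩, hmax⟩ := id h
  have hqN : q < N := by by_contra hc; have := h1 q (by omega); linarith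
  have hrN : r < N := by by_contra hc; have := h1 r (by omega); linarith
  set R := ((Finset.range N).erase q).erase r with hR
  have hqR : q ∉ R := by simp [hR]
  have hrR : r ∉ R := by simp [hR]
  have hrange : Finset.range N = insert q (insert r R) := by
    rw [hR, Finset.insert_erase, Finset.insert_erase]
    · simpa
    · simp [hrN, hqr.symm]
  have hq' : q ∉ insert r R := by simp [hqr, hqR]
  have hpp := p2_le hE h n hn hl
  rw [hrange, Finset.sum_insert hq', Finset.sum_insert hrR] at h2 hpp
  have hkq := kkt hE h q hq
  have hkr := kkt hE h r hr
  set F := E.filter (fun e => (q ∈ e ∨ r ∈ e) ∧ e ⊆ Finset.range N) with hF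
  have hsum : pd E w q + pd E w r = ∑ e ∈ F, tt w q r e := by
    unfold pd
    rw [← Finset.sum_add_distrib, hF, Finset.sum_filter]
    refine Finset.sum_congr rfl fun e _ => ?_
    change tt w q r e = _
    by_cases hc3 : e ⊆ Finset.range N
    · by_cases hqe : q ∈ e ∨ r ∈ e
      · rw [if_pos ⟨hqe, hc3⟩]
      · rw [if_neg (fun hh => hqe hh.1)]
        rw [not_or] at hqe
        simp only [hqe.1, hqe.2, if_false, add_zero, tt]
    · rw [if_neg (fun hh => hc3 hh.2)]
      obtain ⟨x, hx, hxN⟩ := Finset.not_subset.1 hc3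
      have hx0 : w x = 0 := h1 x (by simpa using hxN)
      have hxq : x ≠ q := by rintro rfl; linarith
      have hxr : x ≠ r := by rintro rfl; linarith
      unfold tt
      rw [Finset.prod_eq_zero (Finset.mem_erase.2 ⟨hxq, hx⟩) hx0,
        Finset.prod_eq_zero (Finset.mem_erase.2 ⟨hxr, hx⟩) hx0]; simp only [ite_self, add_zero]
  have hFcard : (F.card : ℝ) ≤ (n - 1).choose 2 + 1 := by
    have : F.card ≤ (E.filter (fun e => q ∈ e ∨ r ∈ e)).card := by
      apply Finset.card_le_card
      intro e he
      simp only [hF, Finset.mem_filter] at he ⊢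
      exact ⟨he.1, he.2.1⟩
    exact_mod_cast this.trans hcard
  have hcs := sq_sum_le_card_mul_sum_sq (s := F) (f := tt w q r)
  have hsub : ∑ e ∈ F, tt w q r e ^ 2 ≤
      ∑ e ∈ (insert q (insert r R)).powersetCard 3, tt w q r e ^ 2 := by
    apply Finset.sum_le_sum_of_subset_of_nonneg
    · intro e he
      simp only [hF, Finset.mem_filter] at he
      rw [Finset.mem_powersetCard, ← hrange]
      exact ⟨he.2.2, hE e he.1⟩
    · intro _ _ _; exact sq_nonneg _
  rw [sum_tt_sq w q r hqr R hqR hrR, e2_eq] at hsub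
  rw [← hsum, hkq, hkr] at hcs
  set p := ∑ i ∈ R, w i ^ 2 with hp
  set s := ∑ i ∈ R, w i with hs
  have hp0 : 0 ≤ p := Finset.sum_nonneg fun i _ => sq_nonneg _
  have hs0 : 0 ≤ s := Finset.sum_nonneg fun i _ => h0 i
  set p4 := ∑ i ∈ R, (w i ^ 2) ^ 2 with hp4
  have hp40 : 0 ≤ p4 := Finset.sum_nonneg fun i _ => sq_nonneg _
  have hch := choose2 (n - 1)
  rw [Nat.cast_sub (by omega)] at hch
  push_cast at hch
  have hLam := Lam_eq n (by omega)
  have hLam0 : 0 < 6 * Lam n := by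
    rw [hLam]; apply div_pos <;> nlinarith
  have hchain : (6 * Lam n) ^ 2 ≤
      (((n:ℝ) - 1) * (n - 2) / 2 + 1) * (p ^ 2 - p4 + (w q + w r) ^ 2 * p) := by
    have e1 : (6 * Lam n) ^ 2 ≤ (3 * lagPoly E w + 3 * lagPoly E w) ^ 2 := by
      apply pow_le_pow_left₀ hLam0.le; linarith
    have e2 : (0:ℝ) ≤ ∑ e ∈ F, tt w q r e ^ 2 := Finset.sum_nonneg fun i _ => sq_nonneg _
    have e3 : (F.card : ℝ) ≤ ((n:ℝ) - 1) * (n - 2) / 2 + 1 := by nlinarith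
    calc _ ≤ _ := e1
      _ ≤ _ := hcs
      _ ≤ _ := mul_le_mul e3 hsub e2 (by nlinarith)
  set z := w q + w r with hz
  have hpz : p ≤ 1 / n - z ^ 2 / 2 := by nlinarith [sq_nonneg (w q - w r)]
  by_cases h6 : n = 5
  · subst h6
    have c1 : p ^ 2 ≤ s * ∑ i ∈ R, w i ^ 3 := by
      have := Finset.sum_sq_le_sum_mul_sum_of_sq_le_mul R (r := fun i => w i ^ 2) (f := w)
        (g := fun i => w i ^ 3) (fun i _ => h0 i) (fun i _ => pow_nonneg (h0 i) 3)
        (fun i _ => le_of_eq (by ring))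
      exact this
    have c2 : (∑ i ∈ R, w i ^ 3) ^ 2 ≤ p * p4 := by
      have := Finset.sum_sq_le_sum_mul_sum_of_sq_le_mul R (r := fun i => w i ^ 3)
        (f := fun i => w i ^ 2)
        (g := fun i => (w i ^ 2) ^ 2) (fun i _ => sq_nonneg _) (fun i _ => sq_nonneg _)
        (fun i _ => le_of_eq (by ring))
      exact this
    have c3 : p ^ 3 ≤ s ^ 2 * p4 := by
      rcases hp0.eq_or_lt with h00 | h00
      · rw [← h00]; simp; positivity
      · have d1 : (p ^ 2) ^ 2 ≤ (s * ∑ i ∈ R, w i ^ 3) ^ 2 := pow_le_pow_left₀ (by positivity) c1 2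
        have d2 : p * p ^ 3 ≤ p * (s ^ 2 * p4) := by
          calc p * p ^ 3 = (p ^ 2) ^ 2 := by ring
            _ ≤ _ := d1
            _ = s ^ 2 * (∑ i ∈ R, w i ^ 3) ^ 2 := by ring
            _ ≤ s ^ 2 * (p * p4) := mul_le_mul_of_nonneg_left c2 (sq_nonneg _)
            _ = _ := by ring
        exact le_of_mul_le_mul_left d2 h00
    have hs1 : s = 1 - z := by linarith
    rw [hs1] at c3
    have := two_out_num5 z p p4 (by positivity) (by linarith) hp0 (by norm_num at hpz ⊢; linarith) c3 hp40
    rw [hLam] at hchain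
    norm_num at hchain this
    linarith
  · have hn6 : (6:ℝ) ≤ n := by exact_mod_cast (by omega : 6 ≤ n)
    rw [hLam] at hchain
    exact two_out_num6 n z p p4 hn6 hp0 hp40 hpz hchain

/-- The 3-graph on `S ∪ {v}` missing the triples `Z` inside `S` and the pairs `N` in the link of `v`. -/
def GG (S : Finset ℕ) (v : ℕ) (Z N : Finset (Finset ℕ)) : Finset (Finset ℕ) :=
  (S.powersetCard 3 \ Z) ∪ ((S.powersetCard 2 \ N).image (insert v))

lemma lagPoly_sdiff {A B : Finset (Finset ℕ)} (h : B ⊆ A) (w : ℕ → ℝ) :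
    lagPoly (A \ B) w = lagPoly A w - lagPoly B w := by
  unfold lagPoly; rw [← Finset.sum_sdiff h]; ring

lemma lagPoly_congr {A : Finset (Finset ℕ)} {w w' : ℕ → ℝ} (h : ∀ e ∈ A, ∀ i ∈ e, w i = w' i) :
    lagPoly A w = lagPoly A w' :=
  Finset.sum_congr rfl fun e he => Finset.prod_congr rfl (h e he)

lemma GG_val {S : Finset ℕ} {v : ℕ} {Z N : Finset (Finset ℕ)} (hv : v ∉ S)
    (hZ : Z ⊆ S.powersetCard 3) (hN : N ⊆ S.powersetCard 2) (w : ℕ → ℝ) :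
    lagPoly (GG S v Z N) w = lagPoly (S.powersetCard 3) w - lagPoly Z w +
      w v * (lagPoly (S.powersetCard 2) w - lagPoly N w) := by
  rw [← lagPoly_sdiff hZ, ← lagPoly_sdiff hN]
  have hvs : ∀ e ∈ S.powersetCard 2 \ N, v ∉ e := fun e he h =>
    hv ((Finset.mem_powersetCard.1 (Finset.mem_sdiff.1 he).1).1 h)
  unfold GG lagPoly
  rw [Finset.sum_union, Finset.sum_image, Finset.mul_sum]
  · congr 1
    refine Finset.sum_congr rfl fun e he => ?_
    rw [Finset.prod_insert (hvs e he)]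
  · intro s hs t ht hst
    have := congrArg (fun x => x.erase v) hst
    simpa [Finset.erase_insert (hvs s hs), Finset.erase_insert (hvs t ht)] using this
  · rw [Finset.disjoint_left]
    intro s hs hs'
    obtain ⟨t, _, rfl⟩ := Finset.mem_image.1 hs'
    exact hv ((Finset.mem_powersetCard.1 (Finset.mem_sdiff.1 hs).1).1 (Finset.mem_insert_self _ _))

lemma GG_sub {S : Finset ℕ} {v : ℕ} {Z N : Finset (Finset ℕ)} (hv : v ∉ S)
    {e : Finset ℕ} (he : e ∈ GG S v Z N) : e ∈ (insert v S).powersetCard 3 := by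
  rw [Finset.mem_powersetCard]
  rcases Finset.mem_union.1 he with h | h
  · obtain ⟨h1, h2⟩ := Finset.mem_powersetCard.1 (Finset.mem_sdiff.1 h).1
    exact ⟨h1.trans (Finset.subset_insert _ _), h2⟩
  · obtain ⟨f, hf, rfl⟩ := Finset.mem_image.1 h
    obtain ⟨h1, h2⟩ := Finset.mem_powersetCard.1 (Finset.mem_sdiff.1 hf).1
    refine ⟨Finset.insert_subset_insert _ h1, ?_⟩
    rw [Finset.card_insert_of_notMem (fun h => hv (h1 h)), h2]

lemma pd_diff (E : Finset (Finset ℕ)) (w : ℕ → ℝ) (i : ℕ) :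
    pd E w i = lagPoly E (Function.update w i (w i + 1)) - lagPoly E w := by
  rw [lagPoly_update]; ring

lemma GG_pd {S : Finset ℕ} {v : ℕ} {Z N : Finset (Finset ℕ)} (hv : v ∉ S)
    (hZ : Z ⊆ S.powersetCard 3) (hN : N ⊆ S.powersetCard 2) (w : ℕ → ℝ) (i : ℕ) (hi : i ∈ S) :
    pd (GG S v Z N) w i = pd (S.powersetCard 3) w i - pd Z w i +
      w v * (pd (S.powersetCard 2) w i - pd N w i) := by
  have hne : v ≠ i := by rintro rfl; exact hv hi
  simp only [pd_diff, GG_val hv hZ hN, Function.update_of_ne hne]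
  ring

lemma pd_full (S : Finset ℕ) (w : ℕ → ℝ) (i : ℕ) (hi : i ∈ S) (k : ℕ) :
    pd (S.powersetCard (k + 1)) w i = lagPoly ((S.erase i).powersetCard k) w := by
  have h := fun u => lagPoly_insert (S.erase i) i (Finset.notMem_erase i S) k u
  rw [Finset.insert_erase hi] at h
  have hc : ∀ m, lagPoly ((S.erase i).powersetCard m) (Function.update w i (w i + 1)) =
      lagPoly ((S.erase i).powersetCard m) w := by
    intro m
    refine lagPoly_congr fun e he j hj => ?_
    rw [Function.update_of_ne]
    rintro rfl
    exact Finset.notMem_erase j S ((Finset.mem_powersetCard.1 he).1 hj)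
  rw [pd_diff, h, h, hc, hc, Function.update_self]; ring

/-- degree of a vertex. -/
def dg (N : Finset (Finset ℕ)) (i : ℕ) : ℝ := ((N.filter (fun e => i ∈ e)).card : ℝ)

lemma dg_eq (N : Finset (Finset ℕ)) (i : ℕ) : dg N i = ∑ e ∈ N, if i ∈ e then (1:ℝ) else 0 := by
  unfold dg; rw [Finset.sum_ite, Finset.sum_const_zero, add_zero, Finset.sum_const, nsmul_eq_mul, mul_one]

lemma sum_ite_mem_sub {S e : Finset ℕ} (h : e ⊆ S) (f : ℕ → ℝ) :
    ∑ i ∈ S, (if i ∈ e then f i else 0) = ∑ i ∈ e, f i := by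
  rw [Finset.sum_ite_mem, Finset.inter_eq_right.2 h]

lemma sum_dg {S : Finset ℕ} {N : Finset (Finset ℕ)} (hN : N ⊆ S.powersetCard 2) (f : ℕ → ℝ) :
    ∑ i ∈ S, dg N i * f i = ∑ e ∈ N, ∑ i ∈ e, f i := by
  simp_rw [dg_eq, Finset.sum_mul]
  rw [Finset.sum_comm]
  refine Finset.sum_congr rfl fun e he => ?_
  rw [← sum_ite_mem_sub (Finset.mem_powersetCard.1 (hN he)).1]
  refine Finset.sum_congr rfl fun i _ => ?_
  split_ifs <;> simp

lemma sum_pd_N {S : Finset ℕ} {N : Finset (Finset ℕ)} (hN : N ⊆ S.powersetCard 2) (w : ℕ → ℝ) :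
    ∑ i ∈ S, pd N w i = ∑ i ∈ S, dg N i * w i := by
  rw [sum_dg hN]
  unfold pd
  rw [Finset.sum_comm]
  refine Finset.sum_congr rfl fun e he => ?_
  obtain ⟨h1, h2⟩ := Finset.mem_powersetCard.1 (hN he)
  rw [sum_ite_mem_sub h1]
  obtain ⟨a, b, hab, rfl⟩ := Finset.card_eq_two.1 h2
  rw [Finset.sum_pair hab, Finset.sum_pair hab]
  have e1 : ({a, b} : Finset ℕ).erase a = {b} := by
    rw [Finset.erase_insert]; simpa using hab
  have e2 : ({a, b} : Finset ℕ).erase b = {a} := by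
    rw [Finset.pair_comm, Finset.erase_insert]; simpa using hab.symm
  rw [e1, e2]; simp; ring

lemma sum_dg_one {S : Finset ℕ} {N : Finset (Finset ℕ)} (hN : N ⊆ S.powersetCard 2) :
    ∑ i ∈ S, dg N i = 2 * N.card := by
  have := sum_dg hN (fun _ => 1)
  simp only [mul_one] at this
  rw [this, Finset.sum_congr rfl (g := fun _ => (2:ℝ))]
  · simp; ring
  · intro e he
    simp [(Finset.mem_powersetCard.1 (hN he)).2]

lemma dg_pair {N : Finset (Finset ℕ)} (hN : ∀ e ∈ N, e.card = 2) (a b : ℕ) (hab : a ≠ b) :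
    dg N a + dg N b ≤ N.card + 1 := by
  unfold dg
  have h := Finset.card_union_add_card_inter (N.filter (fun e => a ∈ e)) (N.filter (fun e => b ∈ e))
  have h1 : (N.filter (fun e => a ∈ e) ∪ N.filter (fun e => b ∈ e)).card ≤ N.card := by
    apply Finset.card_le_card
    exact Finset.union_subset (Finset.filter_subset _ _) (Finset.filter_subset _ _)
  have h2 : (N.filter (fun e => a ∈ e) ∩ N.filter (fun e => b ∈ e)).card ≤ 1 := by
    have : N.filter (fun e => a ∈ e) ∩ N.filter (fun e => b ∈ e) ⊆ {{a, b}} := by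
      intro e he
      simp only [Finset.mem_inter, Finset.mem_filter] at he
      rw [Finset.mem_singleton]
      symm
      apply Finset.eq_of_subset_of_card_le
      · intro x hx
        rcases Finset.mem_insert.1 hx with rfl | hx
        · exact he.1.2
        · rw [Finset.mem_singleton.1 hx]; exact he.2.2
      · rw [hN e he.1.1, Finset.card_pair hab]
    simpa using Finset.card_le_card this
  have : (N.filter (fun e => a ∈ e)).card + (N.filter (fun e => b ∈ e)).card ≤ N.card + 1 := by omega
  exact_mod_cast this

lemma sum_dg_sq {S : Finset ℕ} {N : Finset (Finset ℕ)} (hN : N ⊆ S.powersetCard 2) :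
    ∑ i ∈ S, dg N i ^ 2 ≤ N.card * (N.card + 1) := by
  have := sum_dg hN (dg N)
  simp only [← sq] at this
  rw [this, ← nsmul_eq_mul]
  apply Finset.sum_le_card_nsmul
  intro e he
  obtain ⟨a, b, hab, rfl⟩ := Finset.card_eq_two.1 (Finset.mem_powersetCard.1 (hN he)).2
  rw [Finset.sum_pair hab]
  exact dg_pair (fun e he => (Finset.mem_powersetCard.1 (hN he)).2) a b hab

lemma core {S : Finset ℕ} {v n : ℕ} {Z N : Finset (Finset ℕ)} (hn : 5 ≤ n) (hS : S.card = n)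
    (hv : v ∉ S) (hZ : Z ⊆ S.powersetCard 3) (hN : N ⊆ S.powersetCard 2) {m : ℕ} {w : ℕ → ℝ}
    (h : IsOpt (GG S v Z N) m w) (hpos : ∀ i ∈ S, 0 < w i) (hsum : ∑ i ∈ S, w i + w v = 1) :
    w v * ∑ i ∈ S, dg N i * (1 / n - w i) = n * w v ^ 2 / 2
      + (n - 2) / 2 * ∑ i ∈ S, (1 / n - w i) ^ 2 + 2 * ((N.card : ℝ) - n + 1) * w v / n
      + ∑ i ∈ S, pd Z w i + 3 * n * (lagPoly (GG S v Z N) w - Lam n) := by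
  have hn0 : (n:ℝ) ≠ 0 := by positivity
  have hE : ∀ e ∈ GG S v Z N, e.card = 3 := fun e he => (Finset.mem_powersetCard.1 (GG_sub hv he)).2
  have h1 : ∑ i ∈ S, pd (GG S v Z N) w i = n * (3 * lagPoly (GG S v Z N) w) := by
    rw [Finset.sum_congr rfl (fun i hi => kkt hE h i (hpos i hi))]
    simp [hS]
  rw [Finset.sum_congr rfl (fun i hi => GG_pd hv hZ hN w i hi), Finset.sum_add_distrib,
    Finset.sum_sub_distrib, ← Finset.mul_sum, Finset.sum_sub_distrib, sum_pd_N hN] at h1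
  have h2 : ∑ i ∈ S, pd (S.powersetCard 2) w i = (n - 1) * (1 - w v) := by
    rw [Finset.sum_congr rfl (g := fun i => (1 - w v) - w i)]
    · rw [Finset.sum_sub_distrib]; simp only [Finset.sum_const, hS, nsmul_eq_mul]; linear_combination -hsum
    · intro i hi
      rw [pd_full S w i hi 1, e1_eq]
      have := Finset.add_sum_erase S w hi
      linarith
  have h3 : ∑ i ∈ S, pd (S.powersetCard 3) w i =
      (n - 2) / 2 * ((1 - w v) ^ 2 - ∑ i ∈ S, w i ^ 2) := by
    have hs : ∑ i ∈ S, w i = 1 - w v := by linarith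
    rw [Finset.sum_congr rfl (g := fun i => ((1 - w v) ^ 2 - ∑ i ∈ S, w i ^ 2) / 2
      - (1 - w v) * w i + w i ^ 2)]
    · rw [Finset.sum_add_distrib, Finset.sum_sub_distrib, ← Finset.mul_sum, hs]
      simp only [Finset.sum_const, hS, nsmul_eq_mul]; ring
    · intro i hi
      have e2 := e2_eq (S.erase i) w
      rw [pd_full S w i hi 2]
      have a1 := Finset.add_sum_erase S w hi
      have a2 := Finset.add_sum_erase S (fun i => w i ^ 2) hi
      have a3 : ∑ j ∈ S.erase i, w j = (1 - w v) - w i := by linarith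
      have a4 : ∑ j ∈ S.erase i, w j ^ 2 = ∑ j ∈ S, w j ^ 2 - w i ^ 2 := by linarith
      rw [a3, a4] at e2
      linear_combination e2 / 2
  have h4 : ∑ i ∈ S, (1 / n - w i) ^ 2 = ∑ i ∈ S, w i ^ 2 - 2 / n * (1 - w v) + 1 / n := by
    have hs : ∑ i ∈ S, w i = 1 - w v := by linarith
    rw [Finset.sum_congr rfl (g := fun i => w i ^ 2 - (2 / n) * w i + 1 / (n:ℝ) ^ 2)]
    · rw [Finset.sum_add_distrib, Finset.sum_sub_distrib, ← Finset.mul_sum, hs]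
      simp only [Finset.sum_const, hS, nsmul_eq_mul]; field_simp
    · intro i _; field_simp; ring
  have h5 : ∑ i ∈ S, dg N i * (1 / n - w i) = 2 * N.card / n - ∑ i ∈ S, dg N i * w i := by
    simp_rw [mul_sub]
    rw [Finset.sum_sub_distrib, ← Finset.sum_mul, sum_dg_one hN]; ring
  have h6 := Lam_eq n (by omega)
  rw [h2, h3] at h1
  rw [h4, h5]
  have h7 : 3 * (n:ℝ) * Lam n = ((n:ℝ) - 1) * (n - 2) / (2 * n) := by
    have : 3 * (n:ℝ) * Lam n = n / 2 * (6 * Lam n) := by ring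
    rw [this, h6]; field_simp
  have h8 : 3 * n * (lagPoly (GG S v Z N) w - Lam n) = n * (3 * lagPoly (GG S v Z N) w)
    - ((n:ℝ) - 1) * (n - 2) / (2 * n) := by rw [← h7]; ring
  rw [h8, ← h1]
  field_simp
  ring

lemma quad {S : Finset ℕ} {n : ℕ} (hS : S.card = n) (ε d : ℕ → ℝ) (μ B : ℝ)
    (h1 : ∑ i ∈ S, ε i = μ) (h2 : ∑ i ∈ S, d i = 2 * n - 2) (h3 : ∑ i ∈ S, d i ^ 2 ≤ B) :
    2 * (n - 2) * (μ * ∑ i ∈ S, d i * ε i) ≤ ((n:ℝ) - 2) ^ 2 * ∑ i ∈ S, ε i ^ 2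
      + 2 * (n - 2) * μ ^ 2 + μ ^ 2 * (B - 3 * n + 4) := by
  have h := Finset.sum_nonneg (s := S) (f := fun i => (((n:ℝ) - 2) * ε i - μ * (d i - 1)) ^ 2)
    (fun i _ => sq_nonneg _)
  rw [Finset.sum_congr rfl (g := fun i => ((n:ℝ) - 2) ^ 2 * ε i ^ 2 - 2 * (n - 2) * μ * (d i * ε i)
    + 2 * (n - 2) * μ * ε i + μ ^ 2 * d i ^ 2 - 2 * μ ^ 2 * d i + μ ^ 2) (fun i _ => by ring)] at h
  rw [Finset.sum_add_distrib, Finset.sum_sub_distrib, Finset.sum_add_distrib,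
    Finset.sum_add_distrib, Finset.sum_sub_distrib] at h
  simp only [← Finset.mul_sum] at h
  rw [h1, h2, Finset.sum_const, hS, nsmul_eq_mul] at h
  have := mul_le_mul_of_nonneg_left h3 (sq_nonneg μ)
  linarith

lemma weighting_of {A : Finset ℕ} {w : ℕ → ℝ} (h0 : ∀ i, 0 ≤ w i) (hz : ∀ i, i ∉ A → w i = 0)
    (hs : ∑ i ∈ A, w i = 1) : IsWeighting (A.sup id + 1) w := by
  have hlt : ∀ i ∈ A, i < A.sup id + 1 := fun i hi => Nat.lt_succ_of_le (Finset.le_sup (f := id) hi)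
  refine ⟨h0, fun i hi => hz i fun h => ?_, ?_⟩
  · have := hlt i h; omega
  · rw [← hs]; symm
    apply Finset.sum_subset
    · intro i hi; simpa using hlt i hi
    · intro i _ hi; exact hz i hi

lemma sum_of_weighting {A : Finset ℕ} {m : ℕ} {w : ℕ → ℝ} (h : IsWeighting m w)
    (hz : ∀ i, i ∉ A → w i = 0) : ∑ i ∈ A, w i = 1 := by
  rw [← h.2.2]
  have e1 : ∑ i ∈ A, w i = ∑ i ∈ A ∪ Finset.range m, w i :=
    Finset.sum_subset Finset.subset_union_left fun i _ hi => hz i hi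
  have e2 : ∑ i ∈ Finset.range m, w i = ∑ i ∈ A ∪ Finset.range m, w i :=
    Finset.sum_subset Finset.subset_union_right fun i _ hi => h.2.1 i (by simpa using hi)
  rw [e1, e2]

lemma le_full {G : Finset (Finset ℕ)} (hG : ∀ e ∈ G, e.card = 3) {A : Finset ℕ} {w : ℕ → ℝ}
    (h0 : ∀ i, 0 ≤ w i) (hz : ∀ i, i ∉ A → w i = 0) :
    lagPoly G w ≤ lagPoly (A.powersetCard 3) w := by
  rw [lagPoly_restrict G w A hz]
  apply lagPoly_mono_set _ _ h0
  intro e he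
  obtain ⟨h1, h2⟩ := Finset.mem_filter.1 he
  exact Finset.mem_powersetCard.2 ⟨h2, hG e h1⟩

lemma Lam_pos (n : ℕ) (hn : 5 ≤ n) : 0 < Lam n := by
  unfold Lam
  have : 0 < n.choose 3 := Nat.choose_pos (by omega)
  have : 0 < n := by omega
  positivity

lemma clique_opt {S : Finset ℕ} {v n : ℕ} {N : Finset (Finset ℕ)} (hn : 5 ≤ n) (hS : S.card = n)
    (hv : v ∉ S) (hN : N ⊆ S.powersetCard 2) (hc : N.card = n - 1) {m : ℕ} {w : ℕ → ℝ}
    (h : IsOpt (GG S v ∅ N) m w) : lagPoly (GG S v ∅ N) w ≤ Lam n := by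
  by_contra hlt
  push Not at hlt
  have hL := Lam_pos n hn
  have hn5 : (5:ℝ) ≤ n := by exact_mod_cast hn
  have hE : ∀ e ∈ GG S v ∅ N, e.card = 3 := fun e he => (Finset.mem_powersetCard.1 (GG_sub hv he)).2
  have h0 := h.1.1
  have hz : ∀ i, i ∉ insert v S → w i = 0 := by
    intro i hi
    by_contra hne
    have hp : 0 < w i := lt_of_le_of_ne (h0 i) (Ne.symm hne)
    have hk := kkt hE h i hp
    have : pd (GG S v ∅ N) w i = 0 := by
      refine Finset.sum_eq_zero fun e he => ?_
      rw [if_neg]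
      intro hie
      exact hi ((Finset.mem_powersetCard.1 (GG_sub hv he)).1 hie)
    linarith
  have hsum := sum_of_weighting h.1 hz
  by_cases hall : ∀ i ∈ insert v S, 0 < w i
  · rw [Finset.sum_insert hv, add_comm] at hsum
    have hJ := core hn hS hv (Finset.empty_subset _) hN h
      (fun i hi => hall i (Finset.mem_insert_of_mem hi)) hsum
    have hcc : (N.card : ℝ) = n - 1 := by rw [hc, Nat.cast_sub (by omega)]; simp
    have hq := quad hS (fun i => 1 / n - w i) (dg N) (w v) (n * (n - 1)) (by
        rw [Finset.sum_sub_distrib]; simp only [Finset.sum_const, hS, nsmul_eq_mul]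
        rw [mul_one_div_cancel (by positivity)]; linarith)
      (by rw [sum_dg_one hN, hcc]; ring)
      (by have := sum_dg_sq hN; rw [hcc] at this; linarith)
    have hQ : ∑ i ∈ S, pd ∅ w i = 0 := by simp [pd]
    rw [hQ, hcc] at hJ
    rw [hJ] at hq
    have hp : 0 < ((n:ℝ) - 2) * (n * (lagPoly (GG S v ∅ N) w - Lam n)) := by
      apply mul_pos (by linarith) (mul_pos (by linarith) (by linarith))
    have : 2 * ((n:ℝ) - 1 - n + 1) * w v / n = 0 := by
      have : (n:ℝ) - 1 - n + 1 = 0 := by ring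
      rw [this]; simp
    rw [this] at hq
    nlinarith
  · push Not at hall
    obtain ⟨i, hi, hi0⟩ := hall
    have hi0 : w i = 0 := le_antisymm hi0 (h0 i)
    have hz' : ∀ j, j ∉ (insert v S).erase i → w j = 0 := by
      intro j hj
      by_cases hji : j = i
      · rw [hji, hi0]
      · exact hz j fun hh => hj (Finset.mem_erase.2 ⟨hji, hh⟩)
    have hcard : ((insert v S).erase i).card = n := by
      rw [Finset.card_erase_of_mem hi, Finset.card_insert_of_notMem hv, hS]; simp
    have := (e3_le _ w n hn hcard h0 (sum_of_weighting h.1 hz')).1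
    have := le_full hE h0 hz'
    linarith

lemma clique {S : Finset ℕ} {v n : ℕ} {N : Finset (Finset ℕ)} (hn : 5 ≤ n) (hS : S.card = n)
    (hv : v ∉ S) (hN : N ⊆ S.powersetCard 2) (hc : n - 1 ≤ N.card) {w : ℕ → ℝ}
    (h0 : ∀ i, 0 ≤ w i) (hz : ∀ i, i ∉ insert v S → w i = 0) (hsum : ∑ i ∈ S, w i + w v = 1) :
    lagPoly (S.powersetCard 3) w + w v * (lagPoly (S.powersetCard 2) w - lagPoly N w) ≤ Lam n := by
  obtain ⟨N', hN', hc'⟩ := Finset.exists_subset_card_eq hc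
  obtain ⟨m, u, hu⟩ := attain (GG S v ∅ N')
  have h1 := clique_opt hn hS hv (hN'.trans hN) hc' hu
  have hW := weighting_of h0 hz (by rw [Finset.sum_insert hv]; linarith)
  have h2 := hu.2 _ _ hW
  rw [GG_val hv (Finset.empty_subset _) (hN'.trans hN) w] at h2
  have h3 : lagPoly ∅ w = 0 := by simp [lagPoly]
  have h4 := mul_le_mul_of_nonneg_left (lagPoly_mono_set hN' w h0) (h0 v)
  rw [h3] at h2
  linarith

/-- The situation of an optimal weighting with full support `S ∪ {v}`. -/
structure Ctx (S : Finset ℕ) (v n : ℕ) (e0 : Finset ℕ) (N : Finset (Finset ℕ)) (m : ℕ)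
    (w : ℕ → ℝ) : Prop where
  hn : 5 ≤ n
  hS : S.card = n
  hv : v ∉ S
  he : e0 ∈ S.powersetCard 3
  hN : N ⊆ S.powersetCard 2
  opt : IsOpt (GG S v {e0} N) m w
  pos : ∀ i ∈ insert v S, 0 < w i
  zero : ∀ i, i ∉ insert v S → w i = 0
  hL : Lam n ≤ lagPoly (GG S v {e0} N) w
  hc : n - 2 ≤ N.card
  noK : ∀ A : Finset ℕ, A.card = n → ¬ A.powersetCard 3 ⊆ GG S v {e0} N

lemma Ctx.sum {S : Finset ℕ} {v n : ℕ} {e0 : Finset ℕ} {N : Finset (Finset ℕ)} {m : ℕ}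
    {w : ℕ → ℝ} (h : Ctx S v n e0 N m w) : ∑ i ∈ S, w i + w v = 1 := by
  have := sum_of_weighting h.opt.1 h.zero
  rw [Finset.sum_insert h.hv] at this
  linarith

lemma lagPoly_single (e : Finset ℕ) (w : ℕ → ℝ) : lagPoly {e} w = ∏ i ∈ e, w i := by
  simp [lagPoly]

lemma Ctx.he' {S : Finset ℕ} {v n : ℕ} {e0 : Finset ℕ} {N : Finset (Finset ℕ)} {m : ℕ}
    {w : ℕ → ℝ} (h : Ctx S v n e0 N m w) : {e0} ⊆ S.powersetCard 3 :=
  Finset.singleton_subset_iff.2 h.he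

lemma Ctx.caseA {S : Finset ℕ} {v n : ℕ} {e0 : Finset ℕ} {N : Finset (Finset ℕ)} {m : ℕ}
    {w : ℕ → ℝ} (h : Ctx S v n e0 N m w) (hc : n - 1 ≤ N.card) : False := by
  have h1 := clique h.hn h.hS h.hv h.hN hc h.opt.1.1 h.zero h.sum
  have h2 := h.hL
  rw [GG_val h.hv h.he' h.hN, lagPoly_single] at h2
  have h3 : 0 < ∏ i ∈ e0, w i := Finset.prod_pos fun i hi =>
    h.pos i (Finset.mem_insert_of_mem ((Finset.mem_powersetCard.1 h.he).1 hi))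
  linarith

lemma lagPoly_split (N : Finset (Finset ℕ)) (w : ℕ → ℝ) (c : ℕ) :
    lagPoly N w = lagPoly (N.filter (fun e => c ∉ e)) w + w c * pd N w c := by
  unfold lagPoly pd
  rw [Finset.sum_filter, Finset.mul_sum, ← Finset.sum_add_distrib]
  refine Finset.sum_congr rfl fun e _ => ?_
  by_cases hce : c ∈ e
  · simp only [hce, not_true_eq_false, if_false, if_true, zero_add]
    rw [Finset.mul_prod_erase _ _ hce]
  · simp [hce]

lemma val_split {S : Finset ℕ} {v : ℕ} {e0 : Finset ℕ} {N : Finset (Finset ℕ)} (hv : v ∉ S)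
    (he : e0 ∈ S.powersetCard 3) (hN : N ⊆ S.powersetCard 2) (c : ℕ) (hc : c ∈ e0) (w : ℕ → ℝ) :
    lagPoly (GG S v {e0} N) w = lagPoly ((S.erase c).powersetCard 3) w
      + w c * lagPoly ((S.erase c).powersetCard 2) w - w c * ∏ i ∈ e0.erase c, w i
      + w v * (lagPoly ((S.erase c).powersetCard 2) w + w c * lagPoly ((S.erase c).powersetCard 1) w
        - lagPoly (N.filter (fun e => c ∉ e)) w - w c * lagPoly (lnk N c) w) := by
  have hcS : c ∈ S := (Finset.mem_powersetCard.1 he).1 hc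
  rw [GG_val hv (Finset.singleton_subset_iff.2 he) hN, lagPoly_single, lagPoly_split N w c,
    Finset.mul_prod_erase _ _ hc, pd_eq_lnk]
  have h := fun k => lagPoly_insert (S.erase c) c (Finset.notMem_erase c S) k w
  rw [Finset.insert_erase hcS] at h
  rw [h 2, h 1]; ring

lemma swap_val {S : Finset ℕ} {v : ℕ} {e0 : Finset ℕ} {N : Finset (Finset ℕ)} (hv : v ∉ S)
    (he : e0 ∈ S.powersetCard 3) (hN : N ⊆ S.powersetCard 2) (c : ℕ) (hc : c ∈ e0) (w : ℕ → ℝ) :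
    lagPoly (GG S v {e0} N) (fun i => w (Equiv.swap c v i)) = lagPoly (GG S v {e0} N) w +
      (w v - w c) * (lagPoly (N.filter (fun e => c ∉ e)) w - ∏ i ∈ e0.erase c, w i) := by
  set u : ℕ → ℝ := fun i => w (Equiv.swap c v i) with hu
  have hcong : ∀ A : Finset (Finset ℕ), (∀ e ∈ A, c ∉ e ∧ v ∉ e) → lagPoly A u = lagPoly A w := by
    intro A hA
    refine lagPoly_congr fun e he i hi => ?_
    simp only [hu]
    rw [Equiv.swap_apply_of_ne_of_ne]
    · rintro rfl; exact (hA e he).1 hi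
    · rintro rfl; exact (hA e he).2 hi
  have hSe : ∀ k, ∀ e ∈ (S.erase c).powersetCard k, c ∉ e ∧ v ∉ e := by
    intro k e he
    have hs := (Finset.mem_powersetCard.1 he).1
    exact ⟨fun h => Finset.notMem_erase c S (hs h), fun h => hv (Finset.mem_of_mem_erase (hs h))⟩
  have hNv : ∀ e ∈ N, v ∉ e := fun e he h => hv ((Finset.mem_powersetCard.1 (hN he)).1 h)
  have hev : v ∉ e0 := fun h => hv ((Finset.mem_powersetCard.1 he).1 h)
  have h1 : lagPoly (N.filter (fun e => c ∉ e)) u = lagPoly (N.filter (fun e => c ∉ e)) w := by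
    apply hcong
    intro e he
    obtain ⟨h1, h2⟩ := Finset.mem_filter.1 he
    exact ⟨h2, hNv e h1⟩
  have h2 : lagPoly (lnk N c) u = lagPoly (lnk N c) w := by
    apply hcong
    intro e he
    obtain ⟨f, hf, rfl⟩ := Finset.mem_image.1 he
    exact ⟨Finset.notMem_erase _ _, fun h => hNv f (Finset.mem_filter.1 hf).1 (Finset.mem_of_mem_erase h)⟩
  have h3 : ∏ i ∈ e0.erase c, u i = ∏ i ∈ e0.erase c, w i := by
    rw [← lagPoly_single, ← lagPoly_single]
    apply hcong
    intro e he
    rw [Finset.mem_singleton.1 he]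
    exact ⟨Finset.notMem_erase _ _, fun h => hev (Finset.mem_of_mem_erase h)⟩
  rw [val_split hv he hN c hc u, val_split hv he hN c hc w, h1, h2, h3, hcong _ (hSe 1),
    hcong _ (hSe 2), hcong _ (hSe 3)]
  have hc' : u c = w v := by simp [hu]
  have hv' : u v = w c := by simp [hu]
  rw [hc', hv']; ring

lemma swap_mem {S : Finset ℕ} {v c : ℕ} (hc : c ∈ S) (i : ℕ) :
    Equiv.swap c v i ∈ insert v S ↔ i ∈ insert v S := by
  by_cases h1 : i = c
  · subst h1; simp [hc]
  · by_cases h2 : i = v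
    · subst h2; simp [hc]
    · rw [Equiv.swap_apply_of_ne_of_ne h1 h2]

lemma swap_sum {S : Finset ℕ} {v c : ℕ} (hc : c ∈ S) (w : ℕ → ℝ) :
    ∑ i ∈ insert v S, w (Equiv.swap c v i) = ∑ i ∈ insert v S, w i := by
  apply Finset.sum_equiv (Equiv.swap c v)
  · intro i; exact (swap_mem hc i).symm
  · intro i _; rfl

lemma Ctx.N0_pos {S : Finset ℕ} {v n : ℕ} {e0 : Finset ℕ} {N : Finset (Finset ℕ)} {m : ℕ}
    {w : ℕ → ℝ} (h : Ctx S v n e0 N m w) (c : ℕ) (hc : c ∈ e0) :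
    0 < lagPoly (N.filter (fun e => c ∉ e)) w := by
  have hcS : c ∈ S := (Finset.mem_powersetCard.1 h.he).1 hc
  have hcv : c ≠ v := by rintro rfl; exact h.hv hcS
  have hvE : v ∉ S.erase c := fun hh => h.hv (Finset.mem_of_mem_erase hh)
  have hA : (insert v (S.erase c)).card = n := by
    rw [Finset.card_insert_of_notMem hvE, Finset.card_erase_of_mem hcS, h.hS]; have := h.hn; omega
  obtain ⟨f, hf, hfG⟩ := Finset.not_subset.1 (h.noK _ hA)
  obtain ⟨hf1, hf2⟩ := Finset.mem_powersetCard.1 hf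
  have hcf : c ∉ f := by
    intro hh
    rcases Finset.mem_insert.1 (hf1 hh) with h1 | h1
    · exact hcv h1
    · exact Finset.notMem_erase _ _ h1
  have hvf : v ∈ f := by
    by_contra hvf
    apply hfG
    apply Finset.mem_union_left
    rw [Finset.mem_sdiff, Finset.mem_powersetCard, Finset.mem_singleton]
    refine ⟨⟨fun x hx => ?_, hf2⟩, by rintro rfl; exact hcf hc⟩
    rcases Finset.mem_insert.1 (hf1 hx) with h1 | h1
    · rw [h1] at hx; exact absurd hx hvf
    · exact Finset.mem_of_mem_erase h1
  have hsub : f.erase v ⊆ S := by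
    intro x hx
    obtain ⟨hx1, hx2⟩ := Finset.mem_erase.1 hx
    rcases Finset.mem_insert.1 (hf1 hx2) with h1 | h1
    · exact absurd h1 hx1
    · exact Finset.mem_of_mem_erase h1
  have hfN : f.erase v ∈ N := by
    by_contra hfN
    apply hfG
    apply Finset.mem_union_right
    rw [Finset.mem_image]
    refine ⟨f.erase v, ?_, Finset.insert_erase hvf⟩
    rw [Finset.mem_sdiff, Finset.mem_powersetCard]
    exact ⟨⟨hsub, by rw [Finset.card_erase_of_mem hvf, hf2]⟩, hfN⟩
  apply Finset.sum_pos'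
  · intro e _; exact Finset.prod_nonneg fun i _ => h.opt.1.1 i
  · refine ⟨f.erase v, Finset.mem_filter.2 ⟨hfN, fun hh => hcf (Finset.mem_of_mem_erase hh)⟩, ?_⟩
    exact Finset.prod_pos fun i hi => h.pos i (Finset.mem_insert_of_mem (hsub hi))

lemma Ctx.star {S : Finset ℕ} {v n : ℕ} {e0 : Finset ℕ} {N : Finset (Finset ℕ)} {m : ℕ}
    {w : ℕ → ℝ} (h : Ctx S v n e0 N m w) (c : ℕ) (hc : c ∈ e0) (hf : e0.erase c ∉ N)
    {u : ℕ → ℝ} (h0 : ∀ i, 0 ≤ u i) (hz : ∀ i, i ∉ insert v S → u i = 0)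
    (hsum : ∑ i ∈ insert v S, u i = 1) :
    lagPoly (GG S v {e0} N) u + (∏ i ∈ e0.erase c, u i) * (u c - u v) ≤ Lam n := by
  obtain ⟨he1, he2⟩ := Finset.mem_powersetCard.1 h.he
  have hN' : insert (e0.erase c) N ⊆ S.powersetCard 2 := by
    apply Finset.insert_subset _ h.hN
    rw [Finset.mem_powersetCard, Finset.card_erase_of_mem hc, he2]
    exact ⟨(Finset.erase_subset _ _).trans he1, rfl⟩
  have hcard : n - 1 ≤ (insert (e0.erase c) N).card := by
    rw [Finset.card_insert_of_notMem hf]; have := h.hc; omega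
  rw [Finset.sum_insert h.hv, add_comm] at hsum
  have h1 := clique h.hn h.hS h.hv hN' hcard h0 hz hsum
  rw [GG_val h.hv h.he' h.hN, lagPoly_single, ← Finset.mul_prod_erase e0 u hc]
  have h2 : lagPoly (insert (e0.erase c) N) u = ∏ i ∈ e0.erase c, u i + lagPoly N u := by
    unfold lagPoly; rw [Finset.sum_insert hf]
  rw [h2] at h1
  linarith

lemma Ctx.caseB {S : Finset ℕ} {v n : ℕ} {e0 : Finset ℕ} {N : Finset (Finset ℕ)} {m : ℕ}
    {w : ℕ → ℝ} (h : Ctx S v n e0 N m w) (c : ℕ) (hc : c ∈ e0) (hf : e0.erase c ∉ N) : False := by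
  obtain ⟨he1, he2⟩ := Finset.mem_powersetCard.1 h.he
  have hcS := he1 hc
  have hcv : c ≠ v := by rintro rfl; exact h.hv hcS
  have hL := h.hL
  have hP : 0 < ∏ i ∈ e0.erase c, w i := Finset.prod_pos fun i hi =>
    h.pos i (Finset.mem_insert_of_mem (he1 (Finset.mem_of_mem_erase hi)))
  have hwc := h.pos c (Finset.mem_insert_of_mem hcS)
  have hwv := h.pos v (Finset.mem_insert_self _ _)
  have hE : ∀ e ∈ GG S v {e0} N, e.card = 3 :=
    fun e he => (Finset.mem_powersetCard.1 (GG_sub h.hv he)).2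
  rcases lt_trichotomy (w c) (w v) with hlt | heq | hgt
  · have hN0 := h.N0_pos c hc
    have h1 := h.star c hc hf (u := fun i => w (Equiv.swap c v i)) (fun i => h.opt.1.1 _)
      (fun i hi => h.zero _ (by rwa [swap_mem hcS]))
      (by rw [swap_sum hcS]; exact sum_of_weighting h.opt.1 h.zero)
    rw [swap_val h.hv h.he h.hN c hc] at h1
    have h3 : ∏ i ∈ e0.erase c, w (Equiv.swap c v i) = ∏ i ∈ e0.erase c, w i := by
      refine Finset.prod_congr rfl fun i hi => ?_
      obtain ⟨hi1, hi2⟩ := Finset.mem_erase.1 hi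
      rw [Equiv.swap_apply_of_ne_of_ne hi1]
      rintro rfl; exact h.hv (he1 hi2)
    simp only [h3, Equiv.swap_apply_left, Equiv.swap_apply_right] at h1
    have := mul_pos (sub_pos.2 hlt) hN0
    linarith
  · set G := GG S v {e0} N with hG
    set D := pd (lnk G v) w c with hD
    have hD0 : 0 ≤ D := by rw [hD, pd_eq_lnk]; exact lagPoly_nonneg _ _ h.opt.1.1
    set P := ∏ i ∈ e0.erase c, w i with hPd
    have key : ∀ t, 0 ≤ t → t ≤ w v → 2 * t * P ≤ t ^ 2 * D := by
      intro t ht htv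
      have hW := move_isWeighting h.opt.1 c v hcv hwc t ht htv hwv
      set u := Function.update (Function.update w c (w c + t)) v (w v - t) with hu
      have huo : ∀ i, i ≠ c → i ≠ v → u i = w i := by
        intro i h1 h2; rw [hu, Function.update_of_ne h2, Function.update_of_ne h1]
      have hz : ∀ i, i ∉ insert v S → u i = 0 := by
        intro i hi
        rw [huo i (by rintro rfl; exact hi (Finset.mem_insert_of_mem hcS))
          (by rintro rfl; exact hi (Finset.mem_insert_self _ _))]
        exact h.zero i hi
      have h1 := h.star c hc hf hW.1 hz (sum_of_weighting hW hz)
      have h3 : ∏ i ∈ e0.erase c, u i = P := by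
        refine Finset.prod_congr rfl fun i hi => ?_
        obtain ⟨hi1, hi2⟩ := Finset.mem_erase.1 hi
        exact huo i hi1 (by rintro rfl; exact h.hv (he1 hi2))
      have huc : u c = w c + t := by rw [hu, Function.update_of_ne hcv, Function.update_self]
      have huv : u v = w v - t := by rw [hu, Function.update_self]
      rw [h3, huc, huv, ← hG, hu, lagPoly_move G w c v hcv t, kkt_eq h.opt c v hwc hwv, ← hD] at h1
      rw [heq] at h1
      linarith
    have ht0 : 0 < min (w v) (P / (D + 1)) := lt_min hwv (by positivity)
    have h1 := key _ ht0.le (min_le_left _ _)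
    have h2 : min (w v) (P / (D + 1)) ≤ P / (D + 1) := min_le_right _ _
    set t := min (w v) (P / (D + 1))
    rw [le_div_iff₀ (by linarith)] at h2
    nlinarith
  · have h1 := h.star c hc hf h.opt.1.1 h.zero (sum_of_weighting h.opt.1 h.zero)
    have := mul_pos hP (sub_pos.2 hgt)
    linarith

lemma Ctx.swap {S : Finset ℕ} {v n : ℕ} {e0 : Finset ℕ} {N : Finset (Finset ℕ)} {m : ℕ}
    {w : ℕ → ℝ} (h : Ctx S v n e0 N m w) (c : ℕ) (hc : c ∈ e0) (hf : e0.erase c ∈ N)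
    (hlt : w c < w v) : ∃ m', Ctx S v n e0 N m' (fun i => w (Equiv.swap c v i)) := by
  obtain ⟨he1, he2⟩ := Finset.mem_powersetCard.1 h.he
  have hcS := he1 hc
  have hz : ∀ i, i ∉ insert v S → w (Equiv.swap c v i) = 0 :=
    fun i hi => h.zero _ (by rwa [swap_mem hcS])
  have hge : lagPoly (GG S v {e0} N) w ≤
      lagPoly (GG S v {e0} N) (fun i => w (Equiv.swap c v i)) := by
    rw [swap_val h.hv h.he h.hN c hc]
    have : ∏ i ∈ e0.erase c, w i ≤ lagPoly (N.filter (fun e => c ∉ e)) w := by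
      unfold lagPoly
      apply Finset.single_le_sum (f := fun e => ∏ i ∈ e, w i)
        (fun e _ => Finset.prod_nonneg fun i _ => h.opt.1.1 i)
      exact Finset.mem_filter.2 ⟨hf, Finset.notMem_erase _ _⟩
    have := mul_nonneg (sub_nonneg.2 hlt.le) (sub_nonneg.2 this)
    linarith
  have hW := weighting_of (A := insert v S) (w := fun i => w (Equiv.swap c v i))
    (fun i => h.opt.1.1 _) hz (by rw [swap_sum hcS]; exact sum_of_weighting h.opt.1 h.zero)
  refine ⟨_, h.hn, h.hS, h.hv, h.he, h.hN, ⟨hW, fun n' w' hw' => (h.opt.2 n' w' hw').trans hge⟩,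
    fun i hi => h.pos _ (by rwa [swap_mem hcS]), hz, h.hL.trans hge, h.hc, h.noK⟩

lemma Ctx.caseC {S : Finset ℕ} {v n : ℕ} {e0 : Finset ℕ} {N : Finset (Finset ℕ)} {m : ℕ}
    {w : ℕ → ℝ} (h : Ctx S v n e0 N m w) (hc : N.card = n - 2)
    (hmin : ∀ i ∈ e0, w v ≤ w i) : False := by
  obtain ⟨he1, he2⟩ := Finset.mem_powersetCard.1 h.he
  have hn := h.hn
  have hn5 : (5:ℝ) ≤ n := by exact_mod_cast hn
  have hL := h.hL
  have hS := h.hS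
  have hcc : (N.card : ℝ) = n - 2 := by rw [hc, Nat.cast_sub (by omega)]; simp
  have hwv := h.pos v (Finset.mem_insert_self _ _)
  have hJ := core h.hn h.hS h.hv h.he' h.hN h.opt
    (fun i hi => h.pos i (Finset.mem_insert_of_mem hi)) h.sum
  have hsum := h.sum
  set d' : ℕ → ℝ := fun i => dg N i + (if i ∈ e0 then 2 / 3 else 0) with hd'
  have hEd : ∑ i ∈ e0, dg N i ≤ 3 * ((n:ℝ) - 1) / 2 := by
    obtain ⟨a, b, c, hab, hac, hbc, rfl⟩ := Finset.card_eq_three.1 he2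
    have hN2 : ∀ e ∈ N, e.card = 2 := fun e he => (Finset.mem_powersetCard.1 (h.hN he)).2
    have h1 := dg_pair hN2 a b hab
    have h2 := dg_pair hN2 a c hac
    have h3 := dg_pair hN2 b c hbc
    rw [Finset.sum_insert (by simp [hab, hac]), Finset.sum_pair hbc]
    rw [hcc] at h1 h2 h3
    linarith
  have hd1 : ∑ i ∈ S, d' i = 2 * n - 2 := by
    simp only [hd']
    rw [Finset.sum_add_distrib, sum_ite_mem_sub he1, sum_dg_one h.hN, hcc]
    simp [he2]; ring
  have hd2 : ∑ i ∈ S, d' i ^ 2 ≤ (n:ℝ) ^ 2 - n + 4 / 3 := by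
    have : ∀ i ∈ S, d' i ^ 2 = dg N i ^ 2 + (if i ∈ e0 then 4 / 3 * dg N i + 4 / 9 else 0) := by
      intro i _
      simp only [hd']; split_ifs <;> ring
    rw [Finset.sum_congr rfl this, Finset.sum_add_distrib, sum_ite_mem_sub he1,
      Finset.sum_add_distrib, ← Finset.mul_sum]
    have h1 := sum_dg_sq h.hN
    rw [hcc] at h1
    simp only [Finset.sum_const, he2, nsmul_eq_mul]
    push_cast
    nlinarith
  have hq := quad h.hS (fun i => 1 / n - w i) d' (w v) _ (by
        rw [Finset.sum_sub_distrib]; simp only [Finset.sum_const, hS, nsmul_eq_mul]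
        rw [mul_one_div_cancel (by positivity)]; linarith) hd1 hd2
  have hX : ∑ i ∈ S, d' i * (1 / n - w i) =
      ∑ i ∈ S, dg N i * (1 / n - w i) + 2 / 3 * (3 / n - ∑ i ∈ e0, w i) := by
    have : ∀ i ∈ S, d' i * (1 / n - w i) = dg N i * (1 / n - w i)
        + (if i ∈ e0 then 2 / 3 * (1 / n - w i) else 0) := by
      intro i _
      simp only [hd']; split_ifs <;> ring
    rw [Finset.sum_congr rfl this, Finset.sum_add_distrib, sum_ite_mem_sub he1, ← Finset.mul_sum,
      Finset.sum_sub_distrib]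
    simp only [Finset.sum_const, he2, nsmul_eq_mul]
    push_cast; ring
  have hQ : 2 * w v * ∑ i ∈ e0, w i - 3 * w v ^ 2 ≤ ∑ i ∈ S, pd {e0} w i := by
    have h1 : ∑ i ∈ S, pd {e0} w i = ∑ i ∈ e0, ∏ j ∈ e0.erase i, w j := by
      rw [← sum_ite_mem_sub he1]
      refine Finset.sum_congr rfl fun i _ => ?_
      simp [pd]
    rw [h1]
    obtain ⟨a, b, c, hab, hac, hbc, rfl⟩ := Finset.card_eq_three.1 he2
    have e1 : ({a, b, c} : Finset ℕ).erase a = {b, c} := by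
      rw [Finset.erase_insert]; simp [hab, hac]
    have e2 : ({a, b, c} : Finset ℕ).erase b = {a, c} := by
      rw [Finset.insert_comm, Finset.erase_insert]; simp [hab.symm, hbc]
    have e3 : ({a, b, c} : Finset ℕ).erase c = {a, b} := by
      rw [Finset.pair_comm, Finset.insert_comm, Finset.erase_insert]; simp [hac.symm, hbc.symm]
    have ha : a ∉ ({b, c} : Finset ℕ) := by simp [hab, hac]
    rw [Finset.sum_insert ha, Finset.sum_pair hbc, Finset.sum_insert ha, Finset.sum_pair hbc,
      e1, e2, e3, Finset.prod_pair hbc, Finset.prod_pair hac, Finset.prod_pair hab]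
    have h1 := hmin a (by simp)
    have h2 := hmin b (by simp)
    have h3 := hmin c (by simp)
    nlinarith [mul_nonneg (sub_nonneg.2 h1) (sub_nonneg.2 h2),
      mul_nonneg (sub_nonneg.2 h1) (sub_nonneg.2 h3), mul_nonneg (sub_nonneg.2 h2) (sub_nonneg.2 h3)]
  have hX3 : 3 * w v ≤ ∑ i ∈ e0, w i := by
    have := Finset.card_nsmul_le_sum e0 w (w v) hmin
    rw [he2, nsmul_eq_mul] at this
    exact_mod_cast this
  rw [hX] at hq
  rw [hcc] at hJ
  set μ := w v
  set X := ∑ i ∈ e0, w i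
  set V := ∑ i ∈ S, (1 / (n:ℝ) - w i) ^ 2
  set Y := ∑ i ∈ S, dg N i * (1 / (n:ℝ) - w i)
  set Q := ∑ i ∈ S, pd {e0} w i
  have hnL : 0 ≤ 3 * n * (lagPoly (GG S v {e0} N) w - Lam n) := by
    apply mul_nonneg (by linarith) (by linarith)
  have hJ1 : n * μ ^ 2 / 2 + (n - 2) / 2 * V - 2 * μ / n + 2 * μ * X - 3 * μ ^ 2 ≤ μ * Y := by
    have : 2 * ((n:ℝ) - 2 - n + 1) * μ / n = - (2 * μ / n) := by ring
    rw [this] at hJ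
    linarith
  have hXm := mul_le_mul_of_nonneg_left hX3 hwv.le
  have hJ2 : (n / 2 + 1) * μ ^ 2 + (n - 2) / 2 * V ≤ μ * (Y + 2 / 3 * (3 / n - X)) := by
    have : μ * (Y + 2 / 3 * (3 / n - X)) = μ * Y + 2 * μ / n - 2 / 3 * μ * X := by ring
    rw [this]; nlinarith
  have hJ3 := mul_le_mul_of_nonneg_left hJ2 (by linarith : (0:ℝ) ≤ 2 * (n - 2))
  have hmu2 : 0 < μ ^ 2 := by positivity
  have hfin : μ ^ 2 * ((n:ℝ) ^ 2 + n - 4) ≤ μ ^ 2 * ((n:ℝ) ^ 2 - n + 4 / 3) := by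
    linarith
  have := le_of_mul_le_mul_left hfin hmu2
  linarith

lemma Ctx.false {S : Finset ℕ} {v n : ℕ} {e0 : Finset ℕ} {N : Finset (Finset ℕ)} {m : ℕ}
    {w : ℕ → ℝ} (h : Ctx S v n e0 N m w) : False := by
  by_cases hA : n - 1 ≤ N.card
  · exact h.caseA hA
  have hc : N.card = n - 2 := by have := h.hc; omega
  by_cases hB : ∃ c ∈ e0, e0.erase c ∉ N
  · obtain ⟨c, hc, hf⟩ := hB
    exact h.caseB c hc hf
  push Not at hB
  by_cases hmin : ∀ i ∈ e0, w v ≤ w i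
  · exact h.caseC hc hmin
  push Not at hmin
  obtain ⟨he1, he2⟩ := Finset.mem_powersetCard.1 h.he
  obtain ⟨i, hi, hiv⟩ := hmin
  obtain ⟨c, hce, hcm⟩ := Finset.exists_min_image e0 w ⟨i, hi⟩
  have hlt : w c < w v := (hcm i hi).trans_lt hiv
  obtain ⟨m', h'⟩ := h.swap c hce (hB c hce) hlt
  refine h'.caseC hc fun j hj => ?_
  simp only [Equiv.swap_apply_right]
  by_cases hjc : j = c
  · subst hjc; simp only [Equiv.swap_apply_left]; exact hlt.le
  · rw [Equiv.swap_apply_of_ne_of_ne hjc (by rintro rfl; exact h.hv (he1 hj))]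
    exact hcm j hj

/-- If the support lies in an `n`-set, then the value is below `Lam n`. -/
lemma small_support {E : Finset (Finset ℕ)} (hE : ∀ e ∈ E, e.card = 3) {n m : ℕ} (hn : 5 ≤ n)
    {w : ℕ → ℝ} (h : IsWeighting m w) {A : Finset ℕ} (hA : A.card = n)
    (hz : ∀ i, i ∉ A → w i = 0) (hK : ¬ A.powersetCard 3 ⊆ E) (hL : Lam n ≤ lagPoly E w) :
    False := by
  obtain ⟨f, hf, hfE⟩ := Finset.not_subset.1 hK
  have hs := sum_of_weighting h hz
  have h1 : lagPoly E w ≤ lagPoly (A.powersetCard 3 \ {f}) w := by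
    rw [lagPoly_restrict E w A hz]
    apply lagPoly_mono_set _ _ h.1
    intro e he
    obtain ⟨h1, h2⟩ := Finset.mem_filter.1 he
    rw [Finset.mem_sdiff, Finset.mem_powersetCard, Finset.mem_singleton]
    exact ⟨⟨h2, hE e h1⟩, by rintro rfl; exact hfE h1⟩
  rw [lagPoly_sdiff (Finset.singleton_subset_iff.2 hf), lagPoly_single] at h1
  have h2 : 0 ≤ ∏ i ∈ f, w i := Finset.prod_nonneg fun i _ => h.1 i
  obtain ⟨h3, h4⟩ := e3_le A w n hn hA h.1 hs
  have h5 := h4 (by linarith)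
  have h6 : 0 < ∏ i ∈ f, w i := by
    refine Finset.prod_pos fun i hi => ?_
    rw [h5 i ((Finset.mem_powersetCard.1 hf).1 hi)]
    have : 0 < n := by omega
    positivity
  linarith

lemma main_false {E : Finset (Finset ℕ)} (hE : ∀ e ∈ E, e.card = 3) {n m : ℕ} (hn : 5 ≤ n)
    (hcard : E.card ≤ n.choose 3 + (n - 1).choose 2) {S e0 : Finset ℕ} (hS : S.card = n)
    (he : e0 ∈ S.powersetCard 3) (hsub : S.powersetCard 3 \ {e0} ⊆ E)
    (hnoK : ∀ A : Finset ℕ, A.card = n → ¬ A.powersetCard 3 ⊆ E)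
    {w : ℕ → ℝ} (h : IsOpt E m w) (hL : Lam n ≤ lagPoly E w) : False := by
  have h0 := h.1.1
  have he0E : e0 ∉ E := by
    intro hh
    apply hnoK S hS
    intro f hf
    by_cases hfe : f = e0
    · rw [hfe]; exact hh
    · exact hsub (Finset.mem_sdiff.2 ⟨hf, by simpa using hfe⟩)
  have hout : (E \ (S.powersetCard 3 \ {e0})).card ≤ (n - 1).choose 2 + 1 := by
    rw [Finset.card_sdiff_of_subset hsub, Finset.card_sdiff_of_subset (Finset.singleton_subset_iff.2 he),
      Finset.card_powersetCard, hS, Finset.card_singleton]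
    have : 0 < n.choose 3 := Nat.choose_pos (by omega)
    omega
  -- at most one positive vertex outside
  have honeout : ∀ q r, q ∉ S → r ∉ S → 0 < w q → 0 < w r → q = r := by
    intro q r hqS hrS hq hr
    by_contra hqr
    refine two_out hE h n hn hL q r hqr hq hr ?_
    refine le_trans (Finset.card_le_card ?_) hout
    intro e hee
    obtain ⟨h1, h2⟩ := Finset.mem_filter.1 hee
    rw [Finset.mem_sdiff]
    refine ⟨h1, fun h3 => ?_⟩
    have h4 := (Finset.mem_powersetCard.1 (Finset.mem_sdiff.1 h3).1).1
    rcases h2 with h2 | h2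
    · exact hqS (h4 h2)
    · exact hrS (h4 h2)
  by_cases hex : ∃ v, v ∉ S ∧ 0 < w v
  swap
  · push Not at hex
    exact small_support hE hn h.1 hS (fun i hi => le_antisymm (hex i hi) (h0 i)) (hnoK S hS) hL
  obtain ⟨v, hv, hwv⟩ := hex
  have hz : ∀ i, i ∉ insert v S → w i = 0 := by
    intro i hi
    rw [Finset.mem_insert, not_or] at hi
    by_contra hne
    exact hi.1 (honeout i v hi.2 hv (lt_of_le_of_ne (h0 i) (Ne.symm hne)) hwv)
  by_cases hall : ∀ i ∈ insert v S, 0 < w i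
  swap
  · push Not at hall
    obtain ⟨i, hi, hi0⟩ := hall
    have hi0 : w i = 0 := le_antisymm hi0 (h0 i)
    have hz' : ∀ j, j ∉ (insert v S).erase i → w j = 0 := by
      intro j hj
      by_cases hji : j = i
      · rw [hji, hi0]
      · exact hz j fun hh => hj (Finset.mem_erase.2 ⟨hji, hh⟩)
    have hc : ((insert v S).erase i).card = n := by
      rw [Finset.card_erase_of_mem hi, Finset.card_insert_of_notMem hv, hS]; simp
    exact small_support hE hn h.1 hc hz' (hnoK _ hc) hL
  set N := (S.powersetCard 2).filter (fun f => insert v f ∉ E) with hN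
  have hNS : N ⊆ S.powersetCard 2 := Finset.filter_subset _ _
  have hGE : GG S v {e0} N ⊆ E := by
    intro e hee
    rcases Finset.mem_union.1 hee with h1 | h1
    · exact hsub h1
    · obtain ⟨f, hf, rfl⟩ := Finset.mem_image.1 h1
      obtain ⟨hf1, hf2⟩ := Finset.mem_sdiff.1 hf
      by_contra hcon
      exact hf2 (Finset.mem_filter.2 ⟨hf1, hcon⟩)
  have hEG : E.filter (fun e => e ⊆ insert v S) ⊆ GG S v {e0} N := by
    intro e hee
    obtain ⟨h1, h2⟩ := Finset.mem_filter.1 hee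
    by_cases hve : v ∈ e
    · apply Finset.mem_union_right
      rw [Finset.mem_image]
      refine ⟨e.erase v, ?_, Finset.insert_erase hve⟩
      rw [Finset.mem_sdiff, Finset.mem_powersetCard]
      refine ⟨⟨fun x hx => ?_, by rw [Finset.card_erase_of_mem hve, hE e h1]⟩, fun hh => ?_⟩
      · obtain ⟨hx1, hx2⟩ := Finset.mem_erase.1 hx
        exact (Finset.mem_insert.1 (h2 hx2)).resolve_left hx1
      · have := (Finset.mem_filter.1 hh).2
        rw [Finset.insert_erase hve] at this
        exact this h1
    · apply Finset.mem_union_left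
      rw [Finset.mem_sdiff, Finset.mem_powersetCard, Finset.mem_singleton]
      refine ⟨⟨fun x hx => (Finset.mem_insert.1 (h2 hx)).resolve_left ?_, hE e h1⟩, ?_⟩
      · rintro rfl; exact hve hx
      · rintro rfl; exact he0E h1
  have hval : lagPoly (GG S v {e0} N) w = lagPoly E w := by
    apply le_antisymm (lagPoly_mono_set hGE w h0)
    rw [lagPoly_restrict E w _ hz]
    exact lagPoly_mono_set hEG w h0
  have hNcard : n - 2 ≤ N.card := by
    have h1 : ((S.powersetCard 2 \ N).image (insert v)).card ≤ (n - 1).choose 2 + 1 := by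
      refine le_trans (Finset.card_le_card ?_) hout
      intro e hee
      rw [Finset.mem_sdiff]
      refine ⟨hGE (Finset.mem_union_right _ hee), fun h3 => ?_⟩
      have h4 := (Finset.mem_powersetCard.1 (Finset.mem_sdiff.1 h3).1).1
      obtain ⟨f, hf, rfl⟩ := Finset.mem_image.1 hee
      exact hv (h4 (Finset.mem_insert_self _ _))
    have hvs : ∀ f ∈ S.powersetCard 2 \ N, v ∉ f := fun f hf hh =>
      hv ((Finset.mem_powersetCard.1 (Finset.mem_sdiff.1 hf).1).1 hh)
    rw [Finset.card_image_of_injOn, Finset.card_sdiff_of_subset (hNS : N ⊆ S.powersetCard 2),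
      Finset.card_powersetCard, hS] at h1
    · have h2 : n.choose 2 = (n - 1) + (n - 1).choose 2 := by
        obtain ⟨k, rfl⟩ : ∃ k, n = k + 1 := ⟨n - 1, by omega⟩
        rw [Nat.choose_succ_succ' k 1]; simp
      omega
    · intro s hs t ht hst
      have := congrArg (fun x => x.erase v) hst
      simpa [Finset.erase_insert (hvs s hs), Finset.erase_insert (hvs t ht)] using this
  have hctx : Ctx S v n e0 N m w :=
    { hn := hn, hS := hS, hv := hv, he := he, hN := Finset.filter_subset _ _
      opt := ⟨h.1, fun n' w' hw' => by
        rw [hval]; exact (lagPoly_mono_set hGE w' hw'.1).trans (h.2 n' w' hw')⟩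
      pos := hall, zero := hz, hL := by rw [hval]; exact hL
      hc := hNcard
      noK := fun A hA hh => hnoK A hA (hh.trans hGE) }
  exact hctx.false

/-- A 3-graph with m edges containing K_{t-1}^{(3)-} but no complete 3-graph on
t-1 vertices has λ(G) < λ([t-1]^{(3)}), for C(t-1,3) ≤ m ≤ C(t-1,3)+C(t-2,2), t ≥ 6. -/
theorem stmt_7 (m t : ℕ) (ht : 6 ≤ t)
    (h₁ : (t - 1).choose 3 ≤ m)
    (h₂ : m ≤ (t - 1).choose 3 + (t - 2).choose 2)
    (E : Finset (Finset ℕ)) (huni : ∀ e ∈ E, e.card = 3) (hm : E.card = m)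
    (hKminus : ∃ (s e₀ : Finset ℕ), s.card = t - 1 ∧ e₀ ∈ s.powersetCard 3 ∧
      s.powersetCard 3 \ {e₀} ⊆ E)
    (hnoK : ¬ ∃ s : Finset ℕ, s.card = t - 1 ∧ s.powersetCard 3 ⊆ E) :
    lag E < lag (completeG (t - 1) 3) := by
  obtain ⟨S, e0, hS, he, hsub⟩ := hKminus
  obtain ⟨N, w, hw⟩ := attain E
  refine lt_of_lt_of_le ?_ (Lam_le_lag (t - 1) (by omega))
  rw [lag_eq hw]
  by_contra hcon
  push Not at hcon
  refine main_false huni (n := t - 1) (by omega) ?_ hS he hsub (fun A hA hh => hnoK ⟨A, hA, hh⟩) hw hcon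
  rw [hm]
  have : t - 1 - 1 = t - 2 := by omega
  rw [this]; exact h₂
end

section
/- Let m and t be positive integers with C(t−1,3) ≤ m ≤ C(t−1,3) + C(t−2,2) − (t−2)/2. If G is a 3-uniform hypergraph with m edges whose maximum clique has order exactly t−2, then λ(G) < λ([t−1]^{(3)}). -/
open Finset

lemma sum_pc_insert (x : ℕ → ℝ) (a : ℕ) (s : Finset ℕ) (ha : a ∉ s) (r : ℕ) :
    ∑ e ∈ (insert a s).powersetCard (r+1), ∏ i ∈ e, x i =
      ∑ e ∈ s.powersetCard (r+1), ∏ i ∈ e, x i + x a * ∑ e ∈ s.powersetCard r, ∏ i ∈ e, x i := by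
  have hno : ∀ e ∈ s.powersetCard r, a ∉ e := fun e he h =>
    ha ((mem_powersetCard.mp he).1 h)
  rw [powersetCard_succ_insert ha, sum_union, sum_image, mul_sum]
  · congr 1
    refine sum_congr rfl fun e he => ?_
    rw [prod_insert (hno e he)]
  · intro e he f hf hef
    have h1 := hno e he
    have h2 := hno f hf
    have : (insert a e).erase a = (insert a f).erase a := by
      simpa using congrArg (fun z => z.erase a) hef
    simpa [h1, h2] using this
  · rw [disjoint_left]
    intro e he he'
    obtain ⟨f, hf, rfl⟩ := mem_image.mp he'
    exact ha ((mem_powersetCard.mp he).1 (mem_insert_self _ _))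

lemma e1_eq_s8 (x : ℕ → ℝ) (s : Finset ℕ) :
    ∑ e ∈ s.powersetCard 1, ∏ i ∈ e, x i = ∑ i ∈ s, x i := by
  rw [powersetCard_one, sum_map]
  simp

lemma e2_eq_s8 (x : ℕ → ℝ) (s : Finset ℕ) :
    ∑ e ∈ s.powersetCard 2, ∏ i ∈ e, x i = ((∑ i ∈ s, x i)^2 - ∑ i ∈ s, (x i)^2) / 2 := by
  induction s using Finset.induction_on with
  | empty => rw [powersetCard_eq_empty.mpr (by simp)]; simp
  | insert a s ha ih =>
    rw [sum_pc_insert x a s ha 1, ih, e1_eq_s8, sum_insert ha, sum_insert ha]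
    ring

lemma e3_eq_s8 (x : ℕ → ℝ) (s : Finset ℕ) :
    ∑ e ∈ s.powersetCard 3, ∏ i ∈ e, x i =
      ((∑ i ∈ s, x i)^3 - 3 * (∑ i ∈ s, x i) * ∑ i ∈ s, (x i)^2 + 2 * ∑ i ∈ s, (x i)^3) / 6 := by
  induction s using Finset.induction_on with
  | empty => rw [powersetCard_eq_empty.mpr (by simp)]; simp
  | insert a s ha ih =>
    rw [sum_pc_insert x a s ha 2, ih, e2_eq_s8, sum_insert ha, sum_insert ha, sum_insert ha]
    ring

/-- The Lagrangian value of the complete 3-graph on n vertices. -/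
noncomputable def lamK (n : ℕ) : ℝ := ((n:ℝ)-1)*((n:ℝ)-2)/(6*(n:ℝ)^2)

lemma IsWeighting.le_one {n : ℕ} {w : ℕ → ℝ} (h : IsWeighting n w) (i : ℕ) : w i ≤ 1 := by
  rcases lt_or_ge i n with hi | hi
  · rw [← h.2.2]
    exact single_le_sum (fun j _ => h.1 j) (mem_range.mpr hi)
  · rw [h.2.1 i hi]; norm_num

lemma e3_le_s8 (n : ℕ) (hn : 4 ≤ n) (x : ℕ → ℝ) (hx : IsWeighting n x) :
    lagPoly ((range n).powersetCard 3) x + (∑ i ∈ range n, (x i - 1/n)^2 * (3 - 2 * x i - 4/n))/6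
      = lamK n := by
  have hn' : (n:ℝ) ≠ 0 := by positivity
  rw [lagPoly, e3_eq_s8, hx.2.2]
  have : ∑ i ∈ range n, (x i - 1/n)^2 * (3 - 2 * x i - 4/n) =
     3 * ∑ i ∈ range n, (x i)^2 - 2 * ∑ i ∈ range n, (x i)^3
       - (6/n - 6/n^2) * ∑ i ∈ range n, x i + ∑ i ∈ range n, ((3:ℝ)/n^2 - 4/n^3) := by
    rw [mul_sum, mul_sum, mul_sum, ← sum_sub_distrib, ← sum_sub_distrib, ← sum_add_distrib]
    refine sum_congr rfl fun i _ => ?_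
    field_simp
    ring
  rw [this, hx.2.2, sum_const, card_range, lamK, nsmul_eq_mul]
  field_simp
  ring

lemma e3_term_nonneg (n : ℕ) (hn : 4 ≤ n) (x : ℕ → ℝ) (hx : IsWeighting n x) (i : ℕ) :
    0 ≤ (x i - 1/n)^2 * (3 - 2 * x i - 4/n) := by
  have h1 := hx.le_one i
  have hn' : (4:ℝ) ≤ n := by exact_mod_cast hn
  have : (4:ℝ)/n ≤ 1 := by rw [div_le_one (by linarith)]; exact hn'
  apply mul_nonneg (sq_nonneg _); linarith

lemma e3_le_lam (n : ℕ) (hn : 4 ≤ n) (x : ℕ → ℝ) (hx : IsWeighting n x) :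
    lagPoly ((range n).powersetCard 3) x ≤ lamK n := by
  have h := e3_le_s8 n hn x hx
  have := sum_nonneg (fun i (_ : i ∈ range n) => e3_term_nonneg n hn x hx i)
  linarith

lemma e3_lt_lam (n : ℕ) (hn : 4 ≤ n) (x : ℕ → ℝ) (hx : IsWeighting n x) (i : ℕ) (hi : i < n)
    (h0 : x i = 0) :
    lagPoly ((range n).powersetCard 3) x < lamK n := by
  have h := e3_le_s8 n hn x hx
  have h2 := single_le_sum (fun i (_ : i ∈ range n) => e3_term_nonneg n hn x hx i) (mem_range.mpr hi)
  have hn' : (4:ℝ) ≤ n := by exact_mod_cast hn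
  have : (4:ℝ)/n ≤ 1 := by rw [div_le_one (by linarith)]; exact hn'
  have h3 : 0 < (x i - 1/n)^2 * (3 - 2 * x i - 4/n) := by
    rw [h0]
    apply mul_pos
    · have : (0:ℝ) < 1/n := by positivity
      nlinarith
    · linarith
  linarith

lemma lagPoly_mono_s8 {E F : Finset (Finset ℕ)} (h : E ⊆ F) (x : ℕ → ℝ) (hx : ∀ i, 0 ≤ x i) :
    lagPoly E x ≤ lagPoly F x :=
  sum_le_sum_of_subset_of_nonneg h (fun e _ _ => prod_nonneg fun i _ => hx i)

/-- Normalization: sort the weights and discard null vertices. -/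
lemma normalize_weights (E : Finset (Finset ℕ)) (hE : ∀ e ∈ E, e.card = 3) (k : ℕ) (x : ℕ → ℝ)
    (hx : IsWeighting k x) :
    ∃ (j : ℕ) (F : Finset (Finset ℕ)) (y : ℕ → ℝ), j ≤ k ∧ ((∀ i < k, 0 < x i) → j = k) ∧
      IsWeighting j y ∧ (∀ i < j, 0 < y i) ∧ (∀ a b, a ≤ b → b < j → y b ≤ y a) ∧
      F ⊆ (range j).powersetCard 3 ∧ F.card ≤ E.card ∧ lagPoly F y = lagPoly E x ∧
      (∀ s : Finset ℕ, s.powersetCard 3 ⊆ F → ∃ s' : Finset ℕ, s'.card = s.card ∧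
        s'.powersetCard 3 ⊆ E) := by
  classical
  -- sorting permutation
  obtain ⟨π, hπ1, hπ2⟩ : ∃ π : Equiv.Perm ℕ, (∀ i, i < k ↔ π i < k) ∧
      ∀ a b, a ≤ b → b < k → x (π b) ≤ x (π a) := by
    let f : Fin k → ℝ := fun i => - x i
    let σ := Tuple.sort f
    have hmono : Monotone (f ∘ σ) := Tuple.monotone_sort f
    let π : Equiv.Perm ℕ := σ.extendDomain (Fin.equivSubtype)
    have hπ : ∀ i (h : i < k), π i = σ ⟨i, h⟩ := by
      intro i h
      have := Equiv.Perm.extendDomain_apply_subtype σ (Fin.equivSubtype (n := k)) (b := i) h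
      simpa [π] using this
    have hπ' : ∀ i (h : ¬ i < k), π i = i := by
      intro i h
      exact Equiv.Perm.extendDomain_apply_not_subtype σ (Fin.equivSubtype (n := k)) (b := i) h
    refine ⟨π, ?_, ?_⟩
    · intro i
      by_cases h : i < k
      · simp only [h, true_iff]; rw [hπ i h]; exact (σ ⟨i,h⟩).2
      · rw [hπ' i h]
    · intro a b hab hb
      have := hmono (show (⟨a, lt_of_le_of_lt hab hb⟩ : Fin k) ≤ ⟨b, hb⟩ from hab)
      simp only [Function.comp, f] at this
      rw [hπ a (lt_of_le_of_lt hab hb), hπ b hb]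
      linarith
  let y : ℕ → ℝ := fun i => x (π i)
  have hy0 : ∀ i, 0 ≤ y i := fun i => hx.1 _
  have hyk : ∀ i, k ≤ i → y i = 0 := fun i hi => hx.2.1 _ (by
    have := (hπ1 i).not; push Not at this; exact this.mp hi)
  have hysum : ∑ i ∈ range k, y i = 1 := by
    rw [← hx.2.2]
    refine sum_nbij' (fun i => π i) (fun i => π.symm i) ?_ ?_ ?_ ?_ ?_
    · intro i hi; simp only [mem_range] at *; exact (hπ1 i).mp hi
    · intro i hi; simp only [mem_range] at *; rw [hπ1]; simpa using hi
    · intro i _; simp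
    · intro i _; simp
    · intro i _; rfl
  -- length of support
  let j := ((range k).filter (fun i => 0 < y i)).card
  have hjset : ∀ i, 0 < y i ↔ i < j := by
    have hdown : ∀ a b, a ≤ b → 0 < y b → 0 < y a := by
      intro a b hab hb
      have hbk : b < k := by
        by_contra h; push Not at h; rw [hyk b h] at hb; exact lt_irrefl _ hb
      exact lt_of_lt_of_le hb (hπ2 a b hab hbk)
    intro i
    constructor
    · intro hi
      have hsub : range (i+1) ⊆ (range k).filter (fun i => 0 < y i) := by
        intro a ha
        have ha' : a ≤ i := by simpa [Nat.lt_succ_iff] using ha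
        have h := hdown a i ha' hi
        refine mem_filter.mpr ⟨mem_range.mpr ?_, h⟩
        by_contra hh; push Not at hh; rw [hyk a hh] at h; exact lt_irrefl _ h
      have := card_le_card hsub
      rw [card_range] at this
      exact this
    · intro hi
      by_contra h
      have hsub : (range k).filter (fun i => 0 < y i) ⊆ range i := by
        intro a ha
        rw [mem_range]
        by_contra hh; push Not at hh
        exact h (hdown i a hh (mem_filter.mp ha).2)
      have := card_le_card hsub
      rw [card_range] at this
      exact absurd this (not_le.mpr hi)
  have hjk : j ≤ k := by
    have := card_filter_le (range k) (fun i => 0 < y i)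
    simpa [j] using this
  have hyj : ∀ i, j ≤ i → y i = 0 := by
    intro i hi
    have := (hjset i).not.mpr (not_lt.mpr hi)
    exact le_antisymm (not_lt.mp this) (hy0 i)
  let ρ : Finset ℕ → Finset ℕ := fun e => e.map π.symm.toEmbedding
  have hρ : Function.Injective ρ := Finset.map_injective _
  have hprod : ∀ e, ∏ i ∈ ρ e, y i = ∏ i ∈ e, x i := by
    intro e; simp [ρ, y]
  have hval : lagPoly (E.image ρ) y = lagPoly E x := by
    rw [lagPoly, sum_image (fun a _ b _ h => hρ h)]
    exact sum_congr rfl fun e _ => hprod e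
  refine ⟨j, (E.image ρ).filter (fun e => e ⊆ range j), y, hjk, ?_, ⟨hy0, hyj, ?_⟩,
    fun i hi => (hjset i).mpr hi, fun a b hab hb => hπ2 a b hab (lt_of_lt_of_le hb hjk), ?_, ?_, ?_, ?_⟩
  · intro hpos
    refine le_antisymm hjk ?_
    by_contra hh; push Not at hh
    have h1 := hyj j le_rfl
    have h2 := hpos (π j) ((hπ1 j).mp hh)
    have : y j = x (π j) := rfl
    linarith
  · rw [← hysum]
    refine sum_subset (range_mono hjk) ?_
    intro i _ hi
    exact hyj i (by simpa using hi)
  · intro e he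
    obtain ⟨h1, h2⟩ := mem_filter.mp he
    obtain ⟨f, hf, rfl⟩ := mem_image.mp h1
    exact mem_powersetCard.mpr ⟨h2, by simpa [ρ] using hE f hf⟩
  · exact (card_filter_le _ _).trans card_image_le
  · rw [← hval, lagPoly, lagPoly, sum_filter]
    refine sum_congr rfl fun e _ => ?_
    split_ifs with h
    · rfl
    · symm
      obtain ⟨i, hi, hi'⟩ := not_subset.mp h
      exact prod_eq_zero hi (hyj i (by simpa using hi'))
  · intro s hs
    refine ⟨s.map π.toEmbedding, by simp, ?_⟩
    intro e he
    obtain ⟨h1, h2⟩ := mem_powersetCard.mp he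
    have : ρ e ∈ s.powersetCard 3 := by
      refine mem_powersetCard.mpr ⟨?_, by simpa [ρ] using h2⟩
      intro i hi
      obtain ⟨a, ha, rfl⟩ := mem_map.mp hi
      obtain ⟨b, hb, hb'⟩ := mem_map.mp (h1 ha)
      have : π b = a := hb'
      subst this
      simpa using hb
    obtain ⟨f, hf, hf'⟩ := mem_image.mp (mem_filter.mp (hs this)).1
    rw [← hρ hf']; exact hf

/-- The bound on the number of edges. -/
def FewEdges (n : ℕ) (E : Finset (Finset ℕ)) : Prop :=
  2 * E.card + (n - 1) ≤ 2 * n.choose 3 + 2 * (n-1).choose 2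

def Bad (n k : ℕ) : Prop :=
  ∃ E x, E ⊆ (range k).powersetCard 3 ∧ FewEdges n E ∧ IsWeighting k x ∧
    (∀ i < k, 0 < x i) ∧ lamK n ≤ lagPoly E x

/-- Left-compressed. -/
def Compressed (E : Finset (Finset ℕ)) : Prop :=
  ∀ e ∈ E, ∀ i j, j ∈ e → i ∉ e → i < j → insert i (e.erase j) ∈ E

lemma isCompact_weightings (k : ℕ) : IsCompact {w : ℕ → ℝ | IsWeighting k w} := by
  have h1 : IsCompact (Set.pi Set.univ (fun _ : ℕ => Set.Icc (0:ℝ) 1)) :=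
    isCompact_univ_pi fun _ => isCompact_Icc
  refine h1.of_isClosed_subset ?_ ?_
  · have : {w : ℕ → ℝ | IsWeighting k w} = (⋂ i, {w | 0 ≤ w i}) ∩
        ((⋂ i, ⋂ (_ : k ≤ i), {w | w i = 0}) ∩ {w | ∑ i ∈ range k, w i = 1}) := by
      ext w; simp [IsWeighting]
    rw [this]
    refine (isClosed_iInter fun i => isClosed_le continuous_const (continuous_apply i)).inter
      ((isClosed_iInter fun i => isClosed_iInter fun _ =>
        isClosed_eq (continuous_apply i) continuous_const).inter
        (isClosed_eq (by fun_prop) continuous_const))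
  · intro w hw i _
    exact ⟨hw.1 i, IsWeighting.le_one hw i⟩

lemma continuous_lagPoly (E : Finset (Finset ℕ)) : Continuous (fun w : ℕ → ℝ => lagPoly E w) := by
  unfold lagPoly
  fun_prop

lemma exists_weighting (k : ℕ) (hk : 0 < k) : {w : ℕ → ℝ | IsWeighting k w}.Nonempty := by
  refine ⟨fun i => if i = 0 then 1 else 0, ?_, ?_, ?_⟩
  · intro i; dsimp only; split_ifs <;> norm_num
  · intro i hi; dsimp only; rw [if_neg (by omega)]
  · simp [hk]

lemma exists_max_weight (E : Finset (Finset ℕ)) (k : ℕ) (hk : 0 < k) :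
    ∃ x, IsWeighting k x ∧ ∀ y, IsWeighting k y → lagPoly E y ≤ lagPoly E x := by
  obtain ⟨x, hx, hm⟩ := (isCompact_weightings k).exists_isMaxOn (exists_weighting k hk)
    (continuous_lagPoly E).continuousOn
  exact ⟨x, hx, fun y hy => hm hy⟩

lemma lagPoly_swap (E : Finset (Finset ℕ)) (e f : Finset ℕ) (he : e ∈ E) (hf : f ∉ E) (x : ℕ → ℝ) :
    lagPoly (insert f (E.erase e)) x = lagPoly E x - ∏ i ∈ e, x i + ∏ i ∈ f, x i := by
  have h : f ∉ E.erase e := fun h => hf (mem_of_mem_erase h)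
  rw [lagPoly, sum_insert h, lagPoly, ← add_sum_erase E _ he]
  ring

lemma exists_opt (n k : ℕ) (hn : 4 ≤ n) (hk : n + 1 ≤ k) (hb : Bad n k)
    (hmin : ∀ j, n + 1 ≤ j → j < k → ¬ Bad n j) :
    ∃ E x, E ⊆ (range k).powersetCard 3 ∧ FewEdges n E ∧ IsWeighting k x ∧
      (∀ i < k, 0 < x i) ∧ lamK n ≤ lagPoly E x ∧ (∀ a b, a ≤ b → b < k → x b ≤ x a) ∧
      (∀ y, IsWeighting k y → lagPoly E y ≤ lagPoly E x) ∧ Compressed E := by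
  classical
  -- a maximizing pair
  have key : ∃ E x, E ⊆ (range k).powersetCard 3 ∧ FewEdges n E ∧ IsWeighting k x ∧
      (∀ i < k, 0 < x i) ∧ lamK n ≤ lagPoly E x ∧
      (∀ F y, F ⊆ (range k).powersetCard 3 → FewEdges n F → IsWeighting k y →
        lagPoly F y ≤ lagPoly E x) := by
    obtain ⟨E0, x0, hE0, hF0, hx0, hpos0, hlam0⟩ := hb
    choose g hg1 hg2 using fun E => exists_max_weight E k (by omega)
    let C := ((range k).powersetCard 3).powerset.filter (fun E => FewEdges n E)
    have hC : E0 ∈ C := mem_filter.mpr ⟨mem_powerset.mpr hE0, hF0⟩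
    obtain ⟨E, hEC, hEmax⟩ := exists_max_image C (fun E => lagPoly E (g E)) ⟨E0, hC⟩
    have hE1 := mem_powerset.mp (mem_filter.mp hEC).1
    have hE2 : FewEdges n E := (mem_filter.mp hEC).2
    have hall : ∀ F y, F ⊆ (range k).powersetCard 3 → FewEdges n F → IsWeighting k y →
        lagPoly F y ≤ lagPoly E (g E) := by
      intro F y h1 h2 h3
      exact (hg2 F y h3).trans (hEmax F (mem_filter.mpr ⟨mem_powerset.mpr h1, h2⟩))
    obtain ⟨j, F, y, hjk, -, hy, hypos, hyanti, hF, hFc, hFv, -⟩ :=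
      normalize_weights E (fun e he => (mem_powersetCard.mp (hE1 he)).2) k (g E) (hg1 E)
    have hFF : FewEdges n F := by unfold FewEdges at *; omega
    have hlam : lamK n ≤ lagPoly F y := by
      rw [hFv]; exact hlam0.trans (hall E0 x0 hE0 hF0 hx0)
    rcases lt_or_ge j k with hlt | hge
    · rcases le_or_gt (n+1) j with h | h
      · exact absurd ⟨F, y, hF, hFF, hy, hypos, hlam⟩ (hmin j h hlt)
      · refine ⟨E0, x0, hE0, hF0, hx0, hpos0, hlam0, ?_⟩
        intro F' y' h1 h2 h3
        refine (hall F' y' h1 h2 h3).trans (le_trans ?_ hlam0)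
        rw [← hFv]
        refine (lagPoly_mono_s8 (hF.trans (powersetCard_mono (range_mono (by omega : j ≤ n)))) y hy.1).trans
          (e3_le_lam n hn y ⟨hy.1, fun i hi => hy.2.1 i (by omega), ?_⟩)
        rw [← hy.2.2]
        symm
        refine sum_subset (range_mono (by omega)) ?_
        intro i _ hi
        exact hy.2.1 i (by simpa using hi)
    · have : j = k := le_antisymm hjk hge
      subst this
      exact ⟨F, y, hF, hFF, hy, hypos, hlam, fun F' y' h1 h2 h3 => by
        rw [hFv]; exact hall F' y' h1 h2 h3⟩
  obtain ⟨E, x, hE, hEF, hx, hpos, hlam, hmax⟩ := key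
  -- sort
  obtain ⟨j, F, y, hjk, hj, hy, hypos, hyanti, hF, hFc, hFv, -⟩ :=
      normalize_weights E (fun e he => (mem_powersetCard.mp (hE he)).2) k x hx
  have := hj hpos
  subst this
  rw [← hFv] at hmax hlam
  have hFF : FewEdges n F := by unfold FewEdges at *; omega
  -- choose edges of least index sum
  let C := ((range j).powersetCard 3).powerset.filter
    (fun E => FewEdges n E ∧ lagPoly E y = lagPoly F y)
  obtain ⟨G, hG, hGmin⟩ := exists_min_image C (fun E => ∑ e ∈ E, ∑ i ∈ e, i)
    ⟨F, mem_filter.mpr ⟨mem_powerset.mpr hF, hFF, rfl⟩⟩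
  obtain ⟨hG1, hG2, hG3⟩ := mem_filter.mp hG
  rw [mem_powerset] at hG1
  refine ⟨G, y, hG1, hG2, hy, hypos, by rw [hG3]; exact hlam, hyanti, ?_, ?_⟩
  · intro z hz; rw [hG3]; exact hmax G z hG1 hG2 hz
  · intro e he a b hb ha hab
    by_contra hne
    obtain ⟨her, hec⟩ := mem_powersetCard.mp (hG1 he)
    have hbj : b < j := mem_range.mp (her hb)
    have haer : a ∉ e.erase b := fun h => ha (mem_of_mem_erase h)
    set f := insert a (e.erase b) with hf
    have hfm : f ∈ (range j).powersetCard 3 := by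
      refine mem_powersetCard.mpr ⟨?_, ?_⟩
      · refine insert_subset (mem_range.mpr (by omega)) ((erase_subset _ _).trans her)
      · rw [hf, card_insert_of_notMem haer, card_erase_of_mem hb]; omega
    have hsub : insert f (G.erase e) ⊆ (range j).powersetCard 3 :=
      insert_subset hfm ((erase_subset _ _).trans hG1)
    have hcard : (insert f (G.erase e)).card = G.card := by
      rw [card_insert_of_notMem (fun h => hne (mem_of_mem_erase h)), card_erase_of_mem he]
      have := card_pos.mpr ⟨e, he⟩
      omega
    have hfew : FewEdges n (insert f (G.erase e)) := by unfold FewEdges at *; omega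
    have hw : ∏ i ∈ e, y i ≤ ∏ i ∈ f, y i := by
      rw [hf, prod_insert haer, ← mul_prod_erase e y hb]
      exact mul_le_mul_of_nonneg_right (hyanti a b hab.le hbj) (prod_nonneg fun i _ => hy.1 i)
    have hval := lagPoly_swap G e f he hne y
    have hle := hmax _ y hsub hfew hy
    have := hGmin _ (mem_filter.mpr ⟨mem_powerset.mpr hsub, hfew, by linarith⟩)
    rw [sum_insert (fun h => hne (mem_of_mem_erase h)), ← add_sum_erase G _ he, hf,
      sum_insert haer, ← add_sum_erase e _ hb] at this
    omega

lemma exists_sorted3 (e : Finset ℕ) (he : e.card = 3) :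
    ∃ p q r, p < q ∧ q < r ∧ e = {p, q, r} := by
  obtain ⟨a, b, c, hab, hac, hbc, rfl⟩ := card_eq_three.mp he
  rcases lt_or_gt_of_ne hab with h1 | h1 <;> rcases lt_or_gt_of_ne hac with h2 | h2 <;>
    rcases lt_or_gt_of_ne hbc with h3 | h3
  · exact ⟨a, b, c, h1, h3, rfl⟩
  · exact ⟨a, c, b, h2, h3, by ext; simp; tauto⟩
  · omega
  · exact ⟨c, a, b, h2, h1, by ext; simp; tauto⟩
  · exact ⟨b, a, c, h1, h2, by ext; simp; tauto⟩
  · omega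
  · exact ⟨b, c, a, h3, h2, by ext; simp; tauto⟩
  · exact ⟨c, b, a, h3, h1, by ext; simp; tauto⟩

lemma prod3 (x : ℕ → ℝ) (p q r : ℕ) (h1 : p < q) (h2 : q < r) :
    ∏ i ∈ ({p, q, r} : Finset ℕ), x i = x p * x q * x r := by
  rw [prod_insert (by simp; omega), prod_insert (by simp; omega), prod_singleton]
  ring

lemma comp3 (E : Finset (Finset ℕ)) (hE : Compressed E) (p q r a b c : ℕ) (h1 : p < q) (h2 : q < r)
    (h3 : a < b) (h4 : b < c) (ha : p ≤ a) (hb : q ≤ b) (hc : r ≤ c)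
    (h : ({a, b, c} : Finset ℕ) ∈ E) : ({p, q, r} : Finset ℕ) ∈ E := by
  have s1 : ({p, b, c} : Finset ℕ) ∈ E := by
    rcases eq_or_lt_of_le ha with rfl | hlt
    · exact h
    · have := hE _ h p a (by simp) (by simp; omega) hlt
      convert this using 1
      ext i; simp; omega
  have s2 : ({p, q, c} : Finset ℕ) ∈ E := by
    rcases eq_or_lt_of_le hb with rfl | hlt
    · exact s1
    · have := hE _ s1 q b (by simp) (by simp; omega) hlt
      convert this using 1
      ext i; simp; omega
  rcases eq_or_lt_of_le hc with rfl | hlt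
  · exact s2
  · have := hE _ s2 r c (by simp) (by simp; omega) hlt
    convert this using 1
    ext i; simp; omega

lemma prod_ge3 (x : ℕ → ℝ) (k : ℕ) (hx : ∀ i, 0 ≤ x i) (hanti : ∀ a b, a ≤ b → b < k → x b ≤ x a)
    (p q r a b c : ℕ) (h1 : p < q) (h2 : q < r)
    (ha : p ≤ a) (hb : q ≤ b) (hc : r ≤ c) (hak : a < k) (hbk : b < k) (hck : c < k) :
    x a * x b * x c ≤ ∏ i ∈ ({p, q, r} : Finset ℕ), x i := by
  rw [prod3 x p q r h1 h2]
  have := hanti p a ha hak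
  have := hanti q b hb hbk
  have := hanti r c hc hck
  have := hx a
  have := hx b
  have := hx c
  have hp := hx p
  have hq := hx q
  gcongr

lemma topCount (E : Finset (Finset ℕ)) (hE : Compressed E) (k q i : ℕ) (hqk : q ≤ k) (hq : 5 ≤ q)
    (hi : q - 5 ≤ i) (hik : i < k - 2) (h : ({i, k-2, k-1} : Finset ℕ) ∈ E) :
    q.choose 3 ≤ E.card + 4 := by
  have hsub : (range q).powersetCard 3 ⊆ E ∪ (Ico (q-4) q).powersetCard 3 := by
    intro e he
    obtain ⟨h1, h2⟩ := mem_powersetCard.mp he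
    obtain ⟨a, b, c, hab, hbc, rfl⟩ := exists_sorted3 e h2
    have hc : c < q := mem_range.mp (h1 (by simp))
    rcases le_or_gt a (q-5) with hle | hlt
    · refine mem_union_left _ (comp3 E hE a b c i (k-2) (k-1) hab hbc hik (by omega) (by omega)
        (by omega) (by omega) h)
    · refine mem_union_right _ (mem_powersetCard.mpr ⟨?_, h2⟩)
      intro z hz
      simp only [mem_insert, mem_singleton] at hz
      rw [mem_Ico]
      omega
  have := (card_le_card hsub).trans (card_union_le _ _)
  rw [card_powersetCard, card_powersetCard, card_range, Nat.card_Ico] at this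
  have h4 : q - (q-4) = 4 := by omega
  rw [h4] at this
  exact this

lemma deriv_bound (E : Finset (Finset ℕ)) (k : ℕ) (hk : 1 ≤ k) (x : ℕ → ℝ)
    (hE : E ⊆ (range k).powersetCard 3)
    (hx : IsWeighting k x) (h0 : 0 < x 0) (h1 : x 0 < 1)
    (hmax : ∀ y, IsWeighting k y → lagPoly E y ≤ lagPoly E x) :
    6 * lagPoly E x ≤ (1 - x 0)^2 - ∑ i ∈ (range k).erase 0, (x i)^2 := by
  classical
  have hsum : ∑ i ∈ (range k).erase 0, x i = 1 - x 0 := by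
    rw [← hx.2.2, ← add_sum_erase (range k) x (mem_range.mpr hk)]; ring
  set D := ∑ e ∈ E.filter (fun e => 0 ∈ e), ∏ i ∈ e.erase 0, x i with hD
  set R := ∑ e ∈ E.filter (fun e => 0 ∉ e), ∏ i ∈ e, x i with hR
  have hval : ∀ y r : ℝ, lagPoly E (fun i => if i = 0 then y else r * x i) =
      y * r^2 * D + r^3 * R := by
    intro y r
    rw [lagPoly, ← sum_filter_add_sum_filter_not E (fun e => 0 ∈ e), hD, hR, mul_sum, mul_sum]
    congr 1
    · refine sum_congr rfl fun e he => ?_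
      obtain ⟨he, h0e⟩ := mem_filter.mp he
      have hc := (mem_powersetCard.mp (hE he)).2
      rw [← mul_prod_erase e _ h0e, if_pos rfl]
      have : ∏ i ∈ e.erase 0, (if i = 0 then y else r * x i) = ∏ i ∈ e.erase 0, (r * x i) :=
        prod_congr rfl fun i hi => if_neg (ne_of_mem_erase hi)
      rw [this, prod_mul_distrib, prod_const, card_erase_of_mem h0e, hc]
      ring
    · refine sum_congr rfl fun e he => ?_
      obtain ⟨he, h0e⟩ := mem_filter.mp he
      have hc := (mem_powersetCard.mp (hE he)).2
      have : ∏ i ∈ e, (if i = 0 then y else r * x i) = ∏ i ∈ e, (r * x i) :=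
        prod_congr rfl fun i hi => if_neg (fun h : i = 0 => h0e (by rw [← h]; exact hi))
      rw [this, prod_mul_distrib, prod_const, hc]
  have hP : lagPoly E x = x 0 * D + R := by
    have := hval (x 0) 1
    have h2 : (fun i => if i = 0 then x 0 else 1 * x i) = x := by
      funext i; split_ifs with h
      · rw [h]
      · ring
    rw [h2] at this
    rw [this]; ring
  have ha : (0:ℝ) < 1 - x 0 := by linarith
  let f : ℝ → ℝ := fun y => y * ((1-y)/(1-x 0))^2 * D + ((1-y)/(1-x 0))^3 * R
  have hf0 : f (x 0) = lagPoly E x := by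
    simp only [f]; rw [div_self ha.ne', hP]; ring
  have hle : ∀ y, 0 ≤ y → y ≤ 1 → f y ≤ f (x 0) := by
    intro y hy0 hy1
    rw [hf0]
    have := hval y ((1-y)/(1-x 0))
    simp only [f]
    rw [← this]
    apply hmax
    have hr : 0 ≤ (1-y)/(1-x 0) := div_nonneg (by linarith) ha.le
    refine ⟨?_, ?_, ?_⟩
    · intro i; dsimp only; split_ifs
      · exact hy0
      · exact mul_nonneg hr (hx.1 i)
    · intro i hi; dsimp only; rw [if_neg (by omega), hx.2.1 i hi, mul_zero]
    · rw [← add_sum_erase (range k) _ (mem_range.mpr hk), if_pos rfl]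
      have : ∑ i ∈ (range k).erase 0, (if i = 0 then y else (1-y)/(1-x 0) * x i) =
          ∑ i ∈ (range k).erase 0, (1-y)/(1-x 0) * x i :=
        sum_congr rfl fun i hi => if_neg (ne_of_mem_erase hi)
      rw [this, ← mul_sum, hsum, div_mul_cancel₀ _ ha.ne']
      ring
  have hloc : IsLocalMax f (x 0) := by
    filter_upwards [Icc_mem_nhds h0 h1] with y hy
    exact hle y hy.1 hy.2
  have hr : HasDerivAt (fun y : ℝ => (1-y)/(1-x 0)) (-1/(1-x 0)) (x 0) := by
    simpa using ((hasDerivAt_id (x 0)).const_sub 1).div_const (1-x 0)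
  have hder := ((((hasDerivAt_id (x 0)).mul (hr.pow 2)).mul_const D).add ((hr.pow 3).mul_const R))
  have hz := hloc.hasDerivAt_eq_zero hder
  simp only [Pi.pow_apply, div_self ha.ne', id] at hz
  have hz2 : D * (1 - 3 * x 0) = 3 * R := by
    field_simp at hz
    norm_num at hz
    linarith
  have h3P : 3 * lagPoly E x = D := by rw [hP]; linarith
  have hDle : D ≤ ∑ e ∈ ((range k).erase 0).powersetCard 2, ∏ i ∈ e, x i := by
    have hinj : Set.InjOn (fun e : Finset ℕ => e.erase 0) (E.filter (fun e => 0 ∈ e)) := by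
      intro e he e' he' h
      have h1 := (mem_filter.mp he).2
      have h2 := (mem_filter.mp he').2
      rw [← insert_erase h1, ← insert_erase h2]
      exact congrArg (insert 0) h
    rw [hD, ← sum_image (f := fun e => ∏ i ∈ e, x i) hinj]
    refine sum_le_sum_of_subset_of_nonneg ?_ (fun e _ _ => prod_nonneg fun i _ => hx.1 i)
    intro g hg
    obtain ⟨e, he, rfl⟩ := mem_image.mp hg
    obtain ⟨he, h0e⟩ := mem_filter.mp he
    obtain ⟨h1, h2⟩ := mem_powersetCard.mp (hE he)
    exact mem_powersetCard.mpr ⟨erase_subset_erase _ h1, by rw [card_erase_of_mem h0e, h2]⟩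
  rw [e2_eq_s8, hsum] at hDle
  linarith


lemma final1 (n a S Q : ℝ) (hn : 4 ≤ n) (ha : 0 < a) (ha1 : a < 1) (hS : S ≤ (n-3)*a)
    (hS2 : 1 - 2*a < S) (hQ : S^2 ≤ (n-3) * Q) (hQ0 : 0 ≤ Q)
    (h : (n-1)*(n-2)/n^2 ≤ (1-a)^2 - Q) : False := by
  have hn0 : 0 < n := by linarith
  rw [div_le_iff₀ (by positivity)] at h
  have h1 : 1 < (n-1)*a := by nlinarith
  rcases le_or_gt a (1/2) with h2 | h2
  · have h3 : (1-2*a)^2 ≤ (n-3)*Q := by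
      have : (1-2*a)^2 ≤ S^2 := by
        apply pow_le_pow_left₀ <;> linarith
      linarith
    have h4 : (n-3)*((n-1)*(n-2)) ≤ ((n-3)*(1-a)^2 - (1-2*a)^2) * n^2 := by
      nlinarith [mul_le_mul_of_nonneg_left h (show (0:ℝ) ≤ n-3 by linarith),
        mul_le_mul_of_nonneg_right h3 (show (0:ℝ) ≤ n^2 by positivity)]
    -- the bracket is decreasing in a
    have h5 : ((n-3)*(1-a)^2 - (1-2*a)^2) * (n-1)^2 ≤ (n-3)*(n-2)^2 - (n-3)^2 := by
      have e : (n-3)*(n-2)^2 - (n-3)^2 - ((n-3)*(1-a)^2 - (1-2*a)^2) * (n-1)^2 =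
        ((n-1)*a - 1) * ((n-3)*((n-2) + (n-1)*(1-a)) - 2*((n-3)+(n-1)*(1-2*a))) := by ring
      have e2 : 0 ≤ (n-3)*((n-2) + (n-1)*(1-a)) - 2*((n-3)+(n-1)*(1-2*a)) := by
        nlinarith [mul_nonneg (show (0:ℝ) ≤ n-4 by linarith) (show (0:ℝ) ≤ n-4 by linarith), mul_nonneg (show (0:ℝ) ≤ n-4 by linarith) (show (0:ℝ) ≤ 1/2-a by linarith),
          mul_nonneg (mul_nonneg (show (0:ℝ) ≤ n-4 by linarith) (show (0:ℝ) ≤ n-4 by linarith)) (show (0:ℝ) ≤ 1/2-a by linarith)]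
      have := mul_nonneg (show 0 ≤ (n-1)*a - 1 by linarith) e2
      linarith
    have h6 : (n-3)*((n-1)*(n-2))*(n-1)^2 ≤ ((n-3)*(n-2)^2 - (n-3)^2) * n^2 := by
      nlinarith [mul_le_mul_of_nonneg_right h4 (show (0:ℝ) ≤ (n-1)^2 by positivity),
        mul_le_mul_of_nonneg_right h5 (show (0:ℝ) ≤ n^2 by positivity)]
    have h7 : (n-3)*((n-1)*(n-2))*(n-1)^2 - ((n-3)*(n-2)^2 - (n-3)^2) * n^2 = (n-3)*(2*n^2-7*n+2) := by
      ring
    have h8 : 0 < (n-3)*(2*n^2-7*n+2) := mul_pos (by linarith) (by nlinarith)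
    linarith
  · have : (1-a)^2 ≤ 1/4 := by nlinarith
    have : ((1-a)^2 - Q) * n^2 ≤ 1/4 * n^2 := mul_le_mul_of_nonneg_right (by linarith) (by positivity)
    nlinarith

set_option maxHeartbeats 1000000 in
/-- `Q` is the sum of squares over `n` coordinates with sum `1-a`; `τ` bounds the last four. -/
lemma final2 (n a τ Q : ℝ) (hn : 5 ≤ n) (ha : 0 < a) (ha1 : a < 1)
    (hτ : 3*(n-3)*τ = 2*(n-4)) (hsum : 1 ≤ (n-3+4*τ)*a)
    (hQ1 : (1-a)^2 ≤ n * Q) (hQ2 : 2*a*(1-a) - a^2*(n-4+8*τ-4*τ^2) ≤ Q)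
    (h : (n-1)*(n-2)/n^2 ≤ (1-a)^2 - Q) : False := by
  have hn0 : 0 < n := by linarith
  rw [div_le_iff₀ (by positivity)] at h
  rcases le_or_gt 1 ((n-1)*a) with h1 | h1
  · have h2 : (n-1)*(n-2) * n ≤ (1-a)^2*(n-1) * n^2 := by
      nlinarith [mul_le_mul_of_nonneg_left h hn0.le,
        mul_le_mul_of_nonneg_right hQ1 (show (0:ℝ) ≤ n^2 by positivity)]
    have h3 : (n-2) ≤ (1-a)^2*n := by
      have : 0 < (n-1)*n := mul_pos (by linarith) hn0
      by_contra hc; push Not at hc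
      nlinarith
    have h4 : ((1-a)*(n-1))^2 ≤ (n-2)^2 := by
      apply pow_le_pow_left₀
      · exact mul_nonneg (by linarith) (by linarith)
      · linarith
    have h5 : (n-2)*(n-1)^2 ≤ (n-2)^2*n := by
      nlinarith [mul_le_mul_of_nonneg_right h3 (show (0:ℝ) ≤ (n-1)^2 by positivity),
        mul_le_mul_of_nonneg_right h4 hn0.le]
    nlinarith
  · -- convex case
    have hn3 : 0 < n - 3 := by linarith
    obtain ⟨θ, hθ⟩ : ∃ θ, θ = 1 - τ := ⟨_, rfl⟩
    have hτ' : τ = 1 - θ := by linarith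
    subst hτ'
    have hθ1 : 3*(n-3)*θ = n-1 := by linarith
    have hs : 1 ≤ (n+1-4*θ)*a := by linarith
    set s := n+1-4*θ with hsdef
    have h2 : (n-1)*(n-2) ≤ (1-4*a+(n+3-4*θ^2)*a^2) * n^2 := by
      nlinarith [mul_le_mul_of_nonneg_right hQ2 (show (0:ℝ) ≤ n^2 by positivity)]
    have hsn : n - 1 < s := by
      by_contra hc; push Not at hc; nlinarith
    have hn7 : 7 < n := by
      have : θ < 1/2 := by linarith
      nlinarith
    have hθlo : 1/3 ≤ θ := by nlinarith
    have hθhi : θ ≤ 1/2 := by linarith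
    -- end point values
    have hK : 0 ≤ n+3-4*θ^2 := by nlinarith
    have e1 : ((n-1)^2 - 4*(n-1) + (n+3-4*θ^2)) * n^2 < (n-1)*(n-2)*(n-1)^2 := by
      nlinarith [mul_nonneg hn0.le hn0.le]
    have e2 : (s^2 - 4*s + (n+3-4*θ^2)) * n^2 < (n-1)*(n-2)*s^2 := by
      have hA : 3*(n-3)*s = 3*n^2-10*n-5 := by
        rw [hsdef]; linear_combination (-4)*hθ1
      have hpos : 0 < 9*(n-3)^2 := by positivity
      have key : (9*(n-3)^2)*((n-1)*(n-2)*s^2 - (s^2 - 4*s + (n+3-4*θ^2)) * n^2) =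
          (n-1)*(n-2)*(3*n^2-10*n-5)^2 - ((3*n^2-10*n-5)^2 - 12*(n-3)*(3*n^2-10*n-5)
            + 9*(n-3)^2*(n+3) - 4*(n-1)^2)*n^2 := by
        rw [← hA, ← hθ1]; ring
      have hR : 0 < (n-1)*(n-2)*(3*n^2-10*n-5)^2 - ((3*n^2-10*n-5)^2 - 12*(n-3)*(3*n^2-10*n-5)
            + 9*(n-3)^2*(n+3) - 4*(n-1)^2)*n^2 := by
        obtain ⟨m, hm⟩ : ∃ m, m = n - 7 := ⟨_, rfl⟩
        have hm0 : 0 < m := by linarith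
        have : n = m + 7 := by linarith
        subst this
        ring_nf
        positivity
      rw [← key] at hR
      have := pos_of_mul_pos_right hR hpos.le
      linarith
    obtain ⟨β, hβ⟩ : ∃ β, β = 1 / a := ⟨_, rfl⟩
    have hβa : β * a = 1 := by rw [hβ]; field_simp
    have hβ0 : 0 < β := by rw [hβ]; positivity
    have hb1 : n - 1 < β :=
      lt_of_mul_lt_mul_right (by rw [hβa]; exact h1) ha.le
    have hb2 : β ≤ s :=
      le_of_mul_le_mul_right (by rw [hβa]; exact hs) ha
    have h3 : (n-1)*(n-2)*β^2 ≤ (β^2-4*β+(n+3-4*θ^2)) * n^2 := by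
      have := mul_le_mul_of_nonneg_right h2 (sq_nonneg β)
      have e : (1-4*a+(n+3-4*θ^2)*a^2) * n^2 * β^2 = (β^2-4*β*(β*a)+(n+3-4*θ^2)*(β*a)^2) * n^2 := by ring
      rw [e, hβa] at this
      linarith
    have hid : (s-(n-1)) * ((β^2-4*β+(n+3-4*θ^2)) * n^2 - (n-1)*(n-2)*β^2) =
      (s-β) * (((n-1)^2 - 4*(n-1) + (n+3-4*θ^2)) * n^2 - (n-1)*(n-2)*(n-1)^2) +
      (β-(n-1)) * ((s^2 - 4*s + (n+3-4*θ^2)) * n^2 - (n-1)*(n-2)*s^2) -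
      (3*n-2)*((s-β)*(β-(n-1))*(s-(n-1))) := by ring
    have t1 : (s-β) * (((n-1)^2 - 4*(n-1) + (n+3-4*θ^2)) * n^2 - (n-1)*(n-2)*(n-1)^2) ≤ 0 :=
      mul_nonpos_of_nonneg_of_nonpos (by linarith) (by linarith)
    have t2 : (β-(n-1)) * ((s^2 - 4*s + (n+3-4*θ^2)) * n^2 - (n-1)*(n-2)*s^2) < 0 :=
      mul_neg_of_pos_of_neg (by linarith) (by linarith)
    have t3 : 0 ≤ (3*n-2)*((s-β)*(β-(n-1))*(s-(n-1))) :=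
      mul_nonneg (by linarith) (mul_nonneg (mul_nonneg (by linarith) (by linarith)) (by linarith))
    have t4 : 0 ≤ (s-(n-1)) * ((β^2-4*β+(n+3-4*θ^2)) * n^2 - (n-1)*(n-2)*β^2) :=
      mul_nonneg (by linarith) (by linarith)
    linarith

/-- Merge vertex `l+1` into vertex `l`. -/
noncomputable def mg (x : ℕ → ℝ) (l : ℕ) : ℕ → ℝ :=
  fun i => if i = l then x l + x (l+1) else if i = l+1 then 0 else x i

lemma mg_ge (x : ℕ → ℝ) (hx : ∀ i, 0 ≤ x i) (l i : ℕ) (hi : i ≠ l + 1) : x i ≤ mg x l i := by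
  unfold mg
  split_ifs with h
  · subst h; linarith [hx (i+1)]
  · exact le_rfl

lemma mg_lt (x : ℕ → ℝ) (l i : ℕ) (hi : i < l) : mg x l i = x i := by
  unfold mg
  rw [if_neg (by omega), if_neg (by omega)]

lemma mg_self (x : ℕ → ℝ) (l : ℕ) : mg x l l = x l + x (l+1) := by
  unfold mg
  rw [if_pos rfl]

lemma mg_weighting (x : ℕ → ℝ) (l : ℕ) (hx : IsWeighting (l+2) x) : IsWeighting (l+1) (mg x l) := by
  refine ⟨?_, ?_, ?_⟩
  · intro i
    unfold mg
    split_ifs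
    · linarith [hx.1 l, hx.1 (l+1)]
    · exact le_rfl
    · exact hx.1 i
  · intro i hi
    unfold mg
    rw [if_neg (by omega)]
    split_ifs with h
    · rfl
    · exact hx.2.1 i (by omega)
  · rw [← hx.2.2, sum_range_succ, sum_range_succ, sum_range_succ, mg_self,
      sum_congr rfl (fun i hi => mg_lt x l i (mem_range.mp hi))]
    ring

lemma prod_mg (x : ℕ → ℝ) (l : ℕ) (e : Finset ℕ) (he : l + 1 ∉ e) :
    ∏ i ∈ e, mg x l i = ∏ i ∈ e, x i + if l ∈ e then x (l+1) * ∏ i ∈ e.erase l, x i else 0 := by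
  have key : ∀ f : Finset ℕ, l ∉ f → l + 1 ∉ f → ∏ i ∈ f, mg x l i = ∏ i ∈ f, x i := by
    intro f h1 h2
    refine prod_congr rfl fun i hi => ?_
    unfold mg
    rw [if_neg (fun h => h1 (by rw [← h]; exact hi)), if_neg (fun h => h2 (by rw [← h]; exact hi))]
  split_ifs with h
  · rw [← mul_prod_erase e _ h, ← mul_prod_erase e x h, mg_self,
      key _ (notMem_erase _ _) (fun h => he (mem_of_mem_erase h))]
    ring
  · rw [key e h he, add_zero]

lemma erase_range (k : ℕ) : (range k).erase 0 = Ico 1 k := by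
  ext i; simp; omega

lemma triple_uv (l : ℕ) (e : Finset ℕ) (he : e ∈ (range (l+2)).powersetCard 3) (h1 : l ∈ e)
    (h2 : l + 1 ∈ e) : ∃ i, i < l ∧ e = {i, l, l+1} := by
  obtain ⟨hr, hc⟩ := mem_powersetCard.mp he
  obtain ⟨p, q, r, hpq, hqr, rfl⟩ := exists_sorted3 e hc
  have hr' : r < l + 2 := mem_range.mp (hr (by simp))
  simp only [mem_insert, mem_singleton] at h1 h2
  have e1 : r = l + 1 := by omega
  have e2 : q = l := by omega
  subst e1; subst e2
  exact ⟨p, hpq, rfl⟩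

lemma card_bound (n : ℕ) (hn : 4 ≤ n) :
    (n+1).choose 3 = n.choose 3 + (n-1) + (n-1).choose 2 ∧
    (n+2).choose 3 = n.choose 3 + n + 2 * (n-1) + 2 * (n-1).choose 2 := by
  obtain ⟨m, rfl⟩ : ∃ m, n = m + 1 := ⟨n-1, by omega⟩
  have h0 : m.choose 1 = m := Nat.choose_one_right m
  have h1 : m.choose 0 = 1 := Nat.choose_zero_right m
  have h2 := Nat.choose_succ_succ' m 2
  have h3 := Nat.choose_succ_succ' m 1
  have h4 := Nat.choose_succ_succ' (m+1) 2
  have h5 := Nat.choose_succ_succ' (m+1) 1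
  have h6 := Nat.choose_succ_succ' (m+1+1) 2
  have h7 : (m+1).choose 1 = m + 1 := Nat.choose_one_right _
  simp only [Nat.add_sub_cancel, Nat.reduceAdd, add_assoc] at *
  constructor <;> omega

lemma case1 (n l : ℕ) (hn : 4 ≤ n) (hk : n ≤ l) (E : Finset (Finset ℕ)) (x : ℕ → ℝ)
    (hE : E ⊆ (range (l+2)).powersetCard 3) (hfew : FewEdges n E) (hx : IsWeighting (l+2) x)
    (hpos : ∀ i < l+2, 0 < x i) (hlam : lamK n ≤ lagPoly E x)
    (hanti : ∀ a b, a ≤ b → b < l+2 → x b ≤ x a)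
    (hmax : ∀ y, IsWeighting (l+2) y → lagPoly E y ≤ lagPoly E x) (hcomp : Compressed E)
    (hnb : ¬ Bad n (l+1)) : False := by
  classical
  have hcb := card_bound n hn
  unfold FewEdges at hfew
  -- triples containing the last two vertices
  have hT : ∀ i, i < l → ({i, l, l+1} : Finset ℕ) ∈ E → i < n - 3 := by
    intro i hi h
    by_contra hc
    have := topCount E hcomp (l+2) (n+2) i (by omega) (by omega) (by omega) (by omega) (by simpa using h)
    omega
  set T := (range (n-3)).filter (fun i => ({i, l, l+1} : Finset ℕ) ∈ E) with hTdef
  set Ev := E.filter (fun e => l+1 ∈ e) with hEv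
  set En := E.filter (fun e => ¬ (l+1 ∈ e)) with hEn
  have hcardE : Ev.card + En.card = E.card := card_filter_add_card_filter_not _
  -- the number of missing triples
  have hM : Ev.card ≤ ((range (n+1)).powersetCard 3 \ E).card := by
    have h1 : ((range (n+1)).powersetCard 3).card ≤
        ((range (n+1)).powersetCard 3 \ E).card + En.card := by
      refine (card_le_card ?_).trans (card_union_le _ _)
      intro e he
      by_cases h : e ∈ E
      · refine mem_union_right _ (mem_filter.mpr ⟨h, fun h' => ?_⟩)
        have := mem_range.mp ((mem_powersetCard.mp he).1 h')
        omega
      · exact mem_union_left _ (mem_sdiff.mpr ⟨he, h⟩)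
    rw [card_powersetCard, card_range] at h1
    omega
  obtain ⟨A, hAM, hAc⟩ := exists_subset_card_eq hM
  have hAE : Disjoint En A := by
    rw [disjoint_left]
    intro e he he'
    exact (mem_sdiff.mp (hAM he')).2 (mem_filter.mp he).1
  have hAr : ∀ e ∈ A, e ∈ (range (n+1)).powersetCard 3 := fun e he => (mem_sdiff.mp (hAM he)).1
  -- value after merging
  have hlt : lagPoly (En ∪ A) (mg x l) < lamK n := by
    by_contra hc
    push Not at hc
    refine hnb ⟨En ∪ A, mg x l, ?_, ?_, mg_weighting x l hx, ?_, hc⟩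
    · refine union_subset ?_ ?_
      · intro e he
        obtain ⟨he1, he2⟩ := mem_filter.mp he
        obtain ⟨h1, h2⟩ := mem_powersetCard.mp (hE he1)
        refine mem_powersetCard.mpr ⟨fun i hi => ?_, h2⟩
        have := mem_range.mp (h1 hi)
        rw [mem_range]
        have : i ≠ l + 1 := fun h => he2 (by rw [← h]; exact hi)
        omega
      · intro e he
        exact powersetCard_mono (range_mono (by omega)) (hAr e he)
    · have := card_union_of_disjoint hAE
      unfold FewEdges; omega
    · intro i hi
      exact lt_of_lt_of_le (hpos i (by omega)) (mg_ge x hx.1 l i (by omega))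
  have hvalA : (Ev.card : ℝ) * (x (n-2) * x (n-1) * x n) ≤ ∑ e ∈ A, ∏ i ∈ e, mg x l i := by
    rw [← hAc, ← nsmul_eq_mul]
    refine card_nsmul_le_sum _ _ _ fun e he => ?_
    obtain ⟨h1, h2⟩ := mem_powersetCard.mp (hAr e he)
    have h3 : ∏ i ∈ e, x i ≤ ∏ i ∈ e, mg x l i := by
      refine prod_le_prod (fun i _ => hx.1 i) (fun i hi => mg_ge x hx.1 l i ?_)
      have := mem_range.mp (h1 hi)
      omega
    refine le_trans ?_ h3
    obtain ⟨p, q, r, hpq, hqr, rfl⟩ := exists_sorted3 e h2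
    have hr' : r < n + 1 := mem_range.mp (h1 (by simp))
    exact prod_ge3 x (l+2) hx.1 hanti p q r _ _ _ hpq hqr (by omega) (by omega) (by omega)
      (by omega) (by omega) (by omega)
  -- edges containing l+1 but not l are absorbed
  set Ev0 := Ev.filter (fun e => ¬ (l ∈ e)) with hEv0
  set Ev1 := Ev.filter (fun e => l ∈ e) with hEv1
  have habs : ∑ e ∈ Ev0, ∏ i ∈ e, x i ≤
      ∑ e ∈ En, if l ∈ e then x (l+1) * ∏ i ∈ e.erase l, x i else 0 := by
    rw [← sum_filter]
    have hmem : ∀ e ∈ Ev0, e ∈ E ∧ l + 1 ∈ e ∧ l ∉ e := by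
      intro e he
      obtain ⟨h1, h2⟩ := mem_filter.mp he
      obtain ⟨h3, h4⟩ := mem_filter.mp h1
      exact ⟨h3, h4, h2⟩
    let φ : Finset ℕ → Finset ℕ := fun e => insert l (e.erase (l+1))
    have hlφ : ∀ e ∈ Ev0, l ∉ e.erase (l+1) := fun e he h => (hmem e he).2.2 (mem_of_mem_erase h)
    have hinj : Set.InjOn φ Ev0 := by
      intro e he f hf hef
      have h1 : e.erase (l+1) = f.erase (l+1) := by
        rw [← erase_insert (hlφ e he), ← erase_insert (hlφ f hf)]
        exact congrArg (fun z => z.erase l) hef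
      rw [← insert_erase (hmem e he).2.1, ← insert_erase (hmem f hf).2.1, h1]
    have h2 : ∑ e ∈ Ev0, ∏ i ∈ e, x i = ∑ e ∈ Ev0.image φ, x (l+1) * ∏ i ∈ e.erase l, x i := by
      rw [sum_image hinj]
      refine sum_congr rfl fun e he => ?_
      simp only [φ]
      rw [erase_insert (hlφ e he), mul_prod_erase e x (hmem e he).2.1]
    rw [h2]
    refine sum_le_sum_of_subset_of_nonneg ?_ (fun e _ _ =>
      mul_nonneg (hx.1 _) (prod_nonneg fun i _ => hx.1 i))
    intro g hg
    obtain ⟨e, he, rfl⟩ := mem_image.mp hg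
    obtain ⟨h3, h4, h5⟩ := hmem e he
    refine mem_filter.mpr ⟨mem_filter.mpr ⟨hcomp e h3 l (l+1) h4 h5 (by omega), ?_⟩, ?_⟩
    · simp [φ]
    · simp [φ]
  have hb : ∑ e ∈ Ev1, ∏ i ∈ e, x i ≤ (T.card : ℝ) * (x 0 * x l * x (l+1)) := by
    have hsub : Ev1 ⊆ T.image (fun i => ({i, l, l+1} : Finset ℕ)) := by
      intro e he
      obtain ⟨h1, h2⟩ := mem_filter.mp he
      obtain ⟨h3, h4⟩ := mem_filter.mp h1
      obtain ⟨i, hi, rfl⟩ := triple_uv l e (hE h3) h2 h4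
      exact mem_image.mpr ⟨i, mem_filter.mpr ⟨mem_range.mpr (hT i hi h3), h3⟩, rfl⟩
    have h1 : Ev1.card ≤ T.card := (card_le_card hsub).trans card_image_le
    have h2 : ∑ e ∈ Ev1, ∏ i ∈ e, x i ≤ (Ev1.card : ℝ) * (x 0 * x l * x (l+1)) := by
      rw [← nsmul_eq_mul]
      refine sum_le_card_nsmul _ _ _ fun e he => ?_
      obtain ⟨i, hi, rfl⟩ := mem_image.mp (hsub he)
      have hi' := mem_range.mp (mem_filter.mp hi).1
      rw [prod3 x i l (l+1) (by omega) (by omega)]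
      have := hanti 0 i (by omega) (by omega)
      have := hx.1 l
      have := hx.1 (l+1)
      gcongr
    refine h2.trans ?_
    have := mul_nonneg (mul_nonneg (hx.1 0) (hx.1 l)) (hx.1 (l+1))
    have h1' : (Ev1.card : ℝ) ≤ T.card := by exact_mod_cast h1
    gcongr
  have hsplit : lagPoly E x = ∑ e ∈ En, ∏ i ∈ e, x i + ∑ e ∈ Ev0, ∏ i ∈ e, x i +
      ∑ e ∈ Ev1, ∏ i ∈ e, x i := by
    rw [lagPoly, ← sum_filter_add_sum_filter_not E (fun e => l+1 ∈ e),
      ← sum_filter_add_sum_filter_not (E.filter (fun e => l+1 ∈ e)) (fun e => l ∈ e)]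
    ring
  have hnew : lagPoly (En ∪ A) (mg x l) = ∑ e ∈ En, ∏ i ∈ e, x i +
      (∑ e ∈ En, if l ∈ e then x (l+1) * ∏ i ∈ e.erase l, x i else 0) +
      ∑ e ∈ A, ∏ i ∈ e, mg x l i := by
    rw [lagPoly, sum_union hAE, ← sum_add_distrib]
    congr 1
    exact sum_congr rfl fun e he => prod_mg x l e (mem_filter.mp he).2
  have hmain : (Ev.card : ℝ) * (x (n-2) * x (n-1) * x n) < (T.card : ℝ) * (x 0 * x l * x (l+1)) := by
    linarith
  -- the degree of the last vertex
  have hdeg : T.card * (l + 4 - n) ≤ Ev.card := by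
    have : (T ×ˢ (Ico (n-3) (l+1))).card ≤ Ev.card := by
      refine card_le_card_of_injOn (fun p => {p.1, p.2, l+1}) ?_ ?_
      · rintro ⟨i, j⟩ hp
        obtain ⟨hi, hj⟩ := mem_product.mp hp
        obtain ⟨hi1, hi2⟩ := mem_filter.mp hi
        have hi3 := mem_range.mp hi1
        have hj' := mem_Ico.mp hj
        dsimp only at hi3 hj' hi2
        refine mem_filter.mpr ⟨?_, by simp⟩
        exact comp3 E hcomp i j (l+1) i l (l+1) (by omega) (by omega) (by omega) (by omega)
          le_rfl (by omega) le_rfl hi2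
      · rintro ⟨i, j⟩ hp ⟨i', j'⟩ hp' heq
        obtain ⟨hi, hj⟩ := mem_product.mp hp
        obtain ⟨hi', hj'⟩ := mem_product.mp hp'
        have a1 := mem_range.mp (mem_filter.mp hi).1
        have a2 := mem_range.mp (mem_filter.mp hi').1
        have a3 := mem_Ico.mp hj
        have a4 := mem_Ico.mp hj'
        dsimp only at a1 a2 a3 a4 heq
        have b1 : i ∈ ({i', j', l+1} : Finset ℕ) := by rw [← heq]; simp
        have b2 : j ∈ ({i', j', l+1} : Finset ℕ) := by rw [← heq]; simp
        simp only [mem_insert, mem_singleton] at b1 b2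
        ext <;> simp <;> omega
    rw [card_product, Nat.card_Ico] at this
    have e : l + 1 - (n-3) = l + 4 - n := by omega
    rwa [e] at this
  have hTpos : 0 < T.card := by
    rcases Nat.eq_zero_or_pos T.card with h | h
    · rw [h] at hmain
      have : 0 ≤ (Ev.card : ℝ) * (x (n-2) * x (n-1) * x n) :=
        mul_nonneg (Nat.cast_nonneg _) (mul_nonneg (mul_nonneg (hx.1 _) (hx.1 _)) (hx.1 _))
      simp at hmain
      linarith
    · exact h
  -- weights beyond n-2 are small
  have hsmall : ((l + 4 - n : ℕ) : ℝ) * x (n-2) < x 0 := by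
    have hT' : (0:ℝ) < T.card := by exact_mod_cast hTpos
    have hd' : (T.card : ℝ) * ((l+4-n : ℕ) : ℝ) ≤ Ev.card := by exact_mod_cast hdeg
    have p1 := hpos l (by omega)
    have p2 := hpos (l+1) (by omega)
    have p3 := hpos (n-2) (by omega)
    have q1 := hanti (n-1) l (by omega) (by omega)
    have q2 := hanti n (l+1) (by omega) (by omega)
    have q3 : x l * x (l+1) ≤ x (n-1) * x n := mul_le_mul q1 q2 p2.le (hx.1 _)
    have q4 : (T.card : ℝ) * ((l+4-n : ℕ) : ℝ) * x (n-2) * (x l * x (l+1)) ≤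
        (Ev.card : ℝ) * x (n-2) * (x (n-1) * x n) := by
      gcongr
    have q5 : (x l * x (l+1) * T.card) * (((l+4-n : ℕ) : ℝ) * x (n-2)) <
        (x l * x (l+1) * T.card) * x 0 := by nlinarith
    exact lt_of_mul_lt_mul_left q5 (by positivity)
  have x0pos := hpos 0 (by omega)
  have hsum1 : x 0 + ∑ i ∈ Ico 1 (l+2), x i = 1 := by
    rw [← hx.2.2, ← erase_range, add_sum_erase _ _ (mem_range.mpr (by omega))]
  have hsum2 : ∑ i ∈ Ico 1 (n-2), x i + ∑ i ∈ Ico (n-2) (l+2), x i = ∑ i ∈ Ico 1 (l+2), x i :=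
    sum_Ico_consecutive _ (by omega) (by omega)
  have hrho : ∑ i ∈ Ico (n-2) (l+2), x i < x 0 := by
    refine lt_of_le_of_lt ?_ hsmall
    have := sum_le_card_nsmul (Ico (n-2) (l+2)) x (x (n-2)) (fun i hi => by
      have := mem_Ico.mp hi
      exact hanti _ _ this.1 this.2)
    rw [Nat.card_Ico, nsmul_eq_mul] at this
    have e : l + 2 - (n-2) = l + 4 - n := by omega
    rwa [e] at this
  have x1 : x 0 < 1 := by
    have : x 1 ≤ ∑ i ∈ Ico 1 (l+2), x i :=
      single_le_sum (fun i _ => hx.1 i) (mem_Ico.mpr ⟨le_rfl, by omega⟩)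
    linarith [hpos 1 (by omega)]
  have hder := deriv_bound E (l+2) (by omega) x hE hx x0pos x1 hmax
  rw [erase_range] at hder
  have hQ : ∑ i ∈ Ico 1 (n-2), (x i)^2 ≤ ∑ i ∈ Ico 1 (l+2), (x i)^2 :=
    sum_le_sum_of_subset_of_nonneg (Ico_subset_Ico le_rfl (by omega)) (fun i _ _ => sq_nonneg _)
  have hnc : (((Ico 1 (n-2)).card : ℕ) : ℝ) = (n:ℝ) - 3 := by
    rw [Nat.card_Ico, show n - 2 - 1 = n - 3 by omega, Nat.cast_sub (by omega)]; norm_num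
  refine final1 n (x 0) (∑ i ∈ Ico 1 (n-2), x i) (∑ i ∈ Ico 1 (n-2), (x i)^2)
    (by exact_mod_cast hn) x0pos x1 ?_ (by linarith) ?_ (sum_nonneg fun i _ => sq_nonneg _) ?_
  · rw [← hnc, ← nsmul_eq_mul]
    refine sum_le_card_nsmul _ _ _ fun i hi => ?_
    have := mem_Ico.mp hi
    exact hanti 0 i (by omega) (by omega)
  · rw [← hnc]
    exact sq_sum_le_card_mul_sum_sq
  · have : ((n:ℝ)-1)*(n-2)/n^2 = 6 * lamK n := by
      unfold lamK; have : (n:ℝ) ≠ 0 := by positivity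
      field_simp
    rw [this]
    linarith

set_option maxHeartbeats 1000000 in
lemma case2 (l : ℕ) (hn : 3 ≤ l) (E : Finset (Finset ℕ)) (x : ℕ → ℝ)
    (hE : E ⊆ (range (l+2)).powersetCard 3) (hfew : FewEdges (l+1) E) (hx : IsWeighting (l+2) x)
    (hpos : ∀ i < l+2, 0 < x i) (hlam : lamK (l+1) ≤ lagPoly E x)
    (hanti : ∀ a b, a ≤ b → b < l+2 → x b ≤ x a)
    (hmax : ∀ y, IsWeighting (l+2) y → lagPoly E y ≤ lagPoly E x) (hcomp : Compressed E) :
    False := by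
  classical
  have hcb := (card_bound (l+1) (by omega)).1
  unfold FewEdges at hfew
  simp only [Nat.add_sub_cancel] at hfew hcb
  have hT : ∀ i, i < l → ({i, l, l+1} : Finset ℕ) ∈ E → i < l - 3 := by
    intro i hi h
    by_contra hc
    have := topCount E hcomp (l+2) (l+2) i (by omega) (by omega) (by omega) (by omega) (by simpa using h)
    have e : l + 1 + 1 = l + 2 := rfl
    rw [e] at hcb
    omega
  set T := (range l).filter (fun i => ({i, l, l+1} : Finset ℕ) ∈ E) with hTdef
  set T' := (range l).filter (fun i => ¬ ({i, l, l+1} : Finset ℕ) ∈ E) with hTdef'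
  have hTT : T.card + T'.card = l := by
    have := card_filter_add_card_filter_not (s := range l) (fun i => ({i, l, l+1} : Finset ℕ) ∈ E)
    rwa [card_range] at this
  have hTc : T.card ≤ l - 3 := by
    have : T ⊆ range (l-3) := by
      intro i hi
      obtain ⟨h1, h2⟩ := mem_filter.mp hi
      exact mem_range.mpr (hT i (mem_range.mp h1) h2)
    simpa using card_le_card this
  set P := (range (l+2)).powersetCard 3 with hP
  set M0 := (P \ E).filter (fun e => ¬ (l ∈ e ∧ l + 1 ∈ e)) with hM0
  set M1 := (P \ E).filter (fun e => (l ∈ e ∧ l + 1 ∈ e)) with hM1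
  have hM1eq : M1 = T'.image (fun i => ({i, l, l+1} : Finset ℕ)) := by
    ext e
    constructor
    · intro he
      obtain ⟨h1, h2, h3⟩ := mem_filter.mp he
      obtain ⟨h4, h5⟩ := mem_sdiff.mp h1
      obtain ⟨i, hi, rfl⟩ := triple_uv l e h4 h2 h3
      exact mem_image.mpr ⟨i, mem_filter.mpr ⟨mem_range.mpr hi, h5⟩, rfl⟩
    · intro he
      obtain ⟨i, hi, rfl⟩ := mem_image.mp he
      obtain ⟨h1, h2⟩ := mem_filter.mp hi
      have h1 := mem_range.mp h1
      refine mem_filter.mpr ⟨mem_sdiff.mpr ⟨mem_powersetCard.mpr ⟨?_, ?_⟩, h2⟩, by simp⟩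
      · intro j hj
        simp only [mem_insert, mem_singleton] at hj
        rw [mem_range]; omega
      · exact card_eq_three.mpr ⟨i, l, l+1, by omega, by omega, by omega, rfl⟩
  have hinj : Set.InjOn (fun i => ({i, l, l+1} : Finset ℕ)) T' := by
    intro i hi j hj hij
    have a1 := mem_range.mp (mem_filter.mp hi).1
    have b1 : i ∈ ({j, l, l+1} : Finset ℕ) := by
      have : i ∈ ({i, l, l+1} : Finset ℕ) := by simp
      dsimp only at hij
      rwa [hij] at this
    simp only [mem_insert, mem_singleton] at b1
    omega
  have hM1c : M1.card = T'.card := by rw [hM1eq, card_image_of_injOn hinj]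
  have hM1s : ∑ e ∈ M1, ∏ i ∈ e, x i = (∑ i ∈ T', x i) * (x l * x (l+1)) := by
    rw [hM1eq, sum_image hinj, sum_mul]
    refine sum_congr rfl fun i hi => ?_
    have a1 := mem_range.mp (mem_filter.mp hi).1
    rw [prod3 x i l (l+1) (by omega) (by omega)]
    ring
  have hPE : (P \ E).card + E.card = P.card := card_sdiff_add_card_eq_card hE
  have hMM : M1.card + M0.card = (P \ E).card := card_filter_add_card_filter_not _
  have hPc : P.card = (l+1+1).choose 3 := by rw [hP, card_powersetCard, card_range]
  have hM0c : 2 * T.card + l ≤ 2 * M0.card := by omega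
  have hM0s : (M0.card : ℝ) * (x (l-2) * x (l-1) * x (l+1)) ≤ ∑ e ∈ M0, ∏ i ∈ e, x i := by
    rw [← nsmul_eq_mul]
    refine card_nsmul_le_sum _ _ _ fun e he => ?_
    obtain ⟨h1, h2⟩ := mem_filter.mp he
    obtain ⟨h3, h4⟩ := mem_powersetCard.mp (mem_sdiff.mp h1).1
    obtain ⟨p, q, r, hpq, hqr, rfl⟩ := exists_sorted3 e h4
    have hr' : r < l + 2 := mem_range.mp (h3 (by simp))
    simp only [mem_insert, mem_singleton] at h2
    have : q ≤ l - 1 := by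
      by_contra hc
      apply h2
      constructor <;> omega
    exact prod_ge3 x (l+2) hx.1 hanti p q r _ _ _ hpq hqr (by omega) (by omega) (by omega)
      (by omega) (by omega) (by omega)
  have hsplit : lagPoly P x = lagPoly E x + ∑ e ∈ M1, ∏ i ∈ e, x i + ∑ e ∈ M0, ∏ i ∈ e, x i := by
    rw [lagPoly, ← sum_sdiff hE, hM1, hM0, lagPoly, add_assoc,
      sum_filter_add_sum_filter_not (P \ E) (fun e => l ∈ e ∧ l+1 ∈ e)]
    ring
  have hmg : lagPoly P x = lagPoly ((range (l+1)).powersetCard 3) (mg x l) +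
      (x l * x (l+1)) * ∑ i ∈ range l, x i := by
    have c1 : ∑ i ∈ range l, mg x l i = ∑ i ∈ range l, x i :=
      sum_congr rfl (fun i hi => mg_lt x l i (mem_range.mp hi))
    have c2 : ∑ i ∈ range l, (mg x l i)^2 = ∑ i ∈ range l, (x i)^2 :=
      sum_congr rfl (fun i hi => by rw [mg_lt x l i (mem_range.mp hi)])
    have c3 : ∑ i ∈ range l, (mg x l i)^3 = ∑ i ∈ range l, (x i)^3 :=
      sum_congr rfl (fun i hi => by rw [mg_lt x l i (mem_range.mp hi)])
    rw [hP, lagPoly, lagPoly, e3_eq_s8, e3_eq_s8]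
    simp only [sum_range_succ, mg_self, c1, c2, c3]
    ring
  have hle := e3_le_lam (l+1) (by omega) _ (mg_weighting x l hx)
  have hTs : ∑ i ∈ T, x i + ∑ i ∈ T', x i = ∑ i ∈ range l, x i :=
    sum_filter_add_sum_filter_not _ _ _
  have hTle : ∑ i ∈ T, x i ≤ (T.card : ℝ) * x 0 := by
    rw [← nsmul_eq_mul]
    refine sum_le_card_nsmul _ _ _ fun i hi => ?_
    have a1 := mem_range.mp (mem_filter.mp hi).1
    exact hanti 0 i (by omega) (by omega)
  have p0 := hpos 0 (by omega)
  have p1 := hpos l (by omega)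
  have p2 := hpos (l+1) (by omega)
  have p3 := hpos (l-2) (by omega)
  have p4 := hpos (l-1) (by omega)
  have q1 := hanti (l-1) l (by omega) (by omega)
  have hfin : (M0.card : ℝ) * x (l-2) ≤ (T.card : ℝ) * x 0 := by
    have h1 : (M0.card : ℝ) * (x (l-2) * x (l-1) * x (l+1)) ≤ (x l * x (l+1)) * ∑ i ∈ T, x i := by
      rw [hM1s] at hsplit
      have : (x l * x (l+1)) * ∑ i ∈ range l, x i = (x l * x (l+1)) * ∑ i ∈ T, x i +
        (∑ i ∈ T', x i) * (x l * x (l+1)) := by rw [← hTs]; ring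
      linarith
    have h2 : (M0.card : ℝ) * (x (l-2) * x l * x (l+1)) ≤
        (M0.card : ℝ) * (x (l-2) * x (l-1) * x (l+1)) := by gcongr
    have h3 : (x l * x (l+1)) * ∑ i ∈ T, x i ≤ (x l * x (l+1)) * ((T.card : ℝ) * x 0) := by gcongr
    have h4 : (x l * x (l+1)) * ((M0.card : ℝ) * x (l-2)) ≤
        (x l * x (l+1)) * ((T.card : ℝ) * x 0) := by linarith
    exact le_of_mul_le_mul_left h4 (by positivity)
  have hx02 : x (l-2) ≤ x 0 := hanti 0 (l-2) (by omega) (by omega)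
  have hlr : (3:ℝ) ≤ l := by exact_mod_cast hn
  have hTr : (T.card : ℝ) ≤ (l:ℝ) - 3 := by
    have : ((l - 3 : ℕ) : ℝ) = (l:ℝ) - 3 := by rw [Nat.cast_sub hn]; norm_num
    rw [← this]; exact_mod_cast hTc
  have hM0r : 2 * (T.card : ℝ) + l ≤ 2 * (M0.card : ℝ) := by exact_mod_cast hM0c
  have hkey : 3 * ((l:ℝ) - 2) * x (l-2) ≤ 2 * ((l:ℝ) - 3) * x 0 := by
    have h1 : (2 * (T.card : ℝ) + l) * x (l-2) ≤ 2 * (M0.card : ℝ) * x (l-2) := by gcongr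
    have h2 : (T.card : ℝ) * (x 0 - x (l-2)) ≤ ((l:ℝ) - 3) * (x 0 - x (l-2)) :=
      mul_le_mul_of_nonneg_right hTr (by linarith)
    nlinarith
  have hl4 : 4 ≤ l := by
    by_contra hc
    have : l = 3 := by omega
    subst this
    norm_num at hkey p3
    linarith
  have hl4r : (4:ℝ) ≤ l := by exact_mod_cast hl4
  set τ : ℝ := 2 * ((l:ℝ) - 3) / (3 * ((l:ℝ) - 2)) with hτ
  have hτeq : 3 * ((l:ℝ) - 2) * τ = 2 * ((l:ℝ) - 3) := by
    rw [hτ]; field_simp [show (l:ℝ) - 2 ≠ 0 by linarith]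
  have hτ0 : 0 < τ := by rw [hτ]; apply div_pos <;> linarith
  have hτ1 : τ < 1 := by rw [hτ, div_lt_one (by linarith)]; linarith
  have hb : x (l-2) ≤ τ * x 0 := by
    have h1 : (3 * ((l:ℝ) - 2)) * x (l-2) ≤ (3 * ((l:ℝ) - 2)) * (τ * x 0) := by
      rw [← mul_assoc (3 * ((l:ℝ) - 2)) τ, hτeq]; exact hkey
    exact le_of_mul_le_mul_left h1 (by linarith)
  have hsum1 : x 0 + ∑ i ∈ Ico 1 (l+2), x i = 1 := by
    rw [← hx.2.2, ← erase_range, add_sum_erase _ _ (mem_range.mpr (by omega))]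
  have hsum2 : ∑ i ∈ Ico 1 (l-2), x i + ∑ i ∈ Ico (l-2) (l+2), x i = ∑ i ∈ Ico 1 (l+2), x i :=
    sum_Ico_consecutive _ (by omega) (by omega)
  have hsq2 : ∑ i ∈ Ico 1 (l-2), (x i)^2 + ∑ i ∈ Ico (l-2) (l+2), (x i)^2 =
      ∑ i ∈ Ico 1 (l+2), (x i)^2 :=
    sum_Ico_consecutive _ (by omega) (by omega)
  have hc1 : (((Ico 1 (l-2)).card : ℕ) : ℝ) = (l:ℝ) - 3 := by
    rw [Nat.card_Ico, show l - 2 - 1 = l - 3 by omega, Nat.cast_sub (by omega)]; norm_num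
  have hc2 : (((Ico (l-2) (l+2)).card : ℕ) : ℝ) = 4 := by
    rw [Nat.card_Ico, show l + 2 - (l-2) = 4 by omega]; norm_num
  have hc3 : (((Ico 1 (l+2)).card : ℕ) : ℝ) = (l:ℝ) + 1 := by
    rw [Nat.card_Ico, show l + 2 - 1 = l + 1 by omega]; push_cast; ring
  have hS1 : ∑ i ∈ Ico 1 (l-2), x i ≤ ((l:ℝ) - 3) * x 0 := by
    rw [← hc1, ← nsmul_eq_mul]
    refine sum_le_card_nsmul _ _ _ fun i hi => ?_
    have := mem_Ico.mp hi
    exact hanti 0 i (by omega) (by omega)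
  have hS2 : ∑ i ∈ Ico (l-2) (l+2), x i ≤ 4 * (τ * x 0) := by
    rw [← hc2, ← nsmul_eq_mul]
    refine sum_le_card_nsmul _ _ _ fun i hi => ?_
    have := mem_Ico.mp hi
    exact (hanti (l-2) i (by omega) (by omega)).trans hb
  have hsqlb : ∀ (s : Finset ℕ) (c : ℝ), 2 * c * ∑ i ∈ s, x i - s.card * c^2 ≤ ∑ i ∈ s, (x i)^2 := by
    intro s c
    have : ∑ i ∈ s, (2 * c * x i - c^2) ≤ ∑ i ∈ s, (x i)^2 :=
      sum_le_sum fun i _ => by nlinarith [sq_nonneg (x i - c)]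
    rw [sum_sub_distrib, ← mul_sum, sum_const, nsmul_eq_mul] at this
    exact this
  have hq1 := hsqlb (Ico 1 (l-2)) (x 0)
  have hq2 := hsqlb (Ico (l-2) (l+2)) (τ * x 0)
  rw [hc1] at hq1
  rw [hc2] at hq2
  have x1 : x 0 < 1 := by
    have : x 1 ≤ ∑ i ∈ Ico 1 (l+2), x i :=
      single_le_sum (fun i _ => hx.1 i) (mem_Ico.mpr ⟨le_rfl, by omega⟩)
    linarith [hpos 1 (by omega)]
  have hder := deriv_bound E (l+2) (by omega) x hE hx p0 x1 hmax
  rw [erase_range] at hder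
  refine final2 ((l:ℝ)+1) (x 0) τ (∑ i ∈ Ico 1 (l+2), (x i)^2) (by linarith) p0 x1 ?_ ?_ ?_ ?_ ?_
  · linarith
  · nlinarith
  · rw [← hc3, ← hsum1, add_sub_cancel_left]
    exact sq_sum_le_card_mul_sum_sq
  · have h1 : (1 - τ) * x 0 * (∑ i ∈ Ico (l-2) (l+2), x i) ≤ (1 - τ) * x 0 * (4 * (τ * x 0)) :=
      mul_le_mul_of_nonneg_left hS2 (mul_nonneg (by linarith) p0.le)
    have h2 : ∑ i ∈ Ico 1 (l-2), x i = 1 - x 0 - ∑ i ∈ Ico (l-2) (l+2), x i := by linarith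
    rw [h2] at hq1
    rw [← hsq2]
    linarith
  · have : ((l:ℝ)+1-1)*(l+1-2)/(l+1)^2 = 6 * lamK (l+1) := by
      unfold lamK
      push_cast
      field_simp
    rw [this]
    linarith

lemma not_bad (n : ℕ) (hn : 4 ≤ n) : ∀ k, n + 1 ≤ k → ¬ Bad n k := by
  intro k
  induction k using Nat.strong_induction_on with
  | _ k ih =>
    intro hk hb
    obtain ⟨E, x, h1, h2, h3, h4, h5, h6, h7, h8⟩ :=
      exists_opt n k hn hk hb (fun j hj hjk => ih j hjk hj)
    rcases Nat.lt_or_ge (n+1) k with h | h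
    · obtain ⟨l, rfl⟩ : ∃ l, k = l + 2 := ⟨k-2, by omega⟩
      exact case1 n l hn (by omega) E x h1 h2 h3 h4 h5 h6 h7 h8 (ih (l+1) (by omega) (by omega))
    · obtain ⟨l, rfl⟩ : ∃ l, n = l + 1 := ⟨n-1, by omega⟩
      obtain rfl : k = l + 2 := by omega
      exact case2 l (by omega) E x h1 h2 h3 h4 h5 h6 h7 h8

lemma lagPoly_le_card (E : Finset (Finset ℕ)) (k : ℕ) (w : ℕ → ℝ) (hw : IsWeighting k w) :
    lagPoly E w ≤ E.card := by
  have : lagPoly E w ≤ ∑ _e ∈ E, (1:ℝ) :=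
    sum_le_sum fun e _ => prod_le_one (fun i _ => hw.1 i) (fun i _ => hw.le_one i)
  simpa using this

lemma lamK_le_lag (n : ℕ) (hn : 4 ≤ n) : lamK n ≤ lag (completeG n 3) := by
  have hn' : (n:ℝ) ≠ 0 := by positivity
  let w : ℕ → ℝ := fun i => if i < n then 1/n else 0
  have hw : IsWeighting n w := by
    refine ⟨?_, ?_, ?_⟩
    · intro i; simp only [w]; split_ifs <;> positivity
    · intro i hi; simp only [w]; rw [if_neg (by omega)]
    · rw [sum_congr rfl (g := fun _ => (1:ℝ)/n) (fun i hi => by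
        simp only [w]; rw [if_pos (mem_range.mp hi)])]
      simp [hn']
  have h := e3_le_s8 n hn w hw
  have h0 : ∑ i ∈ range n, (w i - 1/n)^2 * (3 - 2 * w i - 4/n) = 0 := by
    refine sum_eq_zero fun i hi => ?_
    simp only [w]; rw [if_pos (mem_range.mp hi)]; simp
  rw [h0] at h
  have : lagPoly (completeG n 3) w = lamK n := by unfold completeG; linarith
  rw [← this]
  refine le_csSup ⟨(completeG n 3).card, ?_⟩ ⟨n, w, hw, rfl⟩
  rintro _ ⟨k, v, hv, rfl⟩
  exact lagPoly_le_card _ k v hv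

/-- Weight outside the vertex set can be moved inside. -/
lemma restrict_weights (E : Finset (Finset ℕ)) (k n : ℕ) (hk : 0 < k) (hE : ∀ e ∈ E, e ⊆ range k)
    (w : ℕ → ℝ) (hw : IsWeighting n w) :
    ∃ v, IsWeighting k v ∧ lagPoly E w ≤ lagPoly E v := by
  let c : ℝ := 1 - ∑ i ∈ range k, w i
  have hc : 0 ≤ c := by
    have : ∑ i ∈ range k, w i ≤ 1 := by
      rw [← hw.2.2]
      rcases le_total k n with h | h
      · exact sum_le_sum_of_subset_of_nonneg (range_mono h) (fun i _ _ => hw.1 i)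
      · refine le_of_eq (sum_subset (range_mono h) (fun i _ hi => hw.2.1 i ?_)).symm
        simpa using hi
    simp only [c]; linarith
  let v : ℕ → ℝ := fun i => if i < k then w i + (if i = 0 then c else 0) else 0
  refine ⟨v, ⟨?_, ?_, ?_⟩, ?_⟩
  · intro i
    have := hw.1 i
    simp only [v]; split_ifs <;> linarith
  · intro i hi; simp only [v]; rw [if_neg (by omega)]
  · rw [sum_congr rfl (g := fun i => w i + (if i = 0 then c else 0)) (fun i hi => by
        simp only [v]; rw [if_pos (mem_range.mp hi)])]
    rw [sum_add_distrib, sum_ite_eq' , if_pos (mem_range.mpr hk)]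
    simp only [c]; ring
  · refine sum_le_sum fun e he => prod_le_prod (fun i _ => hw.1 i) (fun i hi => ?_)
    have := mem_range.mp (hE e he hi)
    simp only [v]; rw [if_pos this]
    split_ifs <;> linarith

lemma lag_lt (n : ℕ) (hn : 4 ≤ n) (E : Finset (Finset ℕ)) (huni : ∀ e ∈ E, e.card = 3)
    (hfew : FewEdges n E) (hmax : ∀ s : Finset ℕ, s.powersetCard 3 ⊆ E → s.card < n) :
    lag E < lamK n := by
  classical
  obtain ⟨k, hk, hEk⟩ : ∃ k, 0 < k ∧ ∀ e ∈ E, e ⊆ range k := by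
    refine ⟨(E.sup id).sup id + 1, by omega, fun e he i hi => mem_range.mpr ?_⟩
    have h1 : i ∈ E.sup id := by
      rw [mem_sup]; exact ⟨e, he, hi⟩
    have := le_sup (f := id) h1
    simp only [id] at this ⊢
    omega
  obtain ⟨x, hx, hxmax⟩ := exists_max_weight E k hk
  have hle : lag E ≤ lagPoly E x := by
    refine csSup_le ⟨_, k, x, hx, rfl⟩ ?_
    rintro _ ⟨n', w, hw, rfl⟩
    obtain ⟨v, hv, h⟩ := restrict_weights E k n' hk hEk w hw
    exact h.trans (hxmax v hv)
  refine lt_of_le_of_lt hle ?_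
  obtain ⟨j, F, y, -, -, hy, hypos, -, hF, hFc, hval, hcl⟩ := normalize_weights E huni k x hx
  rw [← hval]
  rcases Nat.lt_or_ge n j with hj | hj
  · by_contra hc
    push Not at hc
    refine not_bad n hn j hj ⟨F, y, hF, ?_, hy, hypos, hc⟩
    unfold FewEdges at hfew ⊢
    omega
  have hyn : IsWeighting n y := by
    refine ⟨hy.1, fun i hi => hy.2.1 i (by omega), ?_⟩
    rw [← hy.2.2]
    refine (sum_subset (range_mono hj) (fun i _ hi => hy.2.1 i ?_)).symm
    simpa using hi
  have hFn : F ⊆ (range n).powersetCard 3 := hF.trans (powersetCard_mono (range_mono hj))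
  rcases hj.lt_or_eq with hj' | hj'
  · exact lt_of_le_of_lt (lagPoly_mono_s8 hFn y hy.1)
      (e3_lt_lam n hn y hyn j hj' (hy.2.1 j le_rfl))
  · subst hj'
    have : ¬ (range j).powersetCard 3 ⊆ F := by
      intro h
      obtain ⟨s', h1, h2⟩ := hcl _ h
      have := hmax s' h2
      rw [h1, card_range] at this
      omega
    obtain ⟨e, he, heF⟩ := not_subset.mp this
    have hlt : lagPoly F y < lagPoly ((range j).powersetCard 3) y := by
      refine sum_lt_sum_of_subset hFn he heF ?_ (fun i _ _ => prod_nonneg fun i _ => hy.1 i)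
      exact prod_pos fun i hi => hypos i (mem_range.mp ((mem_powersetCard.mp he).1 hi))
    exact hlt.trans_le (e3_le_lam j hn y hyn)

/-- A 3-graph with m edges whose maximum clique has order exactly t-2 satisfies
λ(G) < λ([t-1]^{(3)}), for C(t-1,3) ≤ m ≤ C(t-1,3)+C(t-2,2)-(t-2)/2. -/
theorem stmt_8 (m t : ℕ) (hm : 0 < m) (ht : 0 < t)
    (h₁ : (t - 1).choose 3 ≤ m)
    (h₂ : (m : ℝ) ≤ ((t - 1).choose 3 : ℝ) + ((t - 2).choose 2 : ℝ) - ((t : ℝ) - 2) / 2)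
    (E : Finset (Finset ℕ)) (huni : ∀ e ∈ E, e.card = 3) (hmE : E.card = m)
    (hclique : ∃ s : Finset ℕ, s.card = t - 2 ∧ s.powersetCard 3 ⊆ E)
    (hmax : ∀ s : Finset ℕ, s.powersetCard 3 ⊆ E → s.card ≤ t - 2) :
    lag E < lag (completeG (t - 1) 3) := by
  have hm3 : 3 ≤ t - 2 := by
    obtain ⟨e, he⟩ := card_pos.mp (hmE ▸ hm)
    have hc := huni e he
    rw [← hc]
    apply hmax
    rw [← hc, powersetCard_self]
    simpa using he
  have hfew : FewEdges (t-1) E := by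
    unfold FewEdges
    have e1 : t - 1 - 1 = t - 2 := by omega
    rw [e1, hmE]
    have h3 : ((t - 2 : ℕ) : ℝ) = (t:ℝ) - 2 := by rw [Nat.cast_sub (by omega)]; norm_num
    rw [← h3] at h₂
    have : (2 * m + (t-2 : ℕ) : ℝ) ≤ 2 * ((t - 1).choose 3 : ℝ) + 2 * ((t - 2).choose 2 : ℝ) := by
      linarith
    exact_mod_cast this
  exact (lag_lt (t-1) (by omega) E huni hfew (fun s hs => by have := hmax s hs; omega)).trans_le
    (lamK_le_lag (t-1) (by omega))
end
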